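/- arXiv:1712.08956 — 4 statements merged into one kernel-verified Lean document; each statement's English description precedes it below -/
import Mathlib

section
/- Let γ ∈ (0,1), let α < β be real numbers, and let f : [0,∞) × (α,β) → ℝ be continuous and locally Lipschitz continuous in its second variable. Then for every u₀ ∈ (α,β) there exist T_b ∈ (0,∞] and a unique continuous function u : [0,T_b) → (α,β) with u(0) = u₀ satisfying u(t) = u₀ + (1/Γ(γ)) ∫₀ᵗ (t−s)^(γ−1) f(s, u(s)) ds for all t ∈ [0,T_b), which is maximal in the sense that if T_b < ∞ then u leaves every compact subset of (α,β): for every compact K ⊆ (α,β) there exists a sequence tₙ → T_b⁻ with u(tₙ) ∉ K. -/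
open MeasureTheory Set Filter
open scoped ENNReal

/-- The Riemann–Liouville fractional integral of order `γ` based at `0`. -/
noncomputable def riemannLiouville (γ : ℝ) (G : ℝ → ℝ) (t : ℝ) : ℝ :=
  (1 / Real.Gamma γ) * ∫ s in (0:ℝ)..t, (t - s) ^ (γ - 1) * G s

/-- `u` is a continuous solution on `[0,T]` of the Volterra equation
`u = u₀ + I^γ (g(·, u))`. -/
def IsVolterraSolution (γ u₀ : ℝ) (g : ℝ → ℝ → ℝ) (T : ℝ) (u : ℝ → ℝ) : Prop :=
  ContinuousOn u (Icc 0 T) ∧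
    ∀ t ∈ Icc 0 T, u t = u₀ + riemannLiouville γ (fun s => g s (u s)) t

lemma intervalIntegrable_sub_rpow_mul {γ t : ℝ} (hγ : 0 < γ) (ht : 0 ≤ t) {G : ℝ → ℝ}
    (hG : ContinuousOn G (Icc 0 t)) :
    IntervalIntegrable (fun s => (t - s) ^ (γ - 1) * G s) volume 0 t := by
  have h : IntervalIntegrable (fun s : ℝ => s ^ (γ - 1)) volume t 0 :=
    intervalIntegral.intervalIntegrable_rpow' (by linarith)
  have h' := h.comp_sub_left t (by simp)
  rw [sub_self, sub_zero] at h'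
  exact h'.mul_continuousOn (by rwa [uIcc_of_le ht])

lemma riemannLiouville_congr {γ t : ℝ} (ht : 0 ≤ t) {G H : ℝ → ℝ}
    (h : ∀ s ∈ Icc 0 t, G s = H s) : riemannLiouville γ G t = riemannLiouville γ H t := by
  unfold riemannLiouville
  congr 1
  refine intervalIntegral.integral_congr fun s hs => ?_
  rw [uIcc_of_le ht] at hs
  simp only [h s hs]

lemma riemannLiouville_eq_rpow_mul {γ t : ℝ} (hγ : 0 < γ) (ht : 0 ≤ t) (G : ℝ → ℝ) :
    riemannLiouville γ G t =
      (1 / Real.Gamma γ) * (t ^ γ * ∫ r in (0:ℝ)..1, r ^ (γ - 1) * G (t - t * r)) := by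
  unfold riemannLiouville
  congr 1
  rcases ht.eq_or_lt with rfl | ht'
  · simp [Real.zero_rpow hγ.ne']
  have h := intervalIntegral.smul_integral_comp_sub_mul (a := 0) (b := 1)
    (fun s => (t - s) ^ (γ - 1) * G s) t t
  simp only [mul_one, mul_zero, sub_self, sub_zero, sub_sub_cancel] at h
  rw [← h, smul_eq_mul, ← intervalIntegral.integral_const_mul,
    ← intervalIntegral.integral_const_mul]
  refine intervalIntegral.integral_congr fun r hr => ?_
  rw [uIcc_of_le zero_le_one] at hr
  have hpow : t ^ γ = t * t ^ (γ - 1) := by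
    rw [Real.rpow_sub_one ht'.ne']
    field_simp
  simp only [Real.mul_rpow ht hr.1, hpow]
  ring

lemma continuousOn_riemannLiouville {γ C : ℝ} (hγ : 0 < γ) {G : ℝ → ℝ} (hG : Continuous G)
    (hC : ∀ s, |G s| ≤ C) : ContinuousOn (riemannLiouville γ G) (Ici 0) := by
  have hint : Continuous fun t : ℝ => ∫ r in (0:ℝ)..1, r ^ (γ - 1) * G (t - t * r) := by
    refine intervalIntegral.continuous_of_dominated_interval
      (bound := fun r => r ^ (γ - 1) * C) (fun t => ?_) (fun t => ?_) ?_ ?_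
    · refine Measurable.aestronglyMeasurable ?_
      have := hG.measurable
      fun_prop
    · refine Eventually.of_forall fun r hr => ?_
      rw [uIoc_of_le zero_le_one] at hr
      rw [Real.norm_eq_abs, abs_mul, abs_of_nonneg (Real.rpow_nonneg hr.1.le _)]
      exact mul_le_mul_of_nonneg_left (hC _) (Real.rpow_nonneg hr.1.le _)
    · exact (intervalIntegral.intervalIntegrable_rpow' (by linarith)).mul_const C
    · exact Eventually.of_forall fun r _ => by fun_prop
  have hmain : Continuous fun t : ℝ =>
      (1 / Real.Gamma γ) * (t ^ γ * ∫ r in (0:ℝ)..1, r ^ (γ - 1) * G (t - t * r)) :=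
    continuous_const.mul ((Real.continuous_rpow_const hγ.le).mul hint)
  exact hmain.continuousOn.congr fun t ht => riemannLiouville_eq_rpow_mul hγ ht G

lemma integrableOn_rpow_mul_exp_neg {γ l : ℝ} (hγ : 0 < γ) (hl : 0 < l) :
    IntegrableOn (fun r : ℝ => r ^ (γ - 1) * Real.exp (-(l * r))) (Ioi 0) := by
  have h := integrableOn_rpow_mul_exp_neg_mul_rpow (p := 1) (s := γ - 1) (b := l)
    (by linarith) one_pos hl
  simpa using h

/-- The fractional integral is a contraction of ratio `λ⁻ᵞ` for the sup norm with weight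
`exp (-λ t)`. -/
lemma abs_riemannLiouville_sub_le {γ l t M : ℝ} (hγ : 0 < γ) (hl : 0 < l) (ht : 0 ≤ t)
    (hM : 0 ≤ M) {G H : ℝ → ℝ} (hG : ContinuousOn G (Icc 0 t)) (hH : ContinuousOn H (Icc 0 t))
    (hGH : ∀ s ∈ Icc 0 t, |G s - H s| ≤ M * Real.exp (l * s)) :
    |riemannLiouville γ G t - riemannLiouville γ H t| ≤
      M * Real.exp (l * t) * (1 / l) ^ γ := by
  have hΓ := Real.Gamma_pos_of_pos hγ
  have hbound : ∫ s in (0:ℝ)..t, (t - s) ^ (γ - 1) * (M * Real.exp (l * s)) ≤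
      M * Real.exp (l * t) * ((1 / l) ^ γ * Real.Gamma γ) := by
    rw [← Real.integral_rpow_mul_exp_neg_mul_Ioi hγ hl]
    have h := intervalIntegral.integral_comp_sub_left (a := 0) (b := t)
      (fun r => M * Real.exp (l * t) * (r ^ (γ - 1) * Real.exp (-(l * r)))) t
    have h' : ∫ s in (0:ℝ)..t, (t - s) ^ (γ - 1) * (M * Real.exp (l * s)) =
        ∫ s in (0:ℝ)..t, M * Real.exp (l * t) *
          ((t - s) ^ (γ - 1) * Real.exp (-(l * (t - s)))) := by
      refine intervalIntegral.integral_congr fun s _ => ?_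
      have : Real.exp (l * s) = Real.exp (l * t) * Real.exp (-(l * (t - s))) := by
        rw [← Real.exp_add]
        ring_nf
      simp only [this]
      ring
    rw [h', h, sub_self, sub_zero, intervalIntegral.integral_const_mul,
      intervalIntegral.integral_of_le ht]
    refine mul_le_mul_of_nonneg_left ?_ (by positivity)
    refine setIntegral_mono_set (integrableOn_rpow_mul_exp_neg hγ hl) ?_
      Ioc_subset_Ioi_self.eventuallyLE
    filter_upwards [ae_restrict_mem measurableSet_Ioi] with r hr
    exact mul_nonneg (Real.rpow_nonneg (le_of_lt hr) _) (Real.exp_pos _).le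
  have hdiff : |(∫ s in (0:ℝ)..t, (t - s) ^ (γ - 1) * G s) -
      ∫ s in (0:ℝ)..t, (t - s) ^ (γ - 1) * H s| ≤
      ∫ s in (0:ℝ)..t, (t - s) ^ (γ - 1) * (M * Real.exp (l * s)) := by
    rw [← intervalIntegral.integral_sub (intervalIntegrable_sub_rpow_mul hγ ht hG)
      (intervalIntegrable_sub_rpow_mul hγ ht hH), ← Real.norm_eq_abs]
    refine intervalIntegral.norm_integral_le_of_norm_le ht (Eventually.of_forall fun s hs => ?_)
      (intervalIntegrable_sub_rpow_mul hγ ht (by fun_prop))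
    have hp : 0 ≤ (t - s) ^ (γ - 1) := Real.rpow_nonneg (by linarith [hs.2]) _
    rw [← mul_sub, Real.norm_eq_abs, abs_mul, abs_of_nonneg hp]
    exact mul_le_mul_of_nonneg_left (hGH s (Ioc_subset_Icc_self hs)) hp
  unfold riemannLiouville
  rw [← mul_sub, abs_mul, abs_of_pos (by positivity : 0 < 1 / Real.Gamma γ)]
  calc _ ≤ 1 / Real.Gamma γ * (M * Real.exp (l * t) * ((1 / l) ^ γ * Real.Gamma γ)) := by
        gcongr
        exact hdiff.trans hbound
    _ = _ := by field_simp

lemma exists_pos_mul_one_div_rpow_le_half {γ L : ℝ} (hγ : 0 < γ) (hL : 0 ≤ L) :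
    ∃ l : ℝ, 0 < l ∧ L * (1 / l) ^ γ ≤ 1 / 2 := by
  have hpos : 0 < 2 * L + 1 := by linarith
  refine ⟨(2 * L + 1) ^ (1 / γ), Real.rpow_pos_of_pos hpos _, ?_⟩
  rw [Real.div_rpow zero_le_one (by positivity), ← Real.rpow_mul hpos.le,
    one_div_mul_cancel hγ.ne', Real.rpow_one, Real.one_rpow, mul_one_div,
    div_le_div_iff₀ hpos two_pos]
  linarith

namespace IsVolterraSolution

variable {γ u₀ T : ℝ} {g h : ℝ → ℝ → ℝ} {u v : ℝ → ℝ}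

lemma mono {T' : ℝ} (hu : IsVolterraSolution γ u₀ g T u) (hT : T' ≤ T) :
    IsVolterraSolution γ u₀ g T' u :=
  ⟨hu.1.mono (Icc_subset_Icc_right hT), fun t ht => hu.2 t ⟨ht.1, ht.2.trans hT⟩⟩

lemma congr_rhs (hu : IsVolterraSolution γ u₀ g T u)
    (hgh : ∀ s ∈ Icc 0 T, g s (u s) = h s (u s)) : IsVolterraSolution γ u₀ h T u :=
  ⟨hu.1, fun t ht => (hu.2 t ht).trans <| congrArg (u₀ + ·) <|
    riemannLiouville_congr ht.1 fun s hs => hgh s ⟨hs.1, hs.2.trans ht.2⟩⟩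

lemma apply_zero (hu : IsVolterraSolution γ u₀ g T u) (hT : 0 ≤ T) : u 0 = u₀ := by
  simpa [riemannLiouville] using hu.2 0 ⟨le_rfl, hT⟩

lemma eqOn {L : ℝ} (hγ : 0 < γ) (hL : 0 ≤ L)
    (hu : IsVolterraSolution γ u₀ g T u) (hv : IsVolterraSolution γ u₀ g T v)
    (hgu : ContinuousOn (fun s => g s (u s)) (Icc 0 T))
    (hgv : ContinuousOn (fun s => g s (v s)) (Icc 0 T))
    (hlip : ∀ s ∈ Icc 0 T, |g s (u s) - g s (v s)| ≤ L * |u s - v s|) :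
    EqOn u v (Icc 0 T) := by
  rcases (Icc (0:ℝ) T).eq_empty_or_nonempty with he | hne
  · simp [he]
  obtain ⟨l, hl, hlL⟩ := exists_pos_mul_one_div_rpow_le_half hγ hL
  obtain ⟨r, hr, hmax⟩ := isCompact_Icc.exists_isMaxOn hne
    (f := fun t => Real.exp (-(l * t)) * |u t - v t|)
    (ContinuousOn.mul (by fun_prop) (hu.1.sub hv.1).abs)
  set M := Real.exp (-(l * r)) * |u r - v r| with hMdef
  have hM : 0 ≤ M := by positivity
  have hle : ∀ s ∈ Icc 0 T, |u s - v s| ≤ M * Real.exp (l * s) := fun s hs => by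
    have h1 : Real.exp (-(l * s)) * |u s - v s| ≤ M := hmax hs
    calc |u s - v s| = Real.exp (-(l * s)) * |u s - v s| * Real.exp (l * s) := by
          rw [mul_right_comm, ← Real.exp_add]
          simp
      _ ≤ _ := by gcongr
  have hsub : Icc 0 r ⊆ Icc 0 T := Icc_subset_Icc_right hr.2
  have hr' : |u r - v r| ≤ L * M * Real.exp (l * r) * (1 / l) ^ γ := by
    rw [hu.2 r hr, hv.2 r hr, add_sub_add_left_eq_sub]
    refine abs_riemannLiouville_sub_le hγ hl hr.1 (by positivity) (hgu.mono hsub)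
      (hgv.mono hsub) fun s hs => (hlip s (hsub hs)).trans ?_
    rw [mul_assoc]
    exact mul_le_mul_of_nonneg_left (hle s (hsub hs)) hL
  have hM2 : M ≤ M * (L * (1 / l) ^ γ) := by
    calc M ≤ Real.exp (-(l * r)) * (L * M * Real.exp (l * r) * (1 / l) ^ γ) := by
          rw [hMdef]
          gcongr
      _ = Real.exp (-(l * r)) * Real.exp (l * r) * (M * (L * (1 / l) ^ γ)) := by ring
      _ = _ := by rw [← Real.exp_add]; simp
  have hM0 : M ≤ 0 := by nlinarith
  intro s hs
  have h2 := hle s hs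
  have h3 : M * Real.exp (l * s) ≤ 0 := mul_nonpos_of_nonpos_of_nonneg hM0 (Real.exp_pos _).le
  exact sub_eq_zero.1 (abs_nonpos_iff.1 (h2.trans h3))

/-- Global existence for a bounded continuous right-hand side that is Lipschitz in the state. -/
lemma exists_of_bounded_lipschitz {L C : ℝ} (hγ : 0 < γ) (hT : 0 ≤ T) (hL : 0 ≤ L)
    (hg : Continuous fun p : ℝ × ℝ => g p.1 p.2) (hC : ∀ t x, |g t x| ≤ C)
    (hlip : ∀ t x y, |g t x - g t y| ≤ L * |x - y|) :
    ∃ w, Continuous w ∧ IsVolterraSolution γ u₀ g T w := by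
  obtain ⟨l, hl, hlL⟩ := exists_pos_mul_one_div_rpow_le_half hγ hL
  set W : C(Icc 0 T, ℝ) → ℝ → ℝ := fun z t => Real.exp (l * t) * IccExtend hT z t with hW
  have hWc : ∀ z, Continuous (W z) := fun z =>
    Continuous.mul (by fun_prop) z.continuous.Icc_extend'
  have hGc : ∀ z, Continuous fun s => g s (W z s) := fun z =>
    hg.comp (continuous_id.prodMk (hWc z))
  have hcont : ∀ z, ContinuousOn (riemannLiouville γ fun s => g s (W z s)) (Ici 0) := fun z =>
    continuousOn_riemannLiouville hγ (hGc z) fun s => hC s _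
  set Φ : C(Icc 0 T, ℝ) → C(Icc 0 T, ℝ) := fun z =>
    ⟨fun t => Real.exp (-(l * t)) * (u₀ + riemannLiouville γ (fun s => g s (W z s)) t), by
      have := (hcont z).comp_continuous continuous_subtype_val fun t : Icc 0 T => t.2.1
      fun_prop⟩ with hΦ
  have hcontr : ContractingWith (1 / 2) Φ := by
    refine ⟨by norm_num, LipschitzWith.of_dist_le_mul fun z y => ?_⟩
    rw [ContinuousMap.dist_le (by positivity)]
    intro t
    have hd : |riemannLiouville γ (fun s => g s (W z s)) t -
        riemannLiouville γ (fun s => g s (W y s)) t| ≤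
        L * dist z y * Real.exp (l * t) * (1 / l) ^ γ := by
      refine abs_riemannLiouville_sub_le hγ hl t.2.1 (by positivity) (hGc z).continuousOn
        (hGc y).continuousOn fun s _ => (hlip s _ _).trans ?_
      rw [mul_assoc]
      refine mul_le_mul_of_nonneg_left ?_ hL
      simp only [hW]
      rw [← mul_sub, abs_mul, abs_of_pos (Real.exp_pos _), mul_comm]
      exact mul_le_mul_of_nonneg_right
        (ContinuousMap.dist_apply_le_dist (f := z) (g := y) (projIcc 0 T hT s)) (Real.exp_pos _).le
    have hexp : Real.exp (-(l * t)) * Real.exp (l * t) = 1 := by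
      rw [← Real.exp_add]
      simp
    calc dist (Φ z t) (Φ y t) = Real.exp (-(l * t)) *
          |riemannLiouville γ (fun s => g s (W z s)) t -
            riemannLiouville γ (fun s => g s (W y s)) t| := by
          simp only [hΦ, ContinuousMap.coe_mk, Real.dist_eq]
          rw [← mul_sub, add_sub_add_left_eq_sub, abs_mul, abs_of_pos (Real.exp_pos _)]
      _ ≤ Real.exp (-(l * t)) * (L * dist z y * Real.exp (l * t) * (1 / l) ^ γ) := by gcongr
      _ = Real.exp (-(l * t)) * Real.exp (l * t) * (L * (1 / l) ^ γ) * dist z y := by ring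
      _ ≤ _ := by
          rw [hexp, one_mul]
          exact mul_le_mul_of_nonneg_right (by simpa using hlL) dist_nonneg
  set z := ContractingWith.fixedPoint Φ hcontr
  have hz : Φ z = z := hcontr.fixedPoint_isFixedPt
  refine ⟨W z, hWc z, (hWc z).continuousOn, fun t ht => ?_⟩
  have hzt : z ⟨t, ht⟩ = Real.exp (-(l * t)) *
      (u₀ + riemannLiouville γ (fun s => g s (W z s)) t) := by
    conv_lhs => rw [← hz]
    rfl
  change Real.exp (l * t) * IccExtend hT z t = _
  rw [IccExtend_of_mem hT z ht, hzt, ← mul_assoc, ← Real.exp_add]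
  simp

end IsVolterraSolution

lemma exists_Icc_superset_of_isCompact {α β : ℝ} {K : Set ℝ} (hK : IsCompact K)
    (hne : K.Nonempty) (hsub : K ⊆ Ioo α β) : ∃ a b, α < a ∧ b < β ∧ K ⊆ Icc a b := by
  obtain ⟨a, ha⟩ := hK.exists_isLeast hne
  obtain ⟨b, hb⟩ := hK.exists_isGreatest hne
  exact ⟨a, b, (hsub ha.1).1, (hsub hb.1).2, fun x hx => ⟨ha.2 hx, hb.2 hx⟩⟩

/-- `f` is Lipschitz in its second variable on `(α,β)`, locally uniformly in both variables. -/
def LocallyLipschitzInState (α β : ℝ) (f : ℝ → ℝ → ℝ) : Prop :=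
  ∀ t₀ x₀ : ℝ, 0 ≤ t₀ → x₀ ∈ Ioo α β → ∃ ε > (0:ℝ), ∃ L ≥ (0:ℝ),
    ∀ t, 0 ≤ t → |t - t₀| ≤ ε →
      ∀ x ∈ Ioo α β, ∀ y ∈ Ioo α β, |x - x₀| ≤ ε → |y - x₀| ≤ ε →
        |f t x - f t y| ≤ L * |x - y|

section LocalLipschitz

variable {γ α β : ℝ} {f : ℝ → ℝ → ℝ}

lemma exists_bound_on_rectangle
    (hf : ContinuousOn (fun p : ℝ × ℝ => f p.1 p.2) (Ici 0 ×ˢ Ioo α β))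
    {a b : ℝ} (ha : α < a) (hb : b < β) (T : ℝ) :
    ∃ C, ∀ t ∈ Icc 0 T, ∀ x ∈ Icc a b, |f t x| ≤ C := by
  obtain ⟨C, hC⟩ := (isCompact_Icc.prod isCompact_Icc).exists_bound_of_continuousOn
    (hf.mono (prod_mono (Icc_subset_Ici_self : Icc 0 T ⊆ Ici 0) (Icc_subset_Ioo ha hb)))
  exact ⟨C, fun t ht x hx => hC (t, x) ⟨ht, hx⟩⟩

lemma LocallyLipschitzInState.exists_lipschitz_on_rectangle
    (hlip : LocallyLipschitzInState α β f)
    (hf : ContinuousOn (fun p : ℝ × ℝ => f p.1 p.2) (Ici 0 ×ˢ Ioo α β))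
    {a b : ℝ} (ha : α < a) (hb : b < β) (T : ℝ) :
    ∃ L ≥ (0:ℝ), ∀ t ∈ Icc 0 T, ∀ x ∈ Icc a b, ∀ y ∈ Icc a b,
      |f t x - f t y| ≤ L * |x - y| := by
  obtain ⟨C, hC⟩ := exists_bound_on_rectangle hf ha hb T
  have hsub : Icc a b ⊆ Ioo α β := Icc_subset_Ioo ha hb
  set D : Set (ℝ × ℝ × ℝ) := Icc 0 T ×ˢ Icc a b ×ˢ Icc a b
  have hcompact : IsCompact D := isCompact_Icc.prod (isCompact_Icc.prod isCompact_Icc)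
  have key : ∃ L ≥ (0:ℝ), ∀ p ∈ D, p ∈ D →
      |f p.1 p.2.1 - f p.1 p.2.2| ≤ L * |p.2.1 - p.2.2| := by
    refine hcompact.induction_on (p := fun S => ∃ L ≥ (0:ℝ), ∀ p ∈ S, p ∈ D →
      |f p.1 p.2.1 - f p.1 p.2.2| ≤ L * |p.2.1 - p.2.2|) ⟨0, le_rfl, by simp⟩ ?_ ?_ ?_
    · rintro S S' hS ⟨L, hL, h⟩
      exact ⟨L, hL, fun p hp => h p (hS hp)⟩
    · rintro S S' ⟨L, hL, h⟩ ⟨L', hL', h'⟩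
      refine ⟨max L L', le_max_of_le_left hL, fun p hp hpD => ?_⟩
      rcases hp with hp | hp
      · exact (h p hp hpD).trans (by gcongr; exact le_max_left _ _)
      · exact (h' p hp hpD).trans (by gcongr; exact le_max_right _ _)
    · rintro ⟨t₀, x₀, y₀⟩ ⟨ht₀, hx₀, hy₀⟩
      dsimp only at ht₀ hx₀ hy₀
      rcases eq_or_ne x₀ y₀ with rfl | hne
      · obtain ⟨ε, hε, L, hL, h⟩ := hlip t₀ x₀ ht₀.1 (hsub hx₀)
        refine ⟨Metric.closedBall (t₀, x₀, x₀) ε,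
          mem_nhdsWithin_of_mem_nhds (Metric.closedBall_mem_nhds _ hε), L, hL, ?_⟩
        rintro ⟨t, x, y⟩ hp ⟨ht, hx, hy⟩
        simp only [Metric.mem_closedBall, Prod.dist_eq, sup_le_iff, Real.dist_eq] at hp
        exact h t ht.1 hp.1 x (hsub hx) y (hsub hy) hp.2.1 hp.2.2
      · set d := |x₀ - y₀| / 2
        have hxy : 0 < |x₀ - y₀| := abs_pos.2 (sub_ne_zero.2 hne)
        have hd0 : 0 < d := half_pos hxy
        have hC0 : 0 ≤ C := (abs_nonneg _).trans (hC t₀ ht₀ x₀ hx₀)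
        have hopen : ∀ᶠ p : ℝ × ℝ × ℝ in nhds (t₀, x₀, y₀), d < |p.2.1 - p.2.2| :=
          (by fun_prop : Continuous fun p : ℝ × ℝ × ℝ => |p.2.1 - p.2.2|).continuousAt.eventually
            (lt_mem_nhds (half_lt_self hxy))
        refine ⟨_, mem_nhdsWithin_of_mem_nhds hopen, 2 * C / d, by positivity, ?_⟩
        rintro ⟨t, x, y⟩ hp ⟨ht, hx, hy⟩
        have hp' : d < |x - y| := hp
        calc |f t x - f t y| ≤ |f t x| + |f t y| := abs_sub _ _
          _ ≤ 2 * C := by linarith [hC t ht x hx, hC t ht y hy]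
          _ = 2 * C / d * d := by field_simp
          _ ≤ 2 * C / d * |x - y| := by gcongr
  obtain ⟨L, hL, h⟩ := key
  exact ⟨L, hL, fun t ht x hx y hy => h (t, x, y) ⟨ht, hx, hy⟩ ⟨ht, hx, hy⟩⟩

/-- Truncation of the right-hand side to a compact rectangle. -/
lemma LocallyLipschitzInState.exists_truncation (hlip : LocallyLipschitzInState α β f)
    (hf : ContinuousOn (fun p : ℝ × ℝ => f p.1 p.2) (Ici 0 ×ˢ Ioo α β))
    {a b T : ℝ} (ha : α < a) (hab : a ≤ b) (hb : b < β) (hT : 0 ≤ T) :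
    ∃ (g : ℝ → ℝ → ℝ) (L C : ℝ), 0 ≤ L ∧ Continuous (fun p : ℝ × ℝ => g p.1 p.2) ∧
      (∀ t x, |g t x| ≤ C) ∧ (∀ t x y, |g t x - g t y| ≤ L * |x - y|) ∧
      ∀ t ∈ Icc 0 T, ∀ x ∈ Icc a b, g t x = f t x := by
  obtain ⟨C, hC⟩ := exists_bound_on_rectangle hf ha hb T
  obtain ⟨L, hL, h⟩ := hlip.exists_lipschitz_on_rectangle hf ha hb T
  refine ⟨fun t x => f (projIcc 0 T hT t) (projIcc a b hab x), L, C, hL, ?_,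
    fun t x => hC _ (projIcc 0 T hT t).2 _ (projIcc a b hab x).2, fun t x y => ?_,
    fun t ht x hx => by simp only [projIcc_of_mem hT ht, projIcc_of_mem hab hx]⟩
  · refine hf.comp_continuous
      (f := fun p : ℝ × ℝ => ((projIcc 0 T hT p.1 : ℝ), (projIcc a b hab p.2 : ℝ))) ?_ ?_
    · exact (continuous_subtype_val.comp (continuous_projIcc.comp continuous_fst)).prodMk
        (continuous_subtype_val.comp (continuous_projIcc.comp continuous_snd))
    · exact fun p => ⟨(projIcc 0 T hT p.1).2.1, Icc_subset_Ioo ha hb (projIcc a b hab p.2).2⟩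
  · exact (h _ (projIcc 0 T hT t).2 _ (projIcc a b hab x).2 _ (projIcc a b hab y).2).trans
      (mul_le_mul_of_nonneg_left (abs_projIcc_sub_projIcc hab) hL)

lemma continuousOn_rhs_comp
    (hf : ContinuousOn (fun p : ℝ × ℝ => f p.1 p.2) (Ici 0 ×ˢ Ioo α β))
    {T : ℝ} {u : ℝ → ℝ} (hu : ContinuousOn u (Icc 0 T)) (hmem : MapsTo u (Icc 0 T) (Ioo α β)) :
    ContinuousOn (fun s => f s (u s)) (Icc 0 T) :=
  hf.comp (f := fun s => (s, u s)) (continuousOn_id.prodMk hu) fun _ hs => ⟨hs.1, hmem hs⟩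

lemma LocallyLipschitzInState.eqOn_of_isVolterraSolution (hlip : LocallyLipschitzInState α β f)
    (hf : ContinuousOn (fun p : ℝ × ℝ => f p.1 p.2) (Ici 0 ×ˢ Ioo α β))
    (hγ : 0 < γ) {u₀ T : ℝ} (hT : 0 ≤ T) {u v : ℝ → ℝ}
    (hu : IsVolterraSolution γ u₀ f T u) (hum : MapsTo u (Icc 0 T) (Ioo α β))
    (hv : IsVolterraSolution γ u₀ f T v) (hvm : MapsTo v (Icc 0 T) (Ioo α β)) :
    EqOn u v (Icc 0 T) := by
  obtain ⟨a, b, ha, hb, hK⟩ := exists_Icc_superset_of_isCompact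
    ((isCompact_Icc.image_of_continuousOn hu.1).union (isCompact_Icc.image_of_continuousOn hv.1))
    ⟨u 0, Or.inl (mem_image_of_mem u ⟨le_rfl, hT⟩)⟩
    (union_subset hum.image_subset hvm.image_subset)
  obtain ⟨L, hL, h⟩ := hlip.exists_lipschitz_on_rectangle hf ha hb T
  exact hu.eqOn hγ hL hv (continuousOn_rhs_comp hf hu.1 hum) (continuousOn_rhs_comp hf hv.1 hvm)
    fun s hs => h s hs _ (hK (Or.inl (mem_image_of_mem u hs))) _
      (hK (Or.inr (mem_image_of_mem v hs)))

/-- A solution on `[0,T)` which stays in a compact interval can be continued beyond `T`. -/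
lemma LocallyLipschitzInState.exists_extension (hlip : LocallyLipschitzInState α β f)
    (hf : ContinuousOn (fun p : ℝ × ℝ => f p.1 p.2) (Ici 0 ×ˢ Ioo α β))
    (hγ : 0 < γ) {u₀ T a b : ℝ} (hT : 0 ≤ T) (ha : α < a) (hb : b < β) (hu₀ : u₀ ∈ Icc a b)
    {u : ℝ → ℝ} (hu : ∀ t ∈ Ico 0 T, IsVolterraSolution γ u₀ f t u)
    (hum : MapsTo u (Ico 0 T) (Icc a b)) :
    ∃ T' > T, ∃ v, IsVolterraSolution γ u₀ f T' v ∧ MapsTo v (Icc 0 T') (Ioo α β) := by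
  obtain ⟨a', ha', haa'⟩ := exists_between ha
  obtain ⟨b', hbb', hb'⟩ := exists_between hb
  have hab : a ≤ b := hu₀.1.trans hu₀.2
  have hIoo : Icc a b ⊆ Ioo a' b' := Icc_subset_Ioo haa' hbb'
  have hT1 : 0 ≤ T + 1 := by linarith
  obtain ⟨g, L, C, hL, hgc, hC, hgl, hgf⟩ :=
    hlip.exists_truncation hf ha' (by linarith : a' ≤ b') hb' hT1
  obtain ⟨w, hwc, hw⟩ := IsVolterraSolution.exists_of_bounded_lipschitz (u₀ := u₀)
    hγ hT1 hL hgc hC hgl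
  have heq : ∀ t ∈ Ico 0 T, w t = u t := fun t ht => by
    have hut : IsVolterraSolution γ u₀ g t u := (hu t ht).congr_rhs fun s hs =>
      (hgf s ⟨hs.1, by linarith [hs.2, ht.2]⟩ _ (Ioo_subset_Icc_self
        (hIoo (hum ⟨hs.1, hs.2.trans_lt ht.2⟩)))).symm
    exact (hw.mono (by linarith [ht.2])).eqOn hγ hL hut
      (hgc.comp (continuous_id.prodMk hwc)).continuousOn
      (hgc.comp_continuousOn (continuousOn_id.prodMk hut.1)) (fun s _ => hgl s _ _) ⟨ht.1, le_rfl⟩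
  have hw0 : w 0 ∈ Icc a b := by rwa [hw.apply_zero hT1]
  have hwIco : MapsTo w (Ico 0 T) (Icc a b) := fun t ht => by
    rw [heq t ht]
    exact hum ht
  have hwIcc : MapsTo w (Icc 0 T) (Icc a b) := by
    rcases hT.eq_or_lt with rfl | hT'
    · intro t ht
      rwa [le_antisymm ht.2 ht.1]
    · rw [← closure_Ico hT'.ne]
      exact hwIco.closure_of_continuousOn hwc.continuousOn |>.mono_right isClosed_Icc.closure_eq.le
  have hev : ∀ᶠ t in nhds T, w t ∈ Ioo a' b' :=
    hwc.continuousAt (isOpen_Ioo.mem_nhds (hIoo (hwIcc ⟨hT, le_rfl⟩)))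
  obtain ⟨δ, hδ, hball⟩ := Metric.eventually_nhds_iff.1 hev
  have hδ' : 0 < min (δ / 2) 1 := by positivity
  have hwm : MapsTo w (Icc 0 (T + min (δ / 2) 1)) (Ioo a' b') := fun t ht => by
    rcases le_or_gt t T with h | h
    · exact hIoo (hwIcc ⟨ht.1, h⟩)
    · refine hball ?_
      rw [Real.dist_eq, abs_of_pos (by linarith)]
      linarith [ht.2, min_le_left (δ / 2) 1]
  have hle : T + min (δ / 2) 1 ≤ T + 1 := by linarith [min_le_right (δ / 2) 1]
  exact ⟨T + min (δ / 2) 1, by linarith, w, (hw.mono hle).congr_rhs fun s hs =>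
    hgf s ⟨hs.1, hs.2.trans hle⟩ _ (Ioo_subset_Icc_self (hwm hs)),
    hwm.mono_right (Ioo_subset_Ioo ha'.le hb'.le)⟩

end LocalLipschitz

/-- Existence and uniqueness of a maximal continuous solution of the
Volterra integral formulation of the fractional ODE `D_c^γ u = f(t,u)` on `(α,β)`. -/
theorem fractional_ode_existence_uniqueness_maximal
    (γ α β : ℝ) (hγ : γ ∈ Set.Ioo (0:ℝ) 1) (hαβ : α < β)
    (f : ℝ → ℝ → ℝ)
    (hf_cont : ContinuousOn (fun p : ℝ × ℝ => f p.1 p.2) (Set.Ici 0 ×ˢ Set.Ioo α β))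
    (hf_lip : ∀ t₀ x₀ : ℝ, 0 ≤ t₀ → x₀ ∈ Set.Ioo α β → ∃ ε > (0:ℝ), ∃ L ≥ (0:ℝ),
      ∀ t, 0 ≤ t → |t - t₀| ≤ ε →
        ∀ x ∈ Set.Ioo α β, ∀ y ∈ Set.Ioo α β, |x - x₀| ≤ ε → |y - x₀| ≤ ε →
          |f t x - f t y| ≤ L * |x - y|)
    (u₀ : ℝ) (hu₀ : u₀ ∈ Set.Ioo α β) :
    ∃ (Tb : ℝ≥0∞) (u : ℝ → ℝ), 0 < Tb ∧
      u 0 = u₀ ∧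
      (∀ t : ℝ, 0 ≤ t → ENNReal.ofReal t < Tb → u t ∈ Set.Ioo α β) ∧
      ContinuousOn u {t : ℝ | 0 ≤ t ∧ ENNReal.ofReal t < Tb} ∧
      (∀ t : ℝ, 0 ≤ t → ENNReal.ofReal t < Tb →
        u t = u₀ + (1 / Real.Gamma γ) * ∫ s in (0:ℝ)..t, (t - s) ^ (γ - 1) * f s (u s)) ∧
      (∀ v : ℝ → ℝ, v 0 = u₀ →
        (∀ t : ℝ, 0 ≤ t → ENNReal.ofReal t < Tb → v t ∈ Set.Ioo α β) →
        ContinuousOn v {t : ℝ | 0 ≤ t ∧ ENNReal.ofReal t < Tb} →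
        (∀ t : ℝ, 0 ≤ t → ENNReal.ofReal t < Tb →
          v t = u₀ + (1 / Real.Gamma γ) * ∫ s in (0:ℝ)..t, (t - s) ^ (γ - 1) * f s (v s)) →
        ∀ t : ℝ, 0 ≤ t → ENNReal.ofReal t < Tb → v t = u t) ∧
      (Tb < ⊤ → ∀ K : Set ℝ, IsCompact K → K ⊆ Set.Ioo α β →
        ∃ tseq : ℕ → ℝ, (∀ n, 0 ≤ tseq n ∧ tseq n < Tb.toReal) ∧
          Filter.Tendsto tseq Filter.atTop (nhds Tb.toReal) ∧ ∀ n, u (tseq n) ∉ K) := by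
  have hlip : LocallyLipschitzInState α β f := hf_lip
  have hγ0 := hγ.1
  set S : Set ℝ := {T | 0 ≤ T ∧
    ∃ v, IsVolterraSolution γ u₀ f T v ∧ MapsTo v (Icc 0 T) (Ioo α β)}
  have hext : ∀ {T a b : ℝ}, 0 ≤ T → α < a → b < β → u₀ ∈ Icc a b → ∀ {u : ℝ → ℝ},
      (∀ t ∈ Ico 0 T, IsVolterraSolution γ u₀ f t u) → MapsTo u (Ico 0 T) (Icc a b) →
      ∃ T' ∈ S, T < T' := fun hT ha hb hu₀ _ hu hum => by
    obtain ⟨T', hT', v, hv, hvm⟩ := hlip.exists_extension hf_cont hγ0 hT ha hb hu₀ hu hum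
    exact ⟨T', ⟨hT.trans hT'.le, v, hv, hvm⟩, hT'⟩
  choose! V hV using fun T (hT : T ∈ S) => hT.2
  set u : ℝ → ℝ := fun t => V t t
  set Tb : ℝ≥0∞ := sSup (ENNReal.ofReal '' S)
  have hsol : ∀ T ∈ S, IsVolterraSolution γ u₀ f T u ∧ MapsTo u (Icc 0 T) (Ioo α β) := by
    intro T hT
    have hVu : EqOn (V T) u (Icc 0 T) := fun t ht => by
      have htV := (hV T hT).1.mono ht.2
      have htm := (hV T hT).2.mono_left (Icc_subset_Icc_right ht.2)
      have htS : t ∈ S := ⟨ht.1, V T, htV, htm⟩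
      exact hlip.eqOn_of_isVolterraSolution hf_cont hγ0 ht.1 htV htm (hV t htS).1 (hV t htS).2
        ⟨ht.1, le_rfl⟩
    refine ⟨⟨(hV T hT).1.1.congr hVu.symm, fun t ht => ?_⟩, (hV T hT).2.congr hVu⟩
    rw [← hVu ht, (hV T hT).1.2 t ht]
    exact congrArg (u₀ + ·) (riemannLiouville_congr ht.1 fun s hs => by
      rw [hVu ⟨hs.1, hs.2.trans ht.2⟩])
  have hlt : ∀ t : ℝ, ENNReal.ofReal t < Tb → ∃ T ∈ S, t < T := fun t ht => by
    obtain ⟨_, ⟨T, hT, rfl⟩, h⟩ := lt_sSup_iff.1 ht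
    exact ⟨T, hT, ENNReal.ofReal_lt_ofReal_iff'.1 h |>.1⟩
  have hsol' : ∀ t : ℝ, ENNReal.ofReal t < Tb →
      IsVolterraSolution γ u₀ f t u ∧ MapsTo u (Icc 0 t) (Ioo α β) := fun t ht => by
    obtain ⟨T, hT, htT⟩ := hlt t ht
    exact ⟨(hsol T hT).1.mono htT.le, (hsol T hT).2.mono_left (Icc_subset_Icc_right htT.le)⟩
  have hle : ∀ T ∈ S, ENNReal.ofReal T ≤ Tb := fun T hT => le_sSup (mem_image_of_mem _ hT)
  have hTb0 : 0 < Tb := by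
    obtain ⟨T, hT, h0⟩ := hext le_rfl hu₀.1 hu₀.2 ⟨le_rfl, le_rfl⟩ (u := u)
      (by simp) (by simp [MapsTo])
    exact (ENNReal.ofReal_pos.2 h0).trans_le (hle T hT)
  have hu0 : u 0 = u₀ := (hsol' 0 (by simpa using hTb0)).1.apply_zero le_rfl
  refine ⟨Tb, u, hTb0, hu0, fun t h0 ht => (hsol' t ht).2 ⟨h0, le_rfl⟩, fun t ht => ?_,
    fun t h0 ht => (hsol' t ht).1.2 t ⟨h0, le_rfl⟩, ?_, ?_⟩
  · obtain ⟨T, hT, htT⟩ := hlt t ht.2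
    refine ((hsol T hT).1.1 t ⟨ht.1, htT.le⟩).mono_of_mem_nhdsWithin ?_
    filter_upwards [self_mem_nhdsWithin, mem_nhdsWithin_of_mem_nhds (Iio_mem_nhds htT)]
      with s hs hsT using ⟨hs.1, le_of_lt hsT⟩
  · intro v _ hvm hvc hv t h0 ht
    have hs : ∀ s ∈ Icc 0 t, ENNReal.ofReal s < Tb := fun s hs =>
      (ENNReal.ofReal_le_ofReal hs.2).trans_lt ht
    exact hlip.eqOn_of_isVolterraSolution hf_cont hγ0 h0
      ⟨hvc.mono fun s hst => ⟨hst.1, hs s hst⟩, fun s hst => hv s hst.1 (hs s hst)⟩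
      (fun s hst => hvm s hst.1 (hs s hst)) (hsol' t ht).1 (hsol' t ht).2 ⟨h0, le_rfl⟩
  · intro htop K hK hKs
    have hτ : 0 < Tb.toReal := ENNReal.toReal_pos hTb0.ne' htop.ne
    have hltτ : ∀ t, 0 ≤ t → t < Tb.toReal → ENNReal.ofReal t < Tb := fun t h0 ht =>
      (ENNReal.ofReal_lt_iff_lt_toReal h0 htop.ne).2 ht
    have key : ∀ r < Tb.toReal, ∃ t, max 0 r ≤ t ∧ t < Tb.toReal ∧ u t ∉ K := by
      by_contra! hcon
      obtain ⟨r, hr, h⟩ := hcon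
      have hrτ : max 0 r < Tb.toReal := max_lt hτ hr
      obtain ⟨hur, hurm⟩ := hsol' _ (hltτ _ (le_max_left _ _) hrτ)
      obtain ⟨a, b, ha, hb, hab⟩ := exists_Icc_superset_of_isCompact
        ((isCompact_Icc.image_of_continuousOn hur.1).union hK)
        ⟨u 0, Or.inl (mem_image_of_mem u ⟨le_rfl, le_max_left _ _⟩)⟩
        (union_subset hurm.image_subset hKs)
      have hum : MapsTo u (Ico 0 Tb.toReal) (Icc a b) := fun t ht => by
        rcases le_total t (max 0 r) with htr | htr
        · exact hab (Or.inl (mem_image_of_mem u ⟨ht.1, htr⟩))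
        · exact hab (Or.inr (h t htr ht.2))
      obtain ⟨T, hT, hTτ⟩ := hext hτ.le ha hb (hu0 ▸ hum ⟨le_rfl, hτ⟩)
        (fun t ht => (hsol' t (hltτ t ht.1 ht.2)).1) hum
      exact hTτ.not_ge ((ENNReal.ofReal_le_iff_le_toReal htop.ne).1 (hle T hT))
    choose! t ht using key
    obtain ⟨r, -, hr, hrt⟩ := exists_seq_strictMono_tendsto Tb.toReal
    refine ⟨fun n => t (r n), fun n => ⟨(le_max_left _ _).trans (ht _ (hr n)).1, (ht _ (hr n)).2.1⟩,
      ?_, fun n => (ht _ (hr n)).2.2⟩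
    exact tendsto_of_tendsto_of_tendsto_of_le_of_le hrt tendsto_const_nhds
      (fun n => (le_max_right _ _).trans (ht _ (hr n)).1) fun n => (ht _ (hr n)).2.1.le
end

section
/- Let γ ∈ (0,1), T > 0, let f be continuous on [0,T], and let u be the continuous function on [0,T] defined by u(t) = u(0) + (1/Γ(γ)) ∫₀ᵗ (t−s)^(γ−1) f(s) ds (so that f is the Caputo derivative of u of order γ). If for some t₁ ∈ (0,T] one has u(t₁) = sup{u(s) : 0 ≤ s ≤ t₁}, then f(t₁) ≥ 0. -/
open MeasureTheory Set Filter

lemma integrableOn_rpow_div_one_add {γ : ℝ} (h0 : 0 < γ) (h1 : γ < 1) :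
    IntegrableOn (fun z : ℝ => z ^ (γ - 1) / (1 + z)) (Ioi 0) := by
  have hm : Measurable fun z : ℝ => z ^ (γ - 1) / (1 + z) := by fun_prop
  rw [← Ioc_union_Ioi_eq_Ioi zero_le_one]
  refine IntegrableOn.union ?_ ?_
  · have h : IntegrableOn (fun z : ℝ => z ^ (γ - 1)) (Ioc 0 1) :=
      (intervalIntegrable_iff_integrableOn_Ioc_of_le zero_le_one).1
        (intervalIntegral.intervalIntegrable_rpow' (by linarith))
    refine h.mono' hm.aestronglyMeasurable ?_
    filter_upwards [ae_restrict_mem measurableSet_Ioc] with z hz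
    have hp := Real.rpow_nonneg hz.1.le (γ - 1)
    have := hz.1
    rw [Real.norm_of_nonneg (by positivity)]
    exact div_le_self hp (by linarith)
  · have h : IntegrableOn (fun z : ℝ => z ^ (γ - 2)) (Ioi 1) :=
      integrableOn_Ioi_rpow_of_lt (by linarith) one_pos
    refine h.mono' hm.aestronglyMeasurable ?_
    filter_upwards [ae_restrict_mem measurableSet_Ioi] with z hz
    have hz0 : 0 < z := one_pos.trans hz
    have hp := Real.rpow_nonneg hz0.le (γ - 1)
    rw [Real.norm_of_nonneg (by positivity), show γ - 2 = γ - 1 - 1 by ring,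
      Real.rpow_sub_one hz0.ne' (γ - 1)]
    gcongr
    linarith

lemma integral_rpow_div_one_add_pos {γ : ℝ} (h0 : 0 < γ) (h1 : γ < 1) :
    0 < ∫ z in Ioi (0 : ℝ), z ^ (γ - 1) / (1 + z) := by
  have hpos : ∀ z ∈ Ioi (0 : ℝ), 0 < z ^ (γ - 1) / (1 + z) := fun z (hz : 0 < z) => by
    positivity
  rw [setIntegral_pos_iff_support_of_nonneg_ae
    (by filter_upwards [ae_restrict_mem measurableSet_Ioi] with z hz using (hpos z hz).le)
    (integrableOn_rpow_div_one_add h0 h1),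
    inter_eq_right.2 (show Ioi (0 : ℝ) ⊆ Function.support _ from fun z hz => (hpos z hz).ne')]
  simp

lemma image_mobius_Ioo {r a t : ℝ} (hra : r < a) (hat : a < t) :
    (fun s => (t - a) * (s - r) / ((t - r) * (a - s))) '' Ioo r a = Ioi 0 := by
  have hd : 0 < t - a := by linarith
  have hr : 0 < t - r := by linarith
  have har : 0 < a - r := by linarith
  ext z
  constructor
  · rintro ⟨s, ⟨h1, h2⟩, rfl⟩
    have : 0 < s - r := by linarith
    have : 0 < a - s := by linarith
    simp only [mem_Ioi]
    positivity
  · intro (hz : 0 < z)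
    have hD : 0 < t - a + z * (t - r) := by positivity
    have e1 : ((t - a) * r + z * (t - r) * a) / (t - a + z * (t - r)) - r
        = z * (t - r) * (a - r) / (t - a + z * (t - r)) := by field_simp; ring
    have e2 : a - ((t - a) * r + z * (t - r) * a) / (t - a + z * (t - r))
        = (t - a) * (a - r) / (t - a + z * (t - r)) := by field_simp; ring
    refine ⟨((t - a) * r + z * (t - r) * a) / (t - a + z * (t - r)), ⟨?_, ?_⟩, ?_⟩
    · rw [← sub_pos, e1]; positivity
    · rw [← sub_pos, e2]; positivity
    · simp only [e1, e2]
      field_simp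

lemma hasDerivAt_mobius {r a t s : ℝ} (hr : t - r ≠ 0) (hs : a - s ≠ 0) :
    HasDerivAt (fun s => (t - a) * (s - r) / ((t - r) * (a - s)))
      ((t - a) * (a - r) / ((t - r) * (a - s) ^ 2)) s := by
  have h := (((hasDerivAt_id s).sub_const r).const_mul (t - a)).div
    (((hasDerivAt_id s).const_sub a).const_mul (t - r)) (mul_ne_zero hr hs)
  refine h.congr_deriv ?_
  simp only [id]
  field_simp
  ring

lemma injOn_mobius {r a t : ℝ} (hra : r < a) (hat : a < t) :
    InjOn (fun s => (t - a) * (s - r) / ((t - r) * (a - s))) (Ioo r a) := by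
  intro x hx y hy hxy
  have hd : t - a ≠ 0 := by linarith
  have hr : t - r ≠ 0 := by linarith
  have har : a - r ≠ 0 := by linarith
  have h1 : a - x ≠ 0 := by linarith [hx.2]
  have h2 : a - y ≠ 0 := by linarith [hy.2]
  simp only at hxy
  rw [div_eq_div_iff (by positivity) (by positivity)] at hxy
  have : (t - a) * (t - r) * (a - r) * (x - y) = 0 := by linear_combination hxy
  have : x - y = 0 := by simpa [hd, hr, har] using this
  linarith

lemma mobius_integrand_eq {γ r a t s : ℝ} (hs : s ∈ Ioo r a) (hat : a < t) :
    |(t - a) * (a - r) / ((t - r) * (a - s) ^ 2)| *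
        (((t - a) * (s - r) / ((t - r) * (a - s))) ^ (γ - 1) /
          (1 + (t - a) * (s - r) / ((t - r) * (a - s)))) =
      (t - a) ^ γ * (t - r) ^ (1 - γ) *
        ((s - r) ^ (γ - 1) * ((a - s) ^ (-γ) * (t - s)⁻¹)) := by
  obtain ⟨hs1, hs2⟩ := hs
  have hd : 0 < t - a := by linarith
  have hr : 0 < t - r := by linarith
  have har : 0 < a - r := by linarith
  have h1 : 0 < s - r := by linarith
  have h2 : 0 < a - s := by linarith
  have h3 : 0 < t - s := by linarith
  have e : 1 + (t - a) * (s - r) / ((t - r) * (a - s))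
      = (a - r) * (t - s) / ((t - r) * (a - s)) := by field_simp; ring
  rw [abs_of_pos (by positivity), e, Real.div_rpow (by positivity) (by positivity),
    Real.mul_rpow hd.le h1.le, Real.mul_rpow hr.le h2.le, show 1 - γ = -(γ - 1) by ring,
    Real.rpow_neg hr.le, Real.rpow_neg h2.le, Real.rpow_sub_one hd.ne',
    Real.rpow_sub_one h2.ne']
  field_simp

/-- Up to normalisation, `s ↦ (a - s) ^ (-γ) * (t - s)⁻¹` is the Poisson kernel expressing the value
at `t` of the Abel kernel `x ↦ (x - r) ^ (γ - 1)` through its values on `(r, a)`. -/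
lemma exists_poisson_kernel_const {γ a t : ℝ} (h0 : 0 < γ) (h1 : γ < 1) (hat : a < t) :
    ∃ c > 0, ∀ r < a,
      IntegrableOn (fun s => (s - r) ^ (γ - 1) * ((a - s) ^ (-γ) * (t - s)⁻¹)) (Ioo r a) ∧
      ∫ s in Ioo r a, (s - r) ^ (γ - 1) * ((a - s) ^ (-γ) * (t - s)⁻¹)
        = c * (t - r) ^ (γ - 1) := by
  have hd : 0 < t - a := by linarith
  refine ⟨(t - a) ^ (-γ) * ∫ z in Ioi (0 : ℝ), z ^ (γ - 1) / (1 + z),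
    mul_pos (by positivity) (integral_rpow_div_one_add_pos h0 h1), fun r hra => ?_⟩
  have hr : 0 < t - r := by linarith
  have hC : 0 < (t - a) ^ γ * (t - r) ^ (1 - γ) := by positivity
  have hder : ∀ s ∈ Ioo r a, HasDerivWithinAt
      (fun s => (t - a) * (s - r) / ((t - r) * (a - s)))
      ((t - a) * (a - r) / ((t - r) * (a - s) ^ 2)) (Ioo r a) s := fun s hs =>
    (hasDerivAt_mobius hr.ne' (by linarith [hs.2])).hasDerivWithinAt
  have hint := integrableOn_rpow_div_one_add h0 h1
  rw [← image_mobius_Ioo hra hat, integrableOn_image_iff_integrableOn_abs_deriv_smul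
    measurableSet_Ioo hder (injOn_mobius hra hat)] at hint
  have heq := integral_image_eq_integral_abs_deriv_smul measurableSet_Ioo hder
    (injOn_mobius hra hat) fun z => z ^ (γ - 1) / (1 + z)
  simp only [smul_eq_mul] at hint heq
  rw [integrableOn_congr_fun (fun s hs => mobius_integrand_eq hs hat) measurableSet_Ioo] at hint
  rw [setIntegral_congr_fun measurableSet_Ioo fun s hs => mobius_integrand_eq hs hat,
    image_mobius_Ioo hra hat, integral_const_mul] at heq
  refine ⟨(integrable_const_mul_iff hC.ne'.isUnit _).1 hint, ?_⟩
  rw [heq, show γ - 1 = -(1 - γ) by ring, Real.rpow_neg hd.le, Real.rpow_neg hr.le]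
  field_simp

lemma integrable_triangle_kernel {γ a t : ℝ} (h0 : 0 < γ) (h1 : γ < 1) (hat : a < t) :
    Integrable ({p : ℝ × ℝ | p.2 < p.1}.indicator fun p =>
        (p.1 - p.2) ^ (γ - 1) * ((a - p.1) ^ (-γ) * (t - p.1)⁻¹))
      ((volume.restrict (Ioo 0 a)).prod (volume.restrict (Ioo 0 a))) := by
  obtain ⟨c, -, hc⟩ := exists_poisson_kernel_const h0 h1 hat
  have hmeas : AEStronglyMeasurable ({p : ℝ × ℝ | p.2 < p.1}.indicator fun p =>
        (p.1 - p.2) ^ (γ - 1) * ((a - p.1) ^ (-γ) * (t - p.1)⁻¹))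
      ((volume.restrict (Ioo 0 a)).prod (volume.restrict (Ioo 0 a))) :=
    (Measurable.indicator (by fun_prop)
      (measurableSet_lt measurable_snd measurable_fst)).aestronglyMeasurable
  have hslice : ∀ r : ℝ, (fun s => {p : ℝ × ℝ | p.2 < p.1}.indicator (fun p =>
        (p.1 - p.2) ^ (γ - 1) * ((a - p.1) ^ (-γ) * (t - p.1)⁻¹)) (s, r)) =
      (Ioi r).indicator fun s => (s - r) ^ (γ - 1) * ((a - s) ^ (-γ) * (t - s)⁻¹) := fun r => rfl
  have hset : ∀ r ∈ Ioo 0 a, Ioi r ∩ Ioo 0 a = Ioo r a := fun r hr => by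
    ext s
    simp only [mem_inter_iff, mem_Ioi, mem_Ioo]
    exact ⟨fun h => ⟨h.1, h.2.2⟩, fun h => ⟨h.1, hr.1.trans h.1, h.2⟩⟩
  rw [integrable_prod_iff' hmeas]
  constructor
  · filter_upwards [ae_restrict_mem measurableSet_Ioo] with r hr
    rw [hslice, integrable_indicator_iff measurableSet_Ioi, IntegrableOn,
      Measure.restrict_restrict measurableSet_Ioi, hset r hr]
    exact (hc r hr.2).1
  · have hint : IntegrableOn (fun r => c * (t - r) ^ (γ - 1)) (Ioo 0 a) := by
      refine (ContinuousOn.integrableOn_Icc ?_).mono_set Ioo_subset_Icc_self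
      refine continuousOn_const.mul (ContinuousOn.rpow_const (by fun_prop) fun r hr => Or.inl ?_)
      linarith [hr.2]
    refine hint.congr ?_
    filter_upwards [ae_restrict_mem measurableSet_Ioo] with r hr
    rw [← (hc r hr.2).2, ← hset r hr, ← Measure.restrict_restrict measurableSet_Ioi,
      ← integral_indicator measurableSet_Ioi]
    refine setIntegral_congr_fun measurableSet_Ioo fun s hs => ?_
    rw [congrFun (hslice r) s, Real.norm_of_nonneg]
    refine indicator_apply_nonneg fun (hrs : r < s) => ?_
    have : 0 < s - r := by linarith
    have : 0 < a - s := by linarith [hs.2]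
    have : 0 < t - s := by linarith
    positivity

lemma abel_integral_poisson {γ a t : ℝ} (h0 : 0 < γ) (h1 : γ < 1) (hat : a < t)
    {f : ℝ → ℝ} (hf : ContinuousOn f (Icc 0 a)) :
    IntegrableOn (fun s => ((a - s) ^ (-γ) * (t - s)⁻¹) *
      ∫ r in (0 : ℝ)..s, (s - r) ^ (γ - 1) * f r) (Ioo 0 a) ∧
    ∫ s in Ioo 0 a, ((a - s) ^ (-γ) * (t - s)⁻¹) * ∫ r in (0 : ℝ)..s, (s - r) ^ (γ - 1) * f r =
      ∫ r in Ioo 0 a, (∫ s in Ioo r a, (s - r) ^ (γ - 1) * ((a - s) ^ (-γ) * (t - s)⁻¹)) * f r := by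
  obtain ⟨M, hM⟩ := isCompact_Icc.exists_bound_of_continuousOn hf
  set μ := volume.restrict (Ioo 0 a) with hμ
  set F : ℝ × ℝ → ℝ := fun p => ({p : ℝ × ℝ | p.2 < p.1}.indicator (fun p =>
        (p.1 - p.2) ^ (γ - 1) * ((a - p.1) ^ (-γ) * (t - p.1)⁻¹)) p) * f p.2 with hF
  have hFint : Integrable F (μ.prod μ) := by
    refine (integrable_triangle_kernel h0 h1 hat).mul_bdd (c := M) ?_ ?_
    · exact ((hf.mono Ioo_subset_Icc_self).aestronglyMeasurable measurableSet_Ioo).comp_snd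
    · have : ∀ᵐ r ∂μ, ‖f r‖ ≤ M := by
        filter_upwards [ae_restrict_mem measurableSet_Ioo] with r hr
        exact hM r (Ioo_subset_Icc_self hr)
      exact Measure.quasiMeasurePreserving_snd.ae this
  have hinner1 : ∀ s ∈ Ioo 0 a, ∫ r, F (s, r) ∂μ =
      ((a - s) ^ (-γ) * (t - s)⁻¹) * ∫ r in (0 : ℝ)..s, (s - r) ^ (γ - 1) * f r := fun s hs => by
    have e : (fun r => F (s, r)) = (Iio s).indicator fun r =>
        ((a - s) ^ (-γ) * (t - s)⁻¹) * ((s - r) ^ (γ - 1) * f r) := by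
      ext r
      by_cases h : r < s
      · simp [hF, h]; ring
      · simp [hF, h]
    have hset : Iio s ∩ Ioo 0 a = Ioo 0 s := by
      ext r
      simp only [mem_inter_iff, mem_Iio, mem_Ioo]
      exact ⟨fun h => ⟨h.2.1, h.1⟩, fun h => ⟨h.2, h.1, h.2.trans hs.2⟩⟩
    rw [e, integral_indicator measurableSet_Iio, hμ, Measure.restrict_restrict measurableSet_Iio,
      hset, integral_const_mul, intervalIntegral.integral_of_le hs.1.le,
      integral_Ioc_eq_integral_Ioo]
  have hinner2 : ∀ r ∈ Ioo 0 a, ∫ s, F (s, r) ∂μ =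
      (∫ s in Ioo r a, (s - r) ^ (γ - 1) * ((a - s) ^ (-γ) * (t - s)⁻¹)) * f r := fun r hr => by
    have e : (fun s => F (s, r)) = (Ioi r).indicator fun s =>
        ((s - r) ^ (γ - 1) * ((a - s) ^ (-γ) * (t - s)⁻¹)) * f r := by
      ext s
      by_cases h : r < s
      · simp [hF, h]
      · simp [hF, h]
    have hset : Ioi r ∩ Ioo 0 a = Ioo r a := by
      ext s
      simp only [mem_inter_iff, mem_Ioi, mem_Ioo]
      exact ⟨fun h => ⟨h.1, h.2.2⟩, fun h => ⟨h.1, hr.1.trans h.1, h.2⟩⟩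
    rw [e, integral_indicator measurableSet_Ioi, hμ, Measure.restrict_restrict measurableSet_Ioi,
      hset, integral_mul_const]
  constructor
  · refine hFint.integral_prod_left.congr ?_
    filter_upwards [ae_restrict_mem measurableSet_Ioo] with s hs using hinner1 s hs
  · rw [← setIntegral_congr_fun measurableSet_Ioo hinner1,
      ← setIntegral_congr_fun measurableSet_Ioo hinner2]
    exact integral_integral_swap hFint

lemma intervalIntegrable_abel_kernel_mul {γ t : ℝ} (h0 : 0 < γ) (ht : 0 ≤ t) {f : ℝ → ℝ}
    (hf : ContinuousOn f (Icc 0 t)) :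
    IntervalIntegrable (fun s => (t - s) ^ (γ - 1) * f s) volume 0 t := by
  have h : IntervalIntegrable (fun s : ℝ => (t - s) ^ (γ - 1)) volume 0 t := by
    have := (intervalIntegral.intervalIntegrable_rpow' (a := 0) (b := t)
      (show -1 < γ - 1 by linarith)).comp_sub_left t
    simpa using this.symm
  exact h.mul_continuousOn (by rwa [uIcc_of_le ht])

/-- If `u` has continuous Caputo derivative `f` (Volterra form) and
`u` attains at `t₁ ∈ (0,T]` its maximum over `[0,t₁]`, then `f(t₁) ≥ 0`. -/
theorem caputo_derivative_nonneg_at_running_max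
    (γ T : ℝ) (hγ : γ ∈ Set.Ioo (0:ℝ) 1) (hT : 0 < T)
    (f u : ℝ → ℝ)
    (hf : ContinuousOn f (Set.Icc 0 T))
    (hu_cont : ContinuousOn u (Set.Icc 0 T))
    (hu : ∀ t ∈ Set.Icc 0 T,
      u t = u 0 + (1 / Real.Gamma γ) * ∫ s in (0:ℝ)..t, (t - s) ^ (γ - 1) * f s)
    (t₁ : ℝ) (ht₁ : t₁ ∈ Set.Ioc 0 T)
    (hmax : ∀ s ∈ Set.Icc 0 t₁, u s ≤ u t₁) :
    0 ≤ f t₁ := by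
  obtain ⟨h0, h1⟩ := hγ
  obtain ⟨ht0, htT⟩ := ht₁
  by_contra! hneg
  set g : ℝ → ℝ := fun t => ∫ s in (0:ℝ)..t, (t - s) ^ (γ - 1) * f s with hg
  have hgmax : ∀ s ∈ Icc 0 t₁, g s ≤ g t₁ := fun s hs => by
    have h := hmax s hs
    rw [hu s ⟨hs.1, hs.2.trans htT⟩, hu t₁ ⟨ht0.le, htT⟩] at h
    have hΓ : 0 < 1 / Real.Gamma γ := one_div_pos.2 (Real.Gamma_pos_of_pos h0)
    exact le_of_mul_le_mul_left (by linarith) hΓ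
  have hgnonneg : 0 ≤ g t₁ := by
    simpa [hg] using hgmax 0 ⟨le_rfl, ht0.le⟩
  have hft : ContinuousOn f (Icc 0 t₁) := hf.mono (Icc_subset_Icc_right htT)
  obtain ⟨a, ha0, hat, hfneg⟩ : ∃ a, 0 < a ∧ a < t₁ ∧ ∀ s ∈ Ioo a t₁, f s < 0 := by
    have h := (hft t₁ ⟨ht0.le, le_rfl⟩).mono Ioo_subset_Icc_self
    have h2 : ∀ᶠ s in nhdsWithin t₁ (Iio t₁), f s < 0 := by
      rw [← nhdsWithin_Ioo_eq_nhdsLT ht0]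
      exact h.eventually (gt_mem_nhds hneg)
    obtain ⟨l, hl, hl'⟩ := (mem_nhdsLT_iff_exists_Ioo_subset' ht0).1 h2
    refine ⟨max l (t₁ / 2), by positivity, max_lt hl (by linarith), fun s hs => hl' ⟨?_, hs.2⟩⟩
    exact (le_max_left _ _).trans_lt hs.1
  have hfa : ContinuousOn f (Icc 0 a) := hft.mono (Icc_subset_Icc_right hat.le)
  have hint := intervalIntegrable_abel_kernel_mul h0 ht0.le hft
  have hint1 : IntervalIntegrable (fun s => (t₁ - s) ^ (γ - 1) * f s) volume 0 a :=
    hint.mono_set (by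
      rw [uIcc_of_le ha0.le, uIcc_of_le ht0.le]; exact Icc_subset_Icc_right hat.le)
  have hint2 : IntervalIntegrable (fun s => (t₁ - s) ^ (γ - 1) * f s) volume a t₁ :=
    hint.mono_set (by
      rw [uIcc_of_le hat.le, uIcc_of_le ht0.le]; exact Icc_subset_Icc_left ha0.le)
  have hsplit : (∫ s in (0:ℝ)..a, (t₁ - s) ^ (γ - 1) * f s) +
      (∫ s in a..t₁, (t₁ - s) ^ (γ - 1) * f s) = g t₁ :=
    intervalIntegral.integral_add_adjacent_intervals hint1 hint2
  have hlast : ∫ s in a..t₁, (t₁ - s) ^ (γ - 1) * f s < 0 := by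
    have := intervalIntegral.intervalIntegral_pos_of_pos_on hint2.neg (fun s hs => by
      have : 0 < t₁ - s := by linarith [hs.2]
      have := hfneg s hs
      rw [Pi.neg_apply, neg_pos]
      exact mul_neg_of_pos_of_neg (by positivity) this) hat
    simp only [Pi.neg_apply, intervalIntegral.integral_neg] at this
    linarith
  obtain ⟨c, hc0, hc⟩ := exists_poisson_kernel_const h0 h1 hat
  obtain ⟨hPint, hPeq⟩ := abel_integral_poisson h0 h1 hat hfa
  have hcf : ∀ r ∈ Ioo 0 a,
      (∫ s in Ioo r a, (s - r) ^ (γ - 1) * ((a - s) ^ (-γ) * (t₁ - s)⁻¹)) * f r =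
        c * ((t₁ - r) ^ (γ - 1) * f r) := fun r hr => by rw [(hc r hr.2).2, mul_assoc]
  rw [setIntegral_congr_fun measurableSet_Ioo hcf, integral_const_mul] at hPeq
  rw [intervalIntegral.integral_of_le ha0.le, integral_Ioc_eq_integral_Ioo] at hsplit
  obtain ⟨hKint, hKeq⟩ := hc 0 ha0
  have htp : 0 < t₁ ^ (γ - 1) := by positivity
  have hle := setIntegral_mono_on hPint (hKint.const_mul (g t₁ / t₁ ^ (γ - 1)))
    measurableSet_Ioo fun s hs => by
      have hs1 := hs.1
      have hs2 : 0 < a - s := by linarith [hs.2]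
      have hs3 : 0 < t₁ - s := by linarith
      have hP : 0 ≤ (a - s) ^ (-γ) * (t₁ - s)⁻¹ := by positivity
      have hpow : t₁ ^ (γ - 1) ≤ s ^ (γ - 1) :=
        Real.rpow_le_rpow_of_nonpos hs1 (by linarith) (by linarith)
      calc (a - s) ^ (-γ) * (t₁ - s)⁻¹ * g s
          ≤ (a - s) ^ (-γ) * (t₁ - s)⁻¹ * (g t₁ * (s ^ (γ - 1) / t₁ ^ (γ - 1))) := by
            refine mul_le_mul_of_nonneg_left ?_ hP
            refine (hgmax s ⟨hs1.le, by linarith⟩).trans (le_mul_of_one_le_right hgnonneg ?_)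
            rwa [one_le_div htp]
        _ = _ := by rw [sub_zero]; ring
  rw [hPeq, integral_const_mul, hKeq, sub_zero] at hle
  have hrw : g t₁ / t₁ ^ (γ - 1) * (c * t₁ ^ (γ - 1)) = c * g t₁ := by field_simp
  rw [hrw] at hle
  have := le_of_mul_le_mul_left hle hc0
  linarith
end

section
/- Let γ ∈ (0,1) and T > 0, and let f : [0,T] × ℝ → ℝ be continuous and locally Lipschitz continuous in its second variable. Let u be continuous on [0,T] with u(t) = u(0) + (1/Γ(γ)) ∫₀ᵗ (t−s)^(γ−1) f(s, u(s)) ds for all t ∈ [0,T]. Let v be continuous on [0,T] and continuously differentiable on (0,T] with v′ integrable near 0. (a) If the pointwise Caputo derivative satisfies D_c^γ v(t) ≤ f(t, v(t)) for all t ∈ (0,T] and v(0) ≤ u(0), then v(t) ≤ u(t) for all t ∈ [0,T]. (b) If D_c^γ v(t) ≥ f(t, v(t)) for all t ∈ (0,T] and v(0) ≥ u(0), then v(t) ≥ u(t) for all t ∈ [0,T]. -/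
open MeasureTheory Set Filter

/-- The pointwise Caputo derivative of order `γ`:
`D_c^γ v (t) = (1/Γ(1-γ)) ∫₀ᵗ (t-s)^(-γ) v'(s) ds`. -/
noncomputable def caputoDeriv (γ : ℝ) (v : ℝ → ℝ) (t : ℝ) : ℝ :=
  (1 / Real.Gamma (1 - γ)) * ∫ s in (0:ℝ)..t, (t - s) ^ (-γ) * deriv v s


lemma intervalIntegrable_sub_left_rpow {r : ℝ} (hr : -1 < r) (t a b : ℝ) :
    IntervalIntegrable (fun s : ℝ => (t - s) ^ r) volume a b := by
  simpa using (intervalIntegral.intervalIntegrable_rpow' hr (a := t - a) (b := t - b)).comp_sub_left t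

/-- An integrable function that is continuous away from `0` stays integrable after multiplication
by a kernel `(t - s) ^ r` with an integrable singularity at `t`. -/
lemma intervalIntegrable_sub_left_rpow_mul {r t : ℝ} (hr : -1 < r) (ht : 0 < t) {h : ℝ → ℝ}
    (hc : ContinuousOn h (Ioc 0 t)) (hi : IntervalIntegrable h volume 0 t) :
    IntervalIntegrable (fun s => (t - s) ^ r * h s) volume 0 t := by
  have hmid : t / 2 ∈ uIcc 0 t := by
    rw [uIcc_of_le ht.le]; constructor <;> linarith
  refine IntervalIntegrable.trans (b := t / 2) ?_ ?_
  · refine (hi.mono_set (uIcc_subset_uIcc left_mem_uIcc hmid)).continuousOn_mul ?_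
    rw [uIcc_of_le (by linarith)]
    refine ContinuousOn.rpow_const (by fun_prop) fun s hs => Or.inl ?_
    linarith [hs.2]
  · refine (intervalIntegrable_sub_left_rpow hr t _ _).mul_continuousOn (hc.mono ?_)
    rw [uIcc_of_le (by linarith)]
    exact fun s hs => ⟨by linarith [hs.1], hs.2⟩

/-- A nonnegative function vanishing at the endpoint `t` has nonpositive Caputo derivative there;
the bound keeps track of the value at `0`. -/
lemma integral_rpow_mul_deriv_le {γ t : ℝ} (hγ : γ ∈ Ioo (0 : ℝ) 1) (ht : 0 < t) {z z' : ℝ → ℝ}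
    (hz : ContinuousOn z (Icc 0 t)) (hz' : ∀ s ∈ Ioc 0 t, HasDerivAt z (z' s) s)
    (hc : ContinuousOn z' (Ioc 0 t)) (hi : IntervalIntegrable z' volume 0 t)
    (hnn : ∀ s ∈ Icc 0 t, 0 ≤ z s) (hzt : z t = 0) :
    ∫ s in (0 : ℝ)..t, (t - s) ^ (-γ) * z' s ≤ -(t ^ (-γ) * z 0) := by
  have hcont : ContinuousOn (fun s => (t - s) ^ (-γ) * z s) (Icc 0 t) := by
    intro s hs
    rcases hs.2.lt_or_eq with hst | rfl
    · refine ContinuousWithinAt.mul ?_ (hz s hs)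
      exact (ContinuousAt.rpow_const (by fun_prop)
        (Or.inl (sub_pos.2 hst).ne')).continuousWithinAt
    · have hO : z =O[nhds s] fun x => x - s := by
        simpa [hzt] using (hz' s ⟨ht, le_rfl⟩).isBigO_sub
      obtain ⟨C, hC⟩ := hO.bound
      have hlim : Tendsto (fun x => C * (s - x) ^ (1 - γ)) (nhdsWithin s (Icc 0 s)) (nhds 0) := by
        have : Continuous fun x : ℝ => C * (s - x) ^ (1 - γ) :=
          continuous_const.mul ((continuous_const.sub continuous_id).rpow_const
            fun _ => Or.inr (by linarith [hγ.2]))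
        have h0 := (this.tendsto s).mono_left (nhdsWithin_le_nhds (s := Icc 0 s))
        simpa [Real.zero_rpow (by linarith [hγ.2] : (1 - γ) ≠ 0)] using h0
      unfold ContinuousWithinAt
      simp only [hzt, mul_zero]
      refine squeeze_zero_norm' ?_ hlim
      filter_upwards [nhdsWithin_le_nhds hC, self_mem_nhdsWithin] with x hx hxs
      rcases hxs.2.lt_or_eq with hlt | rfl
      · have hpos : 0 < s - x := sub_pos.2 hlt
        rw [norm_mul, Real.norm_of_nonneg (Real.rpow_nonneg hpos.le _)]
        calc (s - x) ^ (-γ) * ‖z x‖ ≤ (s - x) ^ (-γ) * (C * ‖x - s‖) := by gcongr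
          _ = C * (s - x) ^ (1 - γ) := by
            rw [norm_sub_rev, Real.norm_of_nonneg hpos.le, sub_eq_add_neg 1 γ,
              Real.rpow_add hpos, Real.rpow_one]
            ring
      · simp [hzt, Real.zero_rpow (by linarith [hγ.2] : (1 - γ) ≠ 0)]
  have key := intervalIntegral.integral_le_sub_of_hasDeriv_right_of_le ht.le hcont
    (g' := fun s => γ * (t - s) ^ (-γ - 1) * z s + (t - s) ^ (-γ) * z' s)
    (φ := fun s => (t - s) ^ (-γ) * z' s) ?_ ?_ ?_
  · simpa [hzt] using key
  · intro s hs
    have h1 : HasDerivAt (fun x => (t - x) ^ (-γ)) (γ * (t - s) ^ (-γ - 1)) s := by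
      convert! ((hasDerivAt_id s).const_sub t).rpow_const (p := -γ)
        (Or.inl (sub_pos.2 hs.2).ne') using 1
      simp
    exact (h1.mul (hz' s ⟨hs.1, hs.2.le⟩)).hasDerivWithinAt
  · rw [← intervalIntegrable_iff_integrableOn_Icc_of_le ht.le]
    exact intervalIntegrable_sub_left_rpow_mul (by linarith [hγ.2]) ht hc hi
  · intro s hs
    have := hnn s (Ioo_subset_Icc_self hs)
    have := Real.rpow_nonneg (sub_pos.2 hs.2).le (-γ - 1)
    have := hγ.1
    simp only [le_add_iff_nonneg_left]
    positivity

lemma rpow_mul_Gamma_le_integral_rpow_mul_exp {γ l t : ℝ} (hγ : γ ∈ Ioo (0 : ℝ) 1) (hl : 0 < l)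
    (ht : 0 < t) :
    l ^ γ * Real.Gamma (1 - γ) ≤
      (∫ s in (0 : ℝ)..t, (t - s) ^ (-γ) * (l * Real.exp (-(l * (t - s))))) +
        t ^ (-γ) * Real.exp (-(l * t)) := by
  have hint₀ : IntegrableOn (fun r : ℝ => r ^ (-γ) * Real.exp (-(l * r))) (Ioi 0) := by
    simpa using integrableOn_rpow_mul_exp_neg_mul_rpow (s := -γ) (p := 1) (b := l)
      (by linarith [hγ.2]) one_pos hl
  have htot : ∫ r in Ioi (0 : ℝ), r ^ (-γ) * Real.exp (-(l * r)) =
      l ^ γ * Real.Gamma (1 - γ) / l := by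
    have := Real.integral_rpow_mul_exp_neg_mul_Ioi (a := 1 - γ) (r := l) (by linarith [hγ.2]) hl
    rw [show 1 - γ - 1 = -γ by ring] at this
    rw [this, one_div, Real.inv_rpow hl.le, ← Real.rpow_neg hl.le, neg_sub, Real.rpow_sub_one hl.ne']
    ring
  have hsplit := intervalIntegral.integral_interval_add_Ioi
    (a := 0) (b := t) hint₀ (hint₀.mono_set (Ioi_subset_Ioi ht.le))
  have htail : ∫ r in Ioi t, r ^ (-γ) * Real.exp (-(l * r)) ≤
      t ^ (-γ) * (Real.exp (-(l * t)) / l) := by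
    have hexp : IntegrableOn (fun r : ℝ => Real.exp (-(l * r))) (Ioi t) := by
      simpa using exp_neg_integrableOn_Ioi t hl
    have hval : ∫ r in Ioi t, Real.exp (-(l * r)) = Real.exp (-(l * t)) / l := by
      have := integral_exp_mul_Ioi (a := -l) (by linarith) t
      simpa [neg_div_neg_eq] using this
    rw [← hval, ← integral_const_mul]
    refine setIntegral_mono_on (hint₀.mono_set (Ioi_subset_Ioi ht.le)) (hexp.const_mul _)
      measurableSet_Ioi fun r hr => ?_
    exact mul_le_mul_of_nonneg_right
      (Real.rpow_le_rpow_of_nonpos ht (mem_Ioi.1 hr).le (neg_nonpos.2 hγ.1.le)) (Real.exp_pos _).le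
  have hsub : ∫ s in (0 : ℝ)..t, (t - s) ^ (-γ) * (l * Real.exp (-(l * (t - s)))) =
      l * ∫ r in (0 : ℝ)..t, r ^ (-γ) * Real.exp (-(l * r)) := by
    rw [intervalIntegral.integral_comp_sub_left
      (fun r : ℝ => r ^ (-γ) * (l * Real.exp (-(l * r)))) t, sub_self, sub_zero,
      ← intervalIntegral.integral_const_mul]
    congr 1 with r
    ring
  rw [hsub]
  rw [htot] at hsplit
  have h2 := mul_le_mul_of_nonneg_left htail hl.le
  have h3 : l * (t ^ (-γ) * (Real.exp (-(l * t)) / l)) = t ^ (-γ) * Real.exp (-(l * t)) := by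
    field_simp
  have h4 : l * (l ^ γ * Real.Gamma (1 - γ) / l) = l ^ γ * Real.Gamma (1 - γ) := by
    field_simp
  rw [← h4, ← hsplit, mul_add]
  linarith

/-- Weighted maximum principle: if `s ↦ exp (-l s) w s` attains its maximum over `[0, t]` at `t`
and `w 0 ≤ 0`, then the Caputo derivative of `w` at `t` is at least `l ^ γ * w t`. -/
lemma rpow_mul_le_caputoDeriv {γ l t : ℝ} (hγ : γ ∈ Ioo (0 : ℝ) 1) (hl : 0 < l) (ht : 0 < t)
    {w : ℝ → ℝ} (hw : ContinuousOn w (Icc 0 t)) (hd : ∀ s ∈ Ioc 0 t, DifferentiableAt ℝ w s)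
    (hc : ContinuousOn (deriv w) (Ioc 0 t)) (hi : IntervalIntegrable (deriv w) volume 0 t)
    (hw0 : w 0 ≤ 0) (hwt : 0 ≤ w t)
    (hmax : ∀ s ∈ Icc 0 t, w s ≤ Real.exp (-(l * (t - s))) * w t) :
    l ^ γ * w t ≤ caputoDeriv γ w t := by
  have hG : 0 < Real.Gamma (1 - γ) := Real.Gamma_pos_of_pos (by linarith [hγ.2])
  have he : Continuous fun s => l * Real.exp (-(l * (t - s))) := by fun_prop
  have key := integral_rpow_mul_deriv_le hγ ht
    (z := fun s => Real.exp (-(l * (t - s))) * w t - w s)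
    (z' := fun s => l * Real.exp (-(l * (t - s))) * w t - deriv w s)
    ((by fun_prop : Continuous fun s => Real.exp (-(l * (t - s))) * w t).continuousOn.sub hw)
    (fun s hs => by
      have h1 : HasDerivAt (fun x => Real.exp (-(l * (t - x)))) (l * Real.exp (-(l * (t - s)))) s := by
        convert! ((((hasDerivAt_id s).const_sub t).const_mul l).neg).exp using 1
        simp; ring
      exact (h1.mul_const _).sub (hd s hs).hasDerivAt)
    ((he.mul continuous_const).continuousOn.sub hc)
    (((he.mul continuous_const).intervalIntegrable 0 t).sub hi)
    (fun s hs => sub_nonneg.2 (hmax s hs)) (by simp)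
  have hi1 : IntervalIntegrable (fun s => (t - s) ^ (-γ) * (l * Real.exp (-(l * (t - s)))))
      volume 0 t :=
    intervalIntegrable_sub_left_rpow_mul (by linarith [hγ.2]) ht he.continuousOn
      (he.intervalIntegrable _ _)
  have hi2 := intervalIntegrable_sub_left_rpow_mul (r := -γ) (by linarith [hγ.2]) ht hc hi
  have hsplit : ∫ s in (0 : ℝ)..t,
      (t - s) ^ (-γ) * (l * Real.exp (-(l * (t - s))) * w t - deriv w s) =
      (∫ s in (0 : ℝ)..t, (t - s) ^ (-γ) * (l * Real.exp (-(l * (t - s))))) * w t -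
        ∫ s in (0 : ℝ)..t, (t - s) ^ (-γ) * deriv w s := by
    rw [← intervalIntegral.integral_mul_const,
      ← intervalIntegral.integral_sub (hi1.mul_const _) hi2]
    congr 1 with s
    ring
  rw [hsplit] at key
  have hB := mul_le_mul_of_nonneg_right
    (rpow_mul_Gamma_le_integral_rpow_mul_exp hγ hl ht) hwt
  have h0 : t ^ (-γ) * w 0 ≤ 0 := mul_nonpos_of_nonneg_of_nonpos (Real.rpow_nonneg ht.le _) hw0
  unfold caputoDeriv
  rw [one_div, ← div_eq_inv_mul, le_div_iff₀ hG]
  simp only [sub_zero] at key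
  nlinarith

lemma integral_sub_left_rpow_mul_rpow {a b t : ℝ} (ha : 0 < a) (hb : 0 < b) (ht : 0 < t) :
    ∫ s in (0 : ℝ)..t, (t - s) ^ (a - 1) * s ^ (b - 1) =
      t ^ (a + b - 1) * (Real.Gamma a * Real.Gamma b / Real.Gamma (a + b)) := by
  have h := Complex.betaIntegral_scaled b a ht
  rw [Complex.betaIntegral_eq_Gamma_mul_div _ _ (by simpa using hb) (by simpa using ha)] at h
  apply Complex.ofReal_injective
  rw [← intervalIntegral.integral_ofReal]
  rw [intervalIntegral.integral_congr (g := fun s : ℝ =>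
    (s : ℂ) ^ ((b : ℂ) - 1) * ((t : ℂ) - s) ^ ((a : ℂ) - 1)), h]
  · push_cast [Complex.ofReal_cpow ht.le, ← Complex.Gamma_ofReal]
    rw [add_comm (a : ℂ) b, mul_comm (Complex.Gamma a)]
  · intro s hs
    rw [uIcc_of_le ht.le] at hs
    push_cast [Complex.ofReal_cpow hs.1, Complex.ofReal_cpow (sub_nonneg.2 hs.2)]
    ring

/-- Fractional integrals of polynomials are classical solutions of the Caputo equation. -/
lemma exists_caputoDeriv_eq_polynomial {γ : ℝ} (hγ : γ ∈ Ioo (0 : ℝ) 1) (p : Polynomial ℝ) :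
    ∃ U U' : ℝ → ℝ, Continuous U ∧ U 0 = 0 ∧ (∀ t > 0, HasDerivAt U (U' t) t) ∧
      ContinuousOn U' (Ioi 0) ∧ (∀ t, IntervalIntegrable U' volume 0 t) ∧
      (∀ t > 0, (1 / Real.Gamma (1 - γ)) * ∫ s in (0 : ℝ)..t, (t - s) ^ (-γ) * U' s = p.eval t) ∧
      ∀ t > 0, (1 / Real.Gamma γ) * ∫ s in (0 : ℝ)..t, (t - s) ^ (γ - 1) * p.eval s = U t := by
  induction p using Polynomial.induction_on' with
  | add p q hp hq =>
    obtain ⟨U, U', hU, hU0, hd, hc, hi, hcap, hint₀⟩ := hp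
    obtain ⟨V, V', hV, hV0, hd2, hc2, hi2, hcap2, hint₁⟩ := hq
    refine ⟨fun t => U t + V t, fun t => U' t + V' t, hU.add hV, by simp [hU0, hV0],
      fun t ht => (hd t ht).add (hd2 t ht), hc.add hc2, fun t => (hi t).add (hi2 t),
      fun t ht => ?_, fun t ht => ?_⟩
    · rw [Polynomial.eval_add, ← hcap t ht, ← hcap2 t ht, ← mul_add,
        ← intervalIntegral.integral_add]
      · simp only [mul_add]
      · exact intervalIntegrable_sub_left_rpow_mul (by linarith [hγ.2]) ht
          (hc.mono fun s hs => hs.1) (hi t)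
      · exact intervalIntegrable_sub_left_rpow_mul (by linarith [hγ.2]) ht
          (hc2.mono fun s hs => hs.1) (hi2 t)
    · beta_reduce
      rw [← hint₀ t ht, ← hint₁ t ht, ← mul_add, ← intervalIntegral.integral_add]
      · simp only [mul_add, Polynomial.eval_add]
      · exact intervalIntegrable_sub_left_rpow_mul (by linarith [hγ.1]) ht
          p.continuous.continuousOn (p.continuous.intervalIntegrable _ _)
      · exact intervalIntegrable_sub_left_rpow_mul (by linarith [hγ.1]) ht
          q.continuous.continuousOn (q.continuous.intervalIntegrable _ _)
  | monomial n c =>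
    have hn : (0 : ℝ) ≤ n := n.cast_nonneg
    have hb : 0 < γ + n := by linarith [hγ.1]
    have hG : 0 < Real.Gamma (1 - γ) := Real.Gamma_pos_of_pos (by linarith [hγ.2])
    have hG' : 0 < Real.Gamma γ := Real.Gamma_pos_of_pos hγ.1
    have hGb : 0 < Real.Gamma (γ + n) := Real.Gamma_pos_of_pos hb
    have hGn : 0 < Real.Gamma (n + 1) := Real.Gamma_pos_of_pos (by linarith)
    have hrec : Real.Gamma (γ + (n + 1)) = (γ + n) * Real.Gamma (γ + n) := by
      rw [← add_assoc, Real.Gamma_add_one hb.ne']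
    set C := c * (Real.Gamma (n + 1) / Real.Gamma (γ + (n + 1))) with hC
    refine ⟨fun t => C * t ^ (γ + n), fun t => C * ((γ + n) * t ^ (γ + n - 1)), ?_, ?_, ?_, ?_,
      ?_, ?_, ?_⟩
    · exact continuous_const.mul (Real.continuous_rpow_const hb.le)
    · simp [Real.zero_rpow hb.ne']
    · exact fun t ht => (Real.hasDerivAt_rpow_const (Or.inl ht.ne')).const_mul C
    · exact continuousOn_const.mul (continuousOn_const.mul
        (continuousOn_id.rpow_const fun s hs => Or.inl (ne_of_gt hs)))
    · exact fun t => ((intervalIntegral.intervalIntegrable_rpow' (by linarith)).const_mul _).const_mul _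
    · intro t ht
      have h := integral_sub_left_rpow_mul_rpow (a := 1 - γ) (b := γ + n) (t := t)
        (by linarith [hγ.2]) hb ht
      rw [show 1 - γ - 1 = -γ by ring, show 1 - γ + (γ + n) - 1 = n by ring,
        show 1 - γ + (γ + n) = n + 1 by ring, Real.rpow_natCast] at h
      have h' : ∀ s : ℝ, (t - s) ^ (-γ) * (C * ((γ + n) * s ^ (γ + n - 1))) =
        C * (γ + n) * ((t - s) ^ (-γ) * s ^ (γ + n - 1)) := fun s => by ring
      simp only [h', intervalIntegral.integral_const_mul, h, Polynomial.eval_monomial]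
      rw [hC, hrec]
      field_simp
    · intro t ht
      have h := integral_sub_left_rpow_mul_rpow (a := γ) (b := n + 1) (t := t) hγ.1
        (by linarith) ht
      rw [show (n : ℝ) + 1 - 1 = n by ring, show γ + ((n : ℝ) + 1) - 1 = γ + n by ring] at h
      simp only [Real.rpow_natCast] at h
      have h' : ∀ s : ℝ, (t - s) ^ (γ - 1) * (c * s ^ n) =
        c * ((t - s) ^ (γ - 1) * s ^ n) := fun s => by ring
      simp only [Polynomial.eval_monomial, h', intervalIntegral.integral_const_mul, h]
      rw [hC]
      field_simp

lemma abs_fractionalIntegral_sub_le {γ t ε : ℝ} (hγ : 0 < γ) (ht : 0 < t) {g h : ℝ → ℝ}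
    (hg : ContinuousOn g (Icc 0 t)) (hh : ContinuousOn h (Icc 0 t))
    (hgh : ∀ s ∈ Icc 0 t, |g s - h s| ≤ ε) :
    |(1 / Real.Gamma γ) * (∫ s in (0 : ℝ)..t, (t - s) ^ (γ - 1) * g s) -
      (1 / Real.Gamma γ) * ∫ s in (0 : ℝ)..t, (t - s) ^ (γ - 1) * h s| ≤
        t ^ γ / (γ * Real.Gamma γ) * ε := by
  have hG : 0 < Real.Gamma γ := Real.Gamma_pos_of_pos hγ
  have hi : ∀ k : ℝ → ℝ, ContinuousOn k (Icc 0 t) →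
      IntervalIntegrable (fun s => (t - s) ^ (γ - 1) * k s) volume 0 t := fun k hk =>
    intervalIntegrable_sub_left_rpow_mul (by linarith) ht (hk.mono Ioc_subset_Icc_self)
      (hk.intervalIntegrable_of_Icc ht.le)
  have hker : ∫ s in (0 : ℝ)..t, (t - s) ^ (γ - 1) * ε = t ^ γ / γ * ε := by
    rw [intervalIntegral.integral_mul_const,
      intervalIntegral.integral_comp_sub_left (fun r : ℝ => r ^ (γ - 1)) t,
      integral_rpow (Or.inl (by linarith))]
    simp [Real.zero_rpow hγ.ne']
  have hle : |∫ s in (0 : ℝ)..t, (t - s) ^ (γ - 1) * (g s - h s)| ≤ t ^ γ / γ * ε := by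
    rw [← hker]
    refine intervalIntegral.norm_integral_le_of_norm_le (g := fun s => (t - s) ^ (γ - 1) * ε)
      (f := fun s => (t - s) ^ (γ - 1) * (g s - h s)) ht.le ?_ (hi _ continuousOn_const)
    filter_upwards with s hs
    have h0 := Real.rpow_nonneg (sub_nonneg.2 hs.2) (γ - 1)
    rw [norm_mul, Real.norm_of_nonneg h0]
    exact mul_le_mul_of_nonneg_left (hgh s (Ioc_subset_Icc_self hs)) h0
  rw [← mul_sub, ← intervalIntegral.integral_sub (hi g hg) (hi h hh)]
  simp only [← mul_sub]
  rw [abs_mul, abs_of_pos (one_div_pos.2 hG)]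
  calc _ ≤ 1 / Real.Gamma γ * (t ^ γ / γ * ε) := by gcongr
    _ = _ := by field_simp

/-- One half of the comparison theorem: subsolutions starting below the solution stay below it. -/
theorem le_of_caputoDeriv_le
    (γ T : ℝ) (hγ : γ ∈ Set.Ioo (0:ℝ) 1) (hT : 0 < T)
    (f : ℝ → ℝ → ℝ)
    (hf_cont : ContinuousOn (fun p : ℝ × ℝ => f p.1 p.2) (Set.Icc 0 T ×ˢ Set.univ))
    (hf_lip : ∀ M > (0:ℝ), ∃ L ≥ (0:ℝ), ∀ t ∈ Set.Icc 0 T,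
      ∀ x ∈ Set.Icc (-M) M, ∀ y ∈ Set.Icc (-M) M, |f t x - f t y| ≤ L * |x - y|)
    (u : ℝ → ℝ)
    (hu_cont : ContinuousOn u (Set.Icc 0 T))
    (hu : ∀ t ∈ Set.Icc 0 T,
      u t = u 0 + (1 / Real.Gamma γ) * ∫ s in (0:ℝ)..t, (t - s) ^ (γ - 1) * f s (u s))
    (v : ℝ → ℝ)
    (hv_cont : ContinuousOn v (Set.Icc 0 T))
    (hv_diff : ∀ t ∈ Set.Ioc 0 T, DifferentiableAt ℝ v t)
    (hv_deriv_cont : ContinuousOn (deriv v) (Set.Ioc 0 T))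
    (hv_deriv_int : ∀ t ∈ Set.Ioc 0 T, IntervalIntegrable (deriv v) volume 0 t)
    (hsub : ∀ t ∈ Set.Ioc 0 T, caputoDeriv γ v t ≤ f t (v t)) (h0 : v 0 ≤ u 0) :
    ∀ t ∈ Set.Icc 0 T, v t ≤ u t := by
  obtain ⟨Mu, hMu⟩ := isCompact_Icc.exists_bound_of_continuousOn hu_cont
  obtain ⟨Mv, hMv⟩ := isCompact_Icc.exists_bound_of_continuousOn hv_cont
  obtain ⟨L, hL, hLip⟩ := hf_lip (max 1 (max Mu Mv)) (by positivity)
  have hl : 0 < (L + 1) ^ γ⁻¹ := by positivity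
  set l := (L + 1) ^ γ⁻¹ with hldef
  have hlγ : l ^ γ = L + 1 := by
    rw [hldef, ← Real.rpow_mul (by positivity), inv_mul_cancel₀ hγ.1.ne', Real.rpow_one]
  have hG : 0 < Real.Gamma γ := Real.Gamma_pos_of_pos hγ.1
  have hγ0 := hγ.1
  set C := T ^ γ / (γ * Real.Gamma γ) with hC
  have hC0 : 0 ≤ C := by positivity
  have hg : ContinuousOn (fun s => f s (u s)) (Icc 0 T) :=
    hf_cont.comp (continuousOn_id.prodMk hu_cont) fun s hs => ⟨hs, mem_univ _⟩
  suffices hmain : ∀ ε > 0, ∀ t ∈ Icc 0 T,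
      v t - u t ≤ (Real.exp (l * T) * (L * C + 1) + C) * ε by
    intro t ht
    have hK : 0 < Real.exp (l * T) * (L * C + 1) + C := by positivity
    refine sub_nonpos.1 (le_of_forall_pos_le_add fun δ hδ => ?_)
    have := hmain (δ / (Real.exp (l * T) * (L * C + 1) + C)) (by positivity) t ht
    rwa [mul_div_cancel₀ _ hK.ne', ← zero_add δ] at this
  intro ε hε
  obtain ⟨p, hp⟩ := exists_polynomial_near_of_continuousOn 0 T _ hg ε hε
  obtain ⟨U, U', hU, hU0, hUd, hUc, hUi, hUcap, hUint⟩ := exists_caputoDeriv_eq_polynomial hγ p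
  have happ : ∀ t ∈ Icc 0 T, |u 0 + U t - u t| ≤ C * ε := by
    intro t ht
    rcases ht.1.eq_or_lt with rfl | htpos
    · simpa [hU0] using by positivity
    · rw [hu t ht, ← hUint t htpos, add_sub_add_left_eq_sub]
      refine (abs_fractionalIntegral_sub_le hγ.1 htpos p.continuous.continuousOn
        (hg.mono (Icc_subset_Icc_right ht.2))
        fun s hs => (hp s ⟨hs.1, hs.2.trans ht.2⟩).le).trans ?_
      rw [hC]
      gcongr
      exact ht.2
  set w := fun t => v t - (u 0 + U t) with hw
  have hwc : ContinuousOn w (Icc 0 T) := hv_cont.sub (continuous_const.add hU).continuousOn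
  have hwd : ∀ t ∈ Ioc 0 T, HasDerivAt w (deriv v t - U' t) t := fun t ht =>
    (hv_diff t ht).hasDerivAt.sub ((hUd t ht.1).const_add _)
  have hdw : ∀ t ∈ Ioc 0 T, deriv w t = deriv v t - U' t := fun t ht => (hwd t ht).deriv
  have hcap : ∀ t ∈ Ioc 0 T, caputoDeriv γ w t = caputoDeriv γ v t - p.eval t := by
    intro t ht
    rw [← hUcap t ht.1]
    unfold caputoDeriv
    rw [← mul_sub, ← intervalIntegral.integral_sub]
    · congr 1
      refine intervalIntegral.integral_congr_ae (Eventually.of_forall fun s hs => ?_)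
      rw [uIoc_of_le ht.1.le] at hs
      rw [hdw s ⟨hs.1, hs.2.trans ht.2⟩, mul_sub]
    · exact intervalIntegrable_sub_left_rpow_mul (by linarith [hγ.2]) ht.1
        (hv_deriv_cont.mono (Ioc_subset_Ioc_right ht.2)) (hv_deriv_int t ht)
    · exact intervalIntegrable_sub_left_rpow_mul (by linarith [hγ.2]) ht.1
        (hUc.mono fun s hs => hs.1) (hUi t)
  obtain ⟨m, hm, hmax⟩ := isCompact_Icc.exists_isMaxOn (nonempty_Icc.2 hT.le)
    (((by fun_prop : Continuous fun s => Real.exp (-(l * s))).continuousOn).mul hwc)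
  have hwle : ∀ s ∈ Icc 0 T, w s ≤ Real.exp (l * (s - m)) * w m := by
    intro s hs
    have h1 : Real.exp (-(l * s)) * w s ≤ Real.exp (-(l * m)) * w m := hmax hs
    have h2 := mul_le_mul_of_nonneg_left h1 (Real.exp_pos (l * s)).le
    rw [← mul_assoc, ← mul_assoc, ← Real.exp_add, ← Real.exp_add] at h2
    rwa [add_neg_cancel, Real.exp_zero, one_mul,
      show l * s + -(l * m) = l * (s - m) by ring] at h2
  have hw0 : w 0 ≤ 0 := by simp [hw, hU0, h0]
  have hwm : w m ≤ (L * C + 1) * ε := by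
    rcases le_or_gt (w m) 0 with hneg | hpos
    · exact hneg.trans (by positivity)
    have hm0 : 0 < m := hm.1.lt_of_ne fun h => by rw [← h] at hpos; linarith
    have hmT : m ∈ Ioc 0 T := ⟨hm0, hm.2⟩
    have hsubT : Ioc 0 m ⊆ Ioc 0 T := Ioc_subset_Ioc_right hm.2
    have key := rpow_mul_le_caputoDeriv hγ hl hm0 (hwc.mono (Icc_subset_Icc_right hm.2))
      (fun s hs => (hwd s (hsubT hs)).differentiableAt)
      (((hv_deriv_cont.mono hsubT).sub (hUc.mono fun s hs => hs.1)).congr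
        fun s hs => hdw s (hsubT hs))
      (((hv_deriv_int m hmT).sub (hUi m)).congr fun s hs => by
        rw [uIoc_of_le hm0.le] at hs
        exact (hdw s (hsubT hs)).symm)
      hw0 hpos.le (fun s hs => by
        have := hwle s ⟨hs.1, hs.2.trans hm.2⟩
        rwa [show l * (s - m) = -(l * (m - s)) by ring] at this)
    rw [hlγ, hcap m hmT] at key
    have hb : ∀ x : ℝ, |x| ≤ max Mu Mv → x ∈ Icc (-(max 1 (max Mu Mv))) (max 1 (max Mu Mv)) :=
      fun x hx => abs_le.1 (hx.trans (le_max_right _ _))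
    have hlip := hLip m hm (v m) (hb _ ((hMv m hm).trans (le_max_right _ _)))
      (u m) (hb _ ((hMu m hm).trans (le_max_left _ _)))
    have hvu : |v m - u m| ≤ w m + C * ε := by
      have : v m - u m = w m + (u 0 + U m - u m) := by simp only [hw]; ring
      rw [this]
      refine (abs_add_le _ _).trans ?_
      rw [abs_of_pos hpos]
      gcongr
      exact happ m hm
    have h1 := (abs_le.1 (hp m hm).le).1
    have h2 := (le_abs_self _).trans (hlip.trans (mul_le_mul_of_nonneg_left hvu hL))
    have h3 := hsub m hmT
    linarith
  intro t ht
  have h1 := (abs_le.1 (happ t ht)).2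
  have h2 : w t ≤ Real.exp (l * T) * ((L * C + 1) * ε) := by
    refine (hwle t ht).trans ?_
    calc Real.exp (l * (t - m)) * w m ≤ Real.exp (l * (t - m)) * ((L * C + 1) * ε) := by gcongr
      _ ≤ _ := by gcongr; linarith [ht.2, hm.1]
  have h3 : w t = v t - (u 0 + U t) := rfl
  linarith

/-- Generalized Grönwall inequality / comparison theorem:
subsolutions (resp. supersolutions) of `D_c^γ u = f(t,u)` stay below (resp. above)
the solution if they start below (resp. above). -/
theorem caputo_gronwall_comparison
    (γ T : ℝ) (hγ : γ ∈ Set.Ioo (0:ℝ) 1) (hT : 0 < T)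
    (f : ℝ → ℝ → ℝ)
    (hf_cont : ContinuousOn (fun p : ℝ × ℝ => f p.1 p.2) (Set.Icc 0 T ×ˢ Set.univ))
    (hf_lip : ∀ M > (0:ℝ), ∃ L ≥ (0:ℝ), ∀ t ∈ Set.Icc 0 T,
      ∀ x ∈ Set.Icc (-M) M, ∀ y ∈ Set.Icc (-M) M, |f t x - f t y| ≤ L * |x - y|)
    (u : ℝ → ℝ)
    (hu_cont : ContinuousOn u (Set.Icc 0 T))
    (hu : ∀ t ∈ Set.Icc 0 T,
      u t = u 0 + (1 / Real.Gamma γ) * ∫ s in (0:ℝ)..t, (t - s) ^ (γ - 1) * f s (u s))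
    (v : ℝ → ℝ)
    (hv_cont : ContinuousOn v (Set.Icc 0 T))
    (hv_diff : ∀ t ∈ Set.Ioc 0 T, DifferentiableAt ℝ v t)
    (hv_deriv_cont : ContinuousOn (deriv v) (Set.Ioc 0 T))
    (hv_deriv_int : ∀ t ∈ Set.Ioc 0 T, IntervalIntegrable (deriv v) volume 0 t) :
    ((∀ t ∈ Set.Ioc 0 T, caputoDeriv γ v t ≤ f t (v t)) → v 0 ≤ u 0 →
      ∀ t ∈ Set.Icc 0 T, v t ≤ u t) ∧
    ((∀ t ∈ Set.Ioc 0 T, f t (v t) ≤ caputoDeriv γ v t) → u 0 ≤ v 0 →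
      ∀ t ∈ Set.Icc 0 T, u t ≤ v t) := by
  refine ⟨le_of_caputoDeriv_le γ T hγ hT f hf_cont hf_lip u hu_cont hu v hv_cont hv_diff
    hv_deriv_cont hv_deriv_int, fun hsup h0 t ht => ?_⟩
  have hderiv : deriv (fun s => -v s) = fun s => -deriv v s := funext fun s => deriv.fun_neg
  refine neg_le_neg_iff.1 (le_of_caputoDeriv_le γ T hγ hT (fun t x => -f t (-x)) ?_ ?_
    (fun s => -u s) hu_cont.neg ?_ (fun s => -v s) hv_cont.neg (fun s hs => (hv_diff s hs).neg)
    ?_ ?_ ?_ (neg_le_neg h0) t ht)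
  · exact (hf_cont.comp (by fun_prop : Continuous fun p : ℝ × ℝ => (p.1, -p.2)).continuousOn
      fun p hp => ⟨hp.1, mem_univ _⟩).neg
  · intro M hM
    obtain ⟨L, hL, h⟩ := hf_lip M hM
    refine ⟨L, hL, fun s hs x hx y hy => ?_⟩
    simpa only [neg_sub_neg] using
      h s hs (-y) ⟨neg_le_neg hy.2, neg_le.1 hy.1⟩ (-x) ⟨neg_le_neg hx.2, neg_le.1 hx.1⟩
  · intro s hs
    simp only [neg_neg, mul_neg, intervalIntegral.integral_neg]
    rw [hu s hs]
    ring
  · rw [hderiv]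
    exact hv_deriv_cont.neg
  · rw [hderiv]
    exact fun s hs => (hv_deriv_int s hs).neg
  · intro s hs
    have := hsup s hs
    unfold caputoDeriv at this ⊢
    simp only [hderiv, mul_neg, intervalIntegral.integral_neg, neg_neg]
    linarith
end

section
/- Let γ ∈ (0,1), A > 0, p > 1, u₀ > 0, and let u : [0,T_b) → (0,∞) be the maximal continuous solution of u(t) = u₀ + (A/Γ(γ)) ∫₀ᵗ (t−s)^(γ−1) u(s)^p ds. Then T_b < ∞, lim_{t→T_b⁻} u(t) = ∞, and lim_{t→T_b⁻} (T_b − t)^(γ/(p−1)) u(t) = [Γ(pγ/(p−1)) / (A Γ(γ/(p−1)))]^(1/(p−1)). -/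
open MeasureTheory Set Filter
open scoped ENNReal

/-- The Taylor coefficients of `(1 - x) ^ (γ - 1)` at `0`. -/
noncomputable def kernelCoeff (γ : ℝ) (n : ℕ) : ℝ := Ring.choose (1 - γ + n - 1) n

lemma kernelCoeff_pos {γ : ℝ} (hγ : γ < 1) (n : ℕ) : 0 < kernelCoeff γ n := by
  have h := Ring.factorial_nsmul_multichoose_eq_ascPochhammer (1 - γ) n
  rw [Polynomial.ascPochhammer_smeval_eq_eval, Ring.multichoose_eq, nsmul_eq_mul] at h
  have h2 := ascPochhammer_pos n (1 - γ) (by linarith)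
  rw [← h] at h2
  exact pos_of_mul_pos_right h2 (by positivity)

lemma hasSum_kernelCoeff (γ : ℝ) {x : ℝ} (hx : |x| < 1) :
    HasSum (fun n => kernelCoeff γ n * x ^ n) ((1 - x) ^ (γ - 1)) := by
  have h := (Real.one_div_one_sub_rpow_hasFPowerSeriesOnBall_zero (1 - γ)).hasSum (y := x)
    (by simpa [enorm_eq_nnnorm] using! hx)
  have h1 : (0:ℝ) ≤ 1 - x := by linarith [(abs_lt.1 hx).2]
  have e : (1 - x) ^ (γ - 1) = 1 / (1 - x) ^ (1 - γ) := by
    rw [one_div, ← Real.rpow_neg h1]; congr 1; ring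
  rw [e]
  simpa [kernelCoeff, FormalMultilinearSeries.ofScalars_apply_eq, mul_comm] using h

lemma intervalIntegrable_betaKernel {α β : ℝ} (hα : 0 < α) (hβ : 0 < β) :
    IntervalIntegrable (fun x : ℝ => x ^ (α - 1) * (1 - x) ^ (β - 1)) volume 0 1 := by
  have h := (Complex.betaIntegral_convergent (u := α) (v := β) (by simpa) (by simpa)).norm
  refine h.congr_ae ?_
  rw [uIoc_of_le zero_le_one, ← restrict_Ioo_eq_restrict_Ioc]
  filter_upwards [ae_restrict_mem measurableSet_Ioo] with x hx
  have h1 : (0:ℝ) < 1 - x := by linarith [hx.2]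
  rw [norm_mul, show (1 - (x:ℂ)) = ((1 - x : ℝ) : ℂ) by push_cast; rfl,
    Complex.norm_cpow_eq_rpow_re_of_pos hx.1, Complex.norm_cpow_eq_rpow_re_of_pos h1]
  simp

lemma integral_betaKernel {α β : ℝ} (hα : 0 < α) (hβ : 0 < β) :
    ∫ x in (0:ℝ)..1, x ^ (α - 1) * (1 - x) ^ (β - 1) = ProbabilityTheory.beta α β := by
  rw [ProbabilityTheory.beta_eq_betaIntegralReal α β hα hβ, Complex.betaIntegral]
  have : ∫ x in (0:ℝ)..1, (x:ℂ) ^ ((α:ℂ) - 1) * (1 - (x:ℂ)) ^ ((β:ℂ) - 1)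
      = ∫ x in (0:ℝ)..1, ((x ^ (α - 1) * (1 - x) ^ (β - 1) : ℝ) : ℂ) := by
    refine intervalIntegral.integral_congr fun x hx => ?_
    rw [uIcc_of_le zero_le_one] at hx
    have h1 : (0:ℝ) ≤ 1 - x := by linarith [hx.2]
    rw [Complex.ofReal_mul, Complex.ofReal_cpow hx.1, Complex.ofReal_cpow h1]
    push_cast
    rfl
  rw [this, intervalIntegral.integral_ofReal, Complex.ofReal_re]

/-- Termwise integration for a series of nonnegative functions with integrable sum. -/
lemma hasSum_intervalIntegral_of_nonneg {F : ℕ → ℝ → ℝ} {f : ℝ → ℝ} {a b : ℝ} (hab : a ≤ b)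
    (hmeas : ∀ n, AEStronglyMeasurable (F n) (volume.restrict (Ioo a b)))
    (hnn : ∀ n, ∀ x ∈ Ioo a b, 0 ≤ F n x) (hf : IntervalIntegrable f volume a b)
    (hsum : ∀ x ∈ Ioo a b, HasSum (fun n => F n x) (f x)) :
    HasSum (fun n => ∫ x in a..b, F n x) (∫ x in a..b, f x) := by
  simp only [intervalIntegral.integral_of_le hab, integral_Ioc_eq_integral_Ioo]
  have hmem := ae_restrict_mem (μ := (volume : Measure ℝ)) (measurableSet_Ioo (a := a) (b := b))
  refine MeasureTheory.hasSum_integral_of_dominated_convergence F hmeas ?_ ?_ ?_ ?_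
  · intro n
    filter_upwards [hmem] with x hx
    rw [Real.norm_of_nonneg (hnn n x hx)]
  · filter_upwards [hmem] with x hx using (hsum x hx).summable
  · have h := (intervalIntegrable_iff_integrableOn_Ioo_of_le hab).1 hf
    refine h.congr ?_
    filter_upwards [hmem] with x hx using (hsum x hx).tsum_eq.symm
  · filter_upwards [hmem] with x hx using hsum x hx

lemma hasSum_kernelCoeff_div {γ β : ℝ} (hγ : γ ∈ Ioo (0:ℝ) 1) (hβ : 0 < β) :
    HasSum (fun n : ℕ => kernelCoeff γ n / (β + n)) (ProbabilityTheory.beta β γ) := by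
  have h := hasSum_intervalIntegral_of_nonneg (a := 0) (b := 1) zero_le_one
    (F := fun n x => kernelCoeff γ n * x ^ (β - 1 + n))
    (f := fun x => x ^ (β - 1) * (1 - x) ^ (γ - 1)) ?_ ?_
    (intervalIntegrable_betaKernel hβ hγ.1) ?_
  · rw [integral_betaKernel hβ hγ.1] at h
    convert h using 2 with n
    have hn : (0:ℝ) ≤ n := n.cast_nonneg
    rw [intervalIntegral.integral_const_mul, integral_rpow (Or.inl (by linarith)),
      Real.zero_rpow (by linarith), Real.one_rpow]
    rw [show β - 1 + n + 1 = β + n by ring]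
    ring
  · intro n
    exact (Measurable.const_mul (measurable_id.pow_const _) _).aestronglyMeasurable
  · intro n x hx
    exact mul_nonneg (kernelCoeff_pos hγ.2 n).le (Real.rpow_nonneg hx.1.le _)
  · intro x hx
    have h2 := (hasSum_kernelCoeff γ (x := x) (by rw [abs_of_pos hx.1]; exact hx.2)).mul_left
      (x ^ (β - 1))
    refine h2.congr_fun fun n => ?_
    rw [Real.rpow_add hx.1, Real.rpow_natCast]
    ring

/-- `u` is a positive continuous solution on `[0, T)` of the Abel–Volterra equation
`u t = u₀ + k ∫₀ᵗ (t - s) ^ (γ - 1) u s ^ p ds`. -/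
structure IsVolterraSol (γ k p u₀ T : ℝ) (u : ℝ → ℝ) : Prop where
  cont : ContinuousOn u (Ico 0 T)
  pos : ∀ t ∈ Ico 0 T, 0 < u t
  eq : ∀ t ∈ Ico 0 T, u t = u₀ + k * ∫ s in (0:ℝ)..t, (t - s) ^ (γ - 1) * u s ^ p

lemma intervalIntegrable_abelKernel {γ : ℝ} (hγ : 0 < γ) (a b t : ℝ) :
    IntervalIntegrable (fun s => (t - s) ^ (γ - 1)) volume a b := by
  have h := (intervalIntegral.intervalIntegrable_rpow' (a := t - b) (b := t - a)
    (r := γ - 1) (by linarith)).comp_sub_left t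
  simpa using h.symm

lemma intervalIntegrable_abelKernel_mul {γ : ℝ} (hγ : 0 < γ) {a b : ℝ} (hab : a ≤ b) (t : ℝ)
    {w : ℝ → ℝ} (hw : ContinuousOn w (Icc a b)) :
    IntervalIntegrable (fun s => (t - s) ^ (γ - 1) * w s) volume a b :=
  (intervalIntegrable_abelKernel hγ a b t).mul_continuousOn (by rwa [uIcc_of_le hab])

lemma integral_abelKernel {γ : ℝ} (hγ : 0 < γ) (a t : ℝ) :
    ∫ s in a..t, (t - s) ^ (γ - 1) = (t - a) ^ γ / γ := by
  rw [intervalIntegral.integral_comp_sub_left (fun x => x ^ (γ - 1)) t,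
    integral_rpow (Or.inl (by linarith))]
  simp [Real.zero_rpow hγ.ne']

namespace IsVolterraSol

variable {γ k p u₀ T : ℝ} {u : ℝ → ℝ}

lemma continuousOn_rpow (h : IsVolterraSol γ k p u₀ T u) {a b : ℝ} (ha : 0 ≤ a) (hb : b < T) :
    ContinuousOn (fun s => u s ^ p) (Icc a b) :=
  (h.cont.mono (Icc_subset_Ico ha hb)).rpow_const
    fun s hs => Or.inl (h.pos s ⟨ha.trans hs.1, hs.2.trans_lt hb⟩).ne'

lemma intervalIntegrable (h : IsVolterraSol γ k p u₀ T u) (hγ : 0 < γ) {a b : ℝ} (ha : 0 ≤ a)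
    (hab : a ≤ b) (hb : b < T) (t : ℝ) :
    IntervalIntegrable (fun s => (t - s) ^ (γ - 1) * u s ^ p) volume a b :=
  intervalIntegrable_abelKernel_mul hγ hab t (h.continuousOn_rpow ha hb)

lemma eq_split (h : IsVolterraSol γ k p u₀ T u) (hγ : 0 < γ) {t r : ℝ} (ht : 0 ≤ t)
    (htr : t ≤ r) (hr : r < T) :
    u r = u₀ + k * (∫ s in (0:ℝ)..t, (r - s) ^ (γ - 1) * u s ^ p)
      + k * ∫ s in t..r, (r - s) ^ (γ - 1) * u s ^ p := by
  rw [h.eq r ⟨ht.trans htr, hr⟩, ← intervalIntegral.integral_add_adjacent_intervals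
    (h.intervalIntegrable hγ le_rfl ht (htr.trans_lt hr) r)
    (h.intervalIntegrable hγ ht htr hr r)]
  ring

lemma integral_nonneg (h : IsVolterraSol γ k p u₀ T u) {a b r : ℝ} (ha : 0 ≤ a)
    (hab : a ≤ b) (hbr : b ≤ r) (hb : b < T) :
    0 ≤ ∫ s in a..b, (r - s) ^ (γ - 1) * u s ^ p :=
  intervalIntegral.integral_nonneg hab fun s hs =>
    mul_nonneg (Real.rpow_nonneg (by linarith [hs.2]) _)
      (Real.rpow_nonneg (h.pos s ⟨ha.trans hs.1, hs.2.trans_lt hb⟩).le _)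

lemma initial_le (h : IsVolterraSol γ k p u₀ T u) (hk : 0 ≤ k) {t : ℝ} (ht : t ∈ Ico 0 T) :
    u₀ ≤ u t := by
  rw [h.eq t ht]
  have := h.integral_nonneg (r := t) le_rfl ht.1 le_rfl ht.2
  nlinarith

lemma monotoneOn (h : IsVolterraSol γ k p u₀ T u) (hγ : 0 < γ) (hk : 0 < k) (hp : 0 ≤ p) :
    MonotoneOn u (Ico 0 T) := by
  suffices H : ∀ t d : ℝ, 0 ≤ t → 0 < d → t + d < T → 0 < u (t + d) - u t by
    intro a ha b hb hab
    rcases hab.eq_or_lt with rfl | hab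
    · rfl
    · have := H a (b - a) ha.1 (by linarith) (by simpa using hb.2)
      rw [add_sub_cancel] at this
      linarith
  intro t₁ d ht₁ hd hT
  by_contra hneg
  have hcont : ContinuousOn (fun t => u (t + d) - u t) (Icc 0 t₁) := by
    refine ContinuousOn.sub (h.cont.comp (by fun_prop) ?_) (h.cont.mono ?_)
    · intro t ht
      exact ⟨by linarith [ht.1], by linarith [ht.2]⟩
    · intro t ht
      exact ⟨ht.1, by linarith [ht.2]⟩
  have hcomp : IsCompact (Icc 0 t₁ ∩ (fun t => u (t + d) - u t) ⁻¹' Iic 0) :=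
    isCompact_Icc.of_isClosed_subset
      (hcont.preimage_isClosed_of_isClosed isClosed_Icc isClosed_Iic) inter_subset_left
  obtain ⟨c, hc, hmin⟩ := hcomp.exists_isLeast
    ⟨t₁, ⟨ht₁, le_rfl⟩, by simpa using not_lt.1 hneg⟩
  have hc0 : 0 ≤ c := hc.1.1
  have hc1 : c ≤ t₁ := hc.1.2
  have hle : u (c + d) - u c ≤ 0 := hc.2
  have hbefore : ∀ s ∈ Ioo 0 c, u s ≤ u (s + d) := by
    intro s hs
    by_contra hcon
    have := hmin ⟨⟨hs.1.le, hs.2.le.trans hc1⟩,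
      show u (s + d) - u s ≤ 0 by linarith [not_le.1 hcon]⟩
    linarith [hs.2]
  have e1 := h.eq_split hγ (t := d) (r := c + d) hd.le (by linarith) (by linarith)
  have e2 := h.eq c ⟨hc0, by linarith⟩
  have hfirst : 0 < ∫ s in (0:ℝ)..d, (c + d - s) ^ (γ - 1) * u s ^ p := by
    refine intervalIntegral.intervalIntegral_pos_of_pos_on
      (h.intervalIntegrable hγ le_rfl hd.le (by linarith) _) (fun s hs => ?_) hd
    exact mul_pos (Real.rpow_pos_of_pos (by linarith [hs.2]) _)
      (Real.rpow_pos_of_pos (h.pos s ⟨hs.1.le, by linarith [hs.2]⟩) _)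
  have hshift : ∫ s in d..(c + d), (c + d - s) ^ (γ - 1) * u s ^ p
      = ∫ s in (0:ℝ)..c, (c - s) ^ (γ - 1) * u (s + d) ^ p := by
    have := intervalIntegral.integral_comp_add_right (a := 0) (b := c)
      (fun s => (c + d - s) ^ (γ - 1) * u s ^ p) d
    rw [zero_add] at this
    rw [← this]
    refine intervalIntegral.integral_congr fun s _ => ?_
    simp only [add_sub_add_right_eq_sub]
  have hsecond : ∫ s in (0:ℝ)..c, (c - s) ^ (γ - 1) * u s ^ p
      ≤ ∫ s in (0:ℝ)..c, (c - s) ^ (γ - 1) * u (s + d) ^ p := by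
    refine intervalIntegral.integral_mono_on_of_le_Ioo hc0
      (h.intervalIntegrable hγ le_rfl hc0 (by linarith) _)
      (intervalIntegrable_abelKernel_mul hγ hc0 c (w := fun s => u (s + d) ^ p) ?_) ?_
    · refine (h.continuousOn_rpow (a := 0) (b := c + d) le_rfl (by linarith)).comp
        (f := fun s => s + d) (by fun_prop) ?_
      intro s hs
      exact ⟨by linarith [hs.1], by linarith [hs.2]⟩
    · intro s hs
      refine mul_le_mul_of_nonneg_left ?_ (Real.rpow_nonneg (by linarith [hs.2]) _)
      exact Real.rpow_le_rpow (h.pos s ⟨hs.1.le, by linarith [hs.2]⟩).le (hbefore s hs) hp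
  rw [hshift] at e1
  nlinarith

/-- Quantitative blow-up: a solution with a large value can only survive for a short time. -/
lemma rpow_mul_le_one (h : IsVolterraSol γ k p u₀ T u) (hγ : γ ∈ Ioo (0:ℝ) 1) (hk : 0 < k)
    (hp : 1 < p) (hu₀ : 0 < u₀) {t d : ℝ} (ht : 0 ≤ t) (hd : 0 < d) (hT : t + d < T) :
    u t ^ (p - 1) * ((p - 1) * k * 2 ^ (-p) * d ^ γ) ≤ 1 := by
  set κ := k * d ^ (γ - 1) with hκ
  have hκ0 : 0 < κ := by positivity
  have hut := h.pos t ⟨ht, by linarith⟩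
  have hI : ∀ r ∈ Icc t (t + d), IntervalIntegrable (fun s => u s ^ p) volume t r := by
    intro r hr
    exact ContinuousOn.intervalIntegrable
      (by rw [uIcc_of_le hr.1]; exact h.continuousOn_rpow ht (by linarith [hr.2]))
  set V : ℝ → ℝ := fun r => u t + κ * ∫ s in t..r, u s ^ p with hV
  have hVpos : ∀ r ∈ Icc t (t + d), 0 < V r := by
    intro r hr
    have : 0 ≤ ∫ s in t..r, u s ^ p := intervalIntegral.integral_nonneg hr.1 fun s hs =>
      Real.rpow_nonneg (h.pos s ⟨ht.trans hs.1, by linarith [hs.2, hr.2]⟩).le _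
    simp only [hV]
    positivity
  have hVle : ∀ r ∈ Icc t (t + d), V r ≤ 2 * u r := by
    intro r hr
    have hrT : r < T := by linarith [hr.2]
    have h1 := h.monotoneOn hγ.1 hk (by linarith) ⟨ht, by linarith⟩ ⟨ht.trans hr.1, hrT⟩ hr.1
    have h2 := h.eq_split hγ.1 ht hr.1 hrT
    have h3 := h.integral_nonneg (r := r) le_rfl ht hr.1 (hr.1.trans_lt hrT)
    have h4 : d ^ (γ - 1) * ∫ s in t..r, u s ^ p ≤ ∫ s in t..r, (r - s) ^ (γ - 1) * u s ^ p := by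
      rw [← intervalIntegral.integral_const_mul]
      refine intervalIntegral.integral_mono_on_of_le_Ioo hr.1 ((hI r hr).const_mul _)
        (h.intervalIntegrable hγ.1 ht hr.1 hrT r) fun s hs => ?_
      refine mul_le_mul_of_nonneg_right ?_
        (Real.rpow_nonneg (h.pos s ⟨ht.trans hs.1.le, hs.2.trans hrT⟩).le _)
      exact Real.rpow_le_rpow_of_nonpos (by linarith [hs.2]) (by linarith [hs.1, hr.2])
        (by linarith [hγ.2])
    have h5 := mul_le_mul_of_nonneg_left h4 hk.le
    have h6 := mul_nonneg hk.le h3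
    simp only [hV, hκ]
    rw [mul_assoc]
    linarith
  have hVder : ∀ r ∈ Ioo t (t + d), HasDerivAt V (κ * u r ^ p) r := by
    intro r hr
    refine HasDerivAt.const_add _ (HasDerivAt.const_mul κ ?_)
    have hco : ContinuousOn (fun s => u s ^ p) (Icc t (t + d)) := h.continuousOn_rpow ht hT
    have hmem : Icc t (t + d) ∈ nhds r := Icc_mem_nhds hr.1 hr.2
    exact intervalIntegral.integral_hasDerivAt_right (hI r (Ioo_subset_Icc_self hr))
      (hco.stronglyMeasurableAtFilter_nhdsWithin measurableSet_Icc r |>.filter_mono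
        (by rw [nhdsWithin_eq_nhds.2 hmem]))
      (hco.continuousAt hmem)
  have hVcont : ContinuousOn V (Icc t (t + d)) := by
    refine continuousOn_const.add (continuousOn_const.mul ?_)
    have := intervalIntegral.continuousOn_primitive_interval (μ := volume)
      (f := fun s => u s ^ p) (a := t) (b := t + d) ?_
    · rwa [uIcc_of_le (by linarith)] at this
    · rw [uIcc_of_le (by linarith)]
      exact (h.continuousOn_rpow ht hT).integrableOn_Icc
  have hanti : AntitoneOn (fun r => V r ^ (1 - p) + (p - 1) * κ * 2 ^ (-p) * r)
      (Icc t (t + d)) := by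
    refine antitoneOn_of_deriv_nonpos (convex_Icc _ _) ?_ ?_ ?_
    · exact (hVcont.rpow_const fun r hr => Or.inl (hVpos r hr).ne').add (by fun_prop)
    all_goals rw [interior_Icc]
    · intro r hr
      exact (((hVder r hr).rpow_const (Or.inl (hVpos r (Ioo_subset_Icc_self hr)).ne')).add
        ((hasDerivAt_id r).const_mul _)).differentiableAt.differentiableWithinAt
    · intro r hr
      have hr' := Ioo_subset_Icc_self hr
      have hVr := hVpos r hr'
      have hd := ((hVder r hr).rpow_const (p := 1 - p) (Or.inl hVr.ne')).add
        ((hasDerivAt_id r).const_mul ((p - 1) * κ * 2 ^ (-p)))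
      have hd' : deriv (fun r => V r ^ (1 - p) + (p - 1) * κ * 2 ^ (-p) * r) r = _ := hd.deriv
      rw [hd']
      have hur := h.pos r ⟨ht.trans hr'.1, by linarith [hr'.2]⟩
      have h1 : V r ^ p * 2 ^ (-p) ≤ u r ^ p := by
        have := Real.rpow_le_rpow hVr.le (hVle r hr') (by linarith : 0 ≤ p)
        rw [Real.mul_rpow (by norm_num) hur.le] at this
        rw [Real.rpow_neg (by norm_num), ← div_eq_mul_inv, div_le_iff₀ (by positivity)]
        linarith
      have h2 : V r ^ (1 - p - 1) * V r ^ p = 1 := by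
        rw [← Real.rpow_add hVr]; simp
      have h3 : 2 ^ (-p) ≤ u r ^ p * V r ^ (1 - p - 1) := by
        calc (2:ℝ) ^ (-p) = V r ^ (1 - p - 1) * (V r ^ p * 2 ^ (-p)) := by rw [← mul_assoc, h2, one_mul]
          _ ≤ V r ^ (1 - p - 1) * u r ^ p := by gcongr
          _ = _ := mul_comm _ _
      have h4 := mul_le_mul_of_nonneg_left h3 (by nlinarith : 0 ≤ (p - 1) * κ)
      nlinarith
  have hend := hanti ⟨le_rfl, by linarith⟩ ⟨by linarith, le_rfl⟩ (by linarith : t ≤ t + d)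
  have hVt : V t = u t := by simp [hV]
  have hVend := Real.rpow_pos_of_pos (hVpos (t + d) ⟨by linarith, le_rfl⟩) (1 - p)
  simp only [hVt] at hend
  have hfin : (p - 1) * κ * 2 ^ (-p) * d ≤ u t ^ (1 - p) := by linarith
  have hdγ : d ^ (γ - 1) * d = d ^ γ := by
    conv_rhs => rw [show γ = (γ - 1) + 1 by ring, Real.rpow_add hd, Real.rpow_one]
  have e : u t ^ (p - 1) * u t ^ (1 - p) = 1 := by rw [← Real.rpow_add hut]; simp
  calc u t ^ (p - 1) * ((p - 1) * k * 2 ^ (-p) * d ^ γ)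
      = u t ^ (p - 1) * ((p - 1) * κ * 2 ^ (-p) * d) := by rw [← hdγ, hκ]; ring
    _ ≤ u t ^ (p - 1) * u t ^ (1 - p) := by gcongr
    _ = 1 := e

/-- The lower blow-up rate. -/
lemma one_le_rpow_mul (h : IsVolterraSol γ k p u₀ T u) (hγ : γ ∈ Ioo (0:ℝ) 1) (hk : 0 < k)
    (hp : 1 < p) (htop : Tendsto u (nhdsWithin T (Iio T)) atTop) {t : ℝ} (ht : t ∈ Ico 0 T) :
    1 ≤ u t ^ (p - 1) * (k * 2 ^ p / γ * (T - t) ^ γ) := by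
  have hut := h.pos t ht
  have hmono := h.monotoneOn hγ.1 hk (by linarith)
  obtain ⟨r₁, hr₁u, hr₁⟩ : ∃ r, 2 * u t ≤ u r ∧ r ∈ Ioo t T :=
    ((htop.eventually_ge_atTop (2 * u t)).and (Ioo_mem_nhdsLT ht.2)).exists
  obtain ⟨r, hr, hur⟩ : ∃ r ∈ Icc t r₁, u r = 2 * u t :=
    intermediate_value_Icc hr₁.1.le (h.cont.mono (Icc_subset_Ico ht.1 hr₁.2))
      ⟨by linarith, hr₁u⟩
  have hrT : r < T := hr.2.trans_lt hr₁.2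
  have e1 := h.eq_split hγ.1 ht.1 hr.1 hrT
  have e2 := h.eq t ht
  have h1 : ∫ s in (0:ℝ)..t, (r - s) ^ (γ - 1) * u s ^ p
      ≤ ∫ s in (0:ℝ)..t, (t - s) ^ (γ - 1) * u s ^ p := by
    refine intervalIntegral.integral_mono_on_of_le_Ioo ht.1
      (h.intervalIntegrable hγ.1 le_rfl ht.1 ht.2 r)
      (h.intervalIntegrable hγ.1 le_rfl ht.1 ht.2 t) fun s hs => ?_
    refine mul_le_mul_of_nonneg_right ?_
      (Real.rpow_nonneg (h.pos s ⟨hs.1.le, hs.2.trans ht.2⟩).le _)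
    exact Real.rpow_le_rpow_of_nonpos (by linarith [hs.2]) (by linarith [hr.1])
      (by linarith [hγ.2])
  have h2 : ∫ s in t..r, (r - s) ^ (γ - 1) * u s ^ p ≤ (2 * u t) ^ p * ((T - t) ^ γ / γ) := by
    calc ∫ s in t..r, (r - s) ^ (γ - 1) * u s ^ p
        ≤ ∫ s in t..r, (r - s) ^ (γ - 1) * (2 * u t) ^ p := by
          refine intervalIntegral.integral_mono_on hr.1
            (h.intervalIntegrable hγ.1 ht.1 hr.1 hrT r)
            ((intervalIntegrable_abelKernel hγ.1 t r r).mul_const _) fun s hs => ?_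
          have hs' : s ∈ Ico 0 T := ⟨ht.1.trans hs.1, hs.2.trans_lt hrT⟩
          refine mul_le_mul_of_nonneg_left ?_ (Real.rpow_nonneg (by linarith [hs.2]) _)
          refine Real.rpow_le_rpow (h.pos s hs').le ?_ (by linarith)
          rw [← hur]
          exact hmono hs' ⟨ht.1.trans hr.1, hrT⟩ hs.2
      _ = (2 * u t) ^ p * ((r - t) ^ γ / γ) := by
          rw [intervalIntegral.integral_mul_const, integral_abelKernel hγ.1, mul_comm]
      _ ≤ _ := by
          have := hγ.1
          have : (r - t) ^ γ ≤ (T - t) ^ γ :=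
            Real.rpow_le_rpow (by linarith [hr.1]) (by linarith) hγ.1.le
          gcongr
  have h3 : u t ≤ k * ((2 * u t) ^ p * ((T - t) ^ γ / γ)) := by
    have a1 := mul_le_mul_of_nonneg_left h1 hk.le
    have a2 := mul_le_mul_of_nonneg_left h2 hk.le
    linarith
  rw [Real.mul_rpow (by norm_num) hut.le] at h3
  have e : u t ^ p = u t ^ (p - 1) * u t := by
    conv_lhs => rw [show p = (p - 1) + 1 by ring, Real.rpow_add hut, Real.rpow_one]
  rw [e] at h3
  refine le_of_mul_le_mul_right ?_ hut
  calc 1 * u t = u t := one_mul _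
    _ ≤ _ := h3
    _ = _ := by ring

end IsVolterraSol

lemma abs_rpow_sub_rpow_le {p M x y : ℝ} (hp : 1 ≤ p) (hx : x ∈ Icc 0 M) (hy : y ∈ Icc 0 M) :
    |x ^ p - y ^ p| ≤ p * M ^ (p - 1) * |x - y| := by
  have := (convex_Icc (0:ℝ) M).norm_image_sub_le_of_norm_hasDerivWithin_le
    (f := fun z => z ^ p) (f' := fun z => p * z ^ (p - 1)) (C := p * M ^ (p - 1))
    (fun z _ => (Real.hasDerivAt_rpow_const (Or.inr hp)).hasDerivWithinAt) ?_ hy hx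
  · simpa [Real.norm_eq_abs] using this
  · intro z hz
    have h1 := Real.rpow_nonneg hz.1 (p - 1)
    rw [Real.norm_of_nonneg (by positivity)]
    have := Real.rpow_le_rpow hz.1 hz.2 (by linarith : 0 ≤ p - 1)
    gcongr

/-- A one-sided version of Barbalat's lemma. -/
lemma tendsto_zero_of_integral_sq_le {h : ℝ → ℝ} {x₁ K C : ℝ} (hcont : ContinuousOn h (Ici x₁))
    (hlip : ∀ x y, x₁ ≤ x → x ≤ y → h x - h y ≤ K * (y - x))
    (hInt : ∀ y, x₁ ≤ y → ∫ x in x₁..y, h x ^ 2 ≤ C) : Tendsto h atTop (nhds 0) := by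
  have hii : ∀ a b, x₁ ≤ a → a ≤ b → IntervalIntegrable (fun x => h x ^ 2) volume a b := by
    intro a b ha hab
    refine ContinuousOn.intervalIntegrable ?_
    rw [uIcc_of_le hab]
    exact (hcont.mono fun z hz => ha.trans hz.1).pow 2
  set I : ℝ → ℝ := fun y => ∫ x in x₁..(max x₁ y), h x ^ 2 with hI
  have hmono : Monotone I := by
    intro a b hab
    have hm : max x₁ a ≤ max x₁ b := max_le_max le_rfl hab
    simp only [hI]
    rw [← intervalIntegral.integral_add_adjacent_intervals
      (hii x₁ _ le_rfl (le_max_left x₁ a)) (hii _ _ (le_max_left x₁ a) hm)]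
    have := intervalIntegral.integral_nonneg (f := fun x => h x ^ 2) (μ := volume) hm
      fun x _ => sq_nonneg (h x)
    linarith
  have hbdd : BddAbove (range I) := ⟨C, by
    rintro _ ⟨y, rfl⟩
    exact hInt _ (le_max_left _ _)⟩
  have hlim := tendsto_atTop_ciSup hmono hbdd
  have hdiff : ∀ τ : ℝ, Tendsto (fun x => I (x + τ) - I x) atTop (nhds 0) := by
    intro τ
    simpa using (hlim.comp (tendsto_atTop_add_const_right atTop τ tendsto_id)).sub hlim
  have hkey : ∀ a b e : ℝ, x₁ ≤ a → a ≤ b → 0 ≤ e → (∀ x ∈ Icc a b, e ≤ |h x|) →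
      (b - a) * e ^ 2 ≤ I b - I a := by
    intro a b e ha hab he hx
    have e1 : I b - I a = ∫ x in a..b, h x ^ 2 := by
      simp only [hI]
      rw [max_eq_right ha, max_eq_right (ha.trans hab),
        ← intervalIntegral.integral_add_adjacent_intervals (hii x₁ a le_rfl ha) (hii a b ha hab)]
      ring
    rw [e1]
    have := intervalIntegral.integral_mono_on (μ := volume) hab
      (intervalIntegrable_const (c := e ^ 2)) (hii a b ha hab) fun x hx' => by
        rw [← sq_abs (h x)]; exact pow_le_pow_left₀ he (hx x hx') 2
    simpa using this
  rw [Metric.tendsto_nhds]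
  intro e he
  set K' := max K 1
  have hK' : 0 < K' := lt_of_lt_of_le one_pos (le_max_right _ _)
  have hlip' : ∀ x y, x₁ ≤ x → x ≤ y → h x - h y ≤ K' * (y - x) := fun x y hx hxy =>
    (hlip x y hx hxy).trans (mul_le_mul_of_nonneg_right (le_max_left _ _) (by linarith))
  set τ := e / (2 * K') with hτ
  have hτ0 : 0 < τ := by positivity
  have hKτ : K' * τ = e / 2 := by rw [hτ]; field_simp
  have hsmall : 0 < τ * (e / 2) ^ 2 := by positivity
  have ev1 := (hdiff τ).eventually (gt_mem_nhds hsmall)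
  have ev2 := (hdiff (-τ)).eventually (lt_mem_nhds (neg_lt_zero.2 hsmall))
  filter_upwards [ev1, ev2, eventually_ge_atTop (x₁ + τ)] with x h1 h2 hx
  rw [Real.dist_eq, sub_zero]
  by_contra hcon
  rcases le_abs.1 (not_lt.1 hcon) with hpos | hneg
  · have := hkey x (x + τ) (e / 2) (by linarith) (by linarith) (by linarith) fun y hy => by
      have h3 := hlip' x y (by linarith) hy.1
      have : K' * (y - x) ≤ K' * τ := by gcongr; linarith [hy.2]
      exact le_trans (by linarith) (le_abs_self _)
    rw [add_sub_cancel_left] at this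
    linarith
  · have := hkey (x - τ) x (e / 2) (by linarith) (by linarith) (by linarith) fun y hy => by
      have h3 := hlip' y x (by linarith [hy.1]) hy.2
      have : K' * (x - y) ≤ K' * τ := by gcongr; linarith [hy.1]
      exact le_trans (by linarith) (neg_le_abs _)
    rw [sub_sub_cancel] at this
    rw [← sub_eq_add_neg] at h2
    linarith

/-- A countable family of relaxation equations `X n' = φ ^ p - b n * X n` driven by the weighted
sum `φ = ε + ∑ a n * X n`, on the half-line `[x₁, ∞)`. It is a perturbed gradient flow. -/
structure IsRelaxationSystem (a b : ℕ → ℝ) (p β m M L D x₁ : ℝ) (ε φ : ℝ → ℝ)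
    (X : ℕ → ℝ → ℝ) : Prop where
  one_lt : 1 < p
  rate_nonneg : 0 ≤ β
  m_pos : 0 < m
  D_nonneg : 0 ≤ D
  a_pos : ∀ n, 0 < a n
  b_pos : ∀ n, 0 < b n
  summable : Summable fun n => a n / b n
  cont : ContinuousOn φ (Ici x₁)
  lower : ∀ x, x₁ ≤ x → m ≤ φ x
  upper : ∀ x, x₁ ≤ x → φ x ≤ M
  hasDerivAt : ∀ n x, x₁ ≤ x → HasDerivAt (X n) (φ x ^ p - b n * X n x) x
  nonneg : ∀ n x, x₁ ≤ x → 0 ≤ X n x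
  bound : ∀ n x, x₁ ≤ x → b n * X n x ≤ M ^ p
  slack : ∀ n x, x₁ ≤ x → b n * X n x ≤ φ x ^ p + D / b n
  lip : ∀ x y, x₁ ≤ x → x ≤ y → φ x ^ p - φ y ^ p ≤ L * (y - x)
  eps_nonneg : ∀ x, x₁ ≤ x → 0 ≤ ε x
  eps_deriv : ∀ x, x₁ ≤ x → HasDerivAt ε (-β * ε x) x
  eps_tendsto : Tendsto ε atTop (nhds 0)
  hasSum : ∀ x, x₁ ≤ x → HasSum (fun n => a n * X n x) (φ x - ε x)

namespace IsRelaxationSystem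

variable {a b : ℕ → ℝ} {p β m M L D x₁ : ℝ} {ε φ : ℝ → ℝ} {X : ℕ → ℝ → ℝ}

lemma M_pos (h : IsRelaxationSystem a b p β m M L D x₁ ε φ X) : 0 < M :=
  h.m_pos.trans_le ((h.lower x₁ le_rfl).trans (h.upper x₁ le_rfl))

lemma pos (h : IsRelaxationSystem a b p β m M L D x₁ ε φ X) {x : ℝ} (hx : x₁ ≤ x) : 0 < φ x :=
  h.m_pos.trans_le (h.lower x hx)

lemma rpow_le (h : IsRelaxationSystem a b p β m M L D x₁ ε φ X) {x : ℝ} (hx : x₁ ≤ x) :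
    φ x ^ p ≤ M ^ p :=
  Real.rpow_le_rpow (h.pos hx).le (h.upper x hx) (by linarith [h.one_lt])

lemma abs_deriv_le (h : IsRelaxationSystem a b p β m M L D x₁ ε φ X) (n : ℕ) {x : ℝ}
    (hx : x₁ ≤ x) : |φ x ^ p - b n * X n x| ≤ M ^ p := by
  have h1 := h.rpow_le hx
  have h2 := h.bound n x hx
  have h3 := mul_nonneg (h.b_pos n).le (h.nonneg n x hx)
  have h4 := Real.rpow_nonneg (h.pos hx).le p
  rw [abs_le]
  constructor <;> linarith

lemma continuousOn_deriv (h : IsRelaxationSystem a b p β m M L D x₁ ε φ X) (n : ℕ) :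
    ContinuousOn (fun x => φ x ^ p - b n * X n x) (Ici x₁) :=
  (h.cont.rpow_const fun _ hx => Or.inl (h.pos hx).ne').sub
    (continuousOn_const.mul fun x hx => (h.hasDerivAt n x hx).continuousAt.continuousWithinAt)

lemma sum_le (h : IsRelaxationSystem a b p β m M L D x₁ ε φ X) (N : ℕ) {x : ℝ} (hx : x₁ ≤ x) :
    ∑ i ∈ Finset.range N, a i * X i x ≤ φ x - ε x :=
  sum_le_hasSum _ (fun i _ => mul_nonneg (h.a_pos i).le (h.nonneg i x hx)) (h.hasSum x hx)

lemma sum_nonneg (h : IsRelaxationSystem a b p β m M L D x₁ ε φ X) (N : ℕ) {x : ℝ}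
    (hx : x₁ ≤ x) : 0 ≤ ∑ i ∈ Finset.range N, a i * X i x :=
  Finset.sum_nonneg fun i _ => mul_nonneg (h.a_pos i).le (h.nonneg i x hx)

lemma sub_sum_le (h : IsRelaxationSystem a b p β m M L D x₁ ε φ X) (N : ℕ) {x : ℝ}
    (hx : x₁ ≤ x) : φ x - (ε x + ∑ i ∈ Finset.range N, a i * X i x)
      ≤ M ^ p * ∑' i, a (i + N) / b (i + N) := by
  have h1 := (hasSum_nat_add_iff' N).2 (h.hasSum x hx)
  have h2 := ((summable_nat_add_iff N).2 h.summable).hasSum.mul_left (M ^ p)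
  have := hasSum_le (fun i => ?_) h1 h2
  · linarith
  · rw [mul_div_assoc', le_div_iff₀ (h.b_pos _)]
    have := mul_le_mul_of_nonneg_left (h.bound (i + N) x hx) (h.a_pos (i + N)).le
    linarith

/-- The energy estimate. -/
lemma exists_integral_sq_le (h : IsRelaxationSystem a b p β m M L D x₁ ε φ X) (n : ℕ) :
    ∃ C, ∀ y, x₁ ≤ y → ∫ x in x₁..y, (φ x ^ p - b n * X n x) ^ 2 ≤ C := by
  have hp := h.one_lt
  have hM := h.M_pos
  set B := ∑' i, a i / b i with hB
  have hB0 : 0 ≤ B := tsum_nonneg fun i => (div_pos (h.a_pos i) (h.b_pos i)).le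
  have hBN : ∀ N, ∑ i ∈ Finset.range N, a i / b i ≤ B := fun N =>
    h.summable.sum_le_tsum _ fun i _ => (div_pos (h.a_pos i) (h.b_pos i)).le
  set η : ℕ → ℝ := fun N => p * M ^ (p - 1) * (M ^ p * ∑' i, a (i + N) / b (i + N)) with hη
  have hη0 : ∀ N, 0 ≤ η N := fun N => by
    have : 0 ≤ ∑' i, a (i + N) / b (i + N) :=
      tsum_nonneg fun i => (div_pos (h.a_pos _) (h.b_pos _)).le
    simp only [hη]
    positivity
  have hηlim : Tendsto η atTop (nhds 0) := by
    have := tendsto_sum_nat_add fun i => a i / b i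
    simpa [hη] using (this.const_mul (M ^ p)).const_mul (p * M ^ (p - 1))
  set R : ℕ → ℝ → ℝ := fun N x => ∑ i ∈ Finset.range N, a i * X i x with hR
  set h' : ℕ → ℝ → ℝ := fun i x => φ x ^ p - b i * X i x with hh'
  set C₀ := (M ^ p) ^ 2 * B / 2 + M ^ (p + 1) / (p + 1) + M ^ p * ε x₁ with hC₀
  refine ⟨C₀ / a n, fun y hy => ?_⟩
  have hfin : ∀ N, n < N →
      ∫ x in x₁..y, a n * h' n x ^ 2 ≤ C₀ + η N * (M + D * B * (y - x₁)) := by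
    intro N hnN
    set F : ℝ → ℝ := fun x =>
      -((∑ i ∈ Finset.range N, a i * b i * X i x ^ 2 / 2)
        - (ε x + R N x) ^ (p + 1) / (p + 1) - η N * (R N x + D * B * x) + M ^ p * ε x) with hF
    have hSnn : ∀ x, x₁ ≤ x → 0 ≤ ε x + R N x := fun x hx =>
      add_nonneg (h.eps_nonneg x hx) (h.sum_nonneg N hx)
    have hSle : ∀ x, x₁ ≤ x → ε x + R N x ≤ φ x := fun x hx => by
      have := h.sum_le N hx
      simp only [hR]; linarith
    have hSM : ∀ x, x₁ ≤ x → (ε x + R N x) ^ p ≤ M ^ p := fun x hx =>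
      Real.rpow_le_rpow (hSnn x hx) ((hSle x hx).trans (h.upper x hx)) (by linarith)
    have hRd : ∀ x, x₁ ≤ x →
        HasDerivAt (R N) (∑ i ∈ Finset.range N, a i * h' i x) x := fun x hx => by
      have := HasDerivAt.fun_sum (u := Finset.range N) (A := fun i x => a i * X i x)
        fun i _ => (h.hasDerivAt i x hx).const_mul (a i)
      simpa only [hR] using this
    have hQd : ∀ x, x₁ ≤ x → HasDerivAt
        (fun x => ∑ i ∈ Finset.range N, a i * b i * X i x ^ 2 / 2)
        (∑ i ∈ Finset.range N, (φ x ^ p * (a i * h' i x) - a i * h' i x ^ 2)) x := fun x hx => by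
      refine HasDerivAt.fun_sum fun i _ => ?_
      refine ((((h.hasDerivAt i x hx).pow 2).const_mul (a i * b i)).div_const 2).congr_deriv ?_
      simp only [hh']
      push_cast
      ring
    have hFd : ∀ x, x₁ ≤ x → HasDerivAt F
        (∑ i ∈ Finset.range N, a i * h' i x ^ 2
          + ((η N - (φ x ^ p - (ε x + R N x) ^ p)) * (∑ i ∈ Finset.range N, a i * h' i x + D * B)
            + (φ x ^ p - (ε x + R N x) ^ p) * (D * B)
            + β * ε x * (M ^ p - (ε x + R N x) ^ p))) x := fun x hx => by
      have d1 := (((h.eps_deriv x hx).add (hRd x hx)).rpow_const (p := p + 1)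
        (Or.inr (by linarith))).div_const (p + 1)
      have d2 := ((hRd x hx).add ((hasDerivAt_id x).const_mul (D * B))).const_mul (η N)
      have d3 := (h.eps_deriv x hx).const_mul (M ^ p)
      refine ((((hQd x hx).sub d1).sub d2).add d3).neg.congr_deriv ?_
      rw [Finset.sum_sub_distrib, ← Finset.mul_sum, add_sub_cancel_right]
      have : p + 1 ≠ 0 := by linarith
      simp only [Pi.add_apply]
      field_simp
      ring
    have hle := intervalIntegral.integral_le_sub_of_hasDeriv_right_of_le hy (g := F)
      (φ := fun x => a n * h' n x ^ 2)
      (fun x hx => (hFd x hx.1).continuousAt.continuousWithinAt)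
      (fun x hx => (hFd x hx.1.le).hasDerivWithinAt) ?_ ?_
    · refine hle.trans ?_
      have hQ0 : 0 ≤ ∑ i ∈ Finset.range N, a i * b i * X i y ^ 2 / 2 :=
        Finset.sum_nonneg fun i _ => by
          have := h.a_pos i
          have := h.b_pos i
          positivity
      have hQ1 : ∑ i ∈ Finset.range N, a i * b i * X i x₁ ^ 2 / 2 ≤ (M ^ p) ^ 2 * B / 2 := by
        calc ∑ i ∈ Finset.range N, a i * b i * X i x₁ ^ 2 / 2
            ≤ ∑ i ∈ Finset.range N, (M ^ p) ^ 2 / 2 * (a i / b i) := by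
              refine Finset.sum_le_sum fun i _ => ?_
              have hb := h.b_pos i
              have ha := h.a_pos i
              have : (b i * X i x₁) ^ 2 ≤ (M ^ p) ^ 2 := pow_le_pow_left₀
                (mul_nonneg hb.le (h.nonneg i x₁ le_rfl)) (h.bound i x₁ le_rfl) 2
              calc a i * b i * X i x₁ ^ 2 / 2 = (b i * X i x₁) ^ 2 / 2 * (a i / b i) := by
                    field_simp
                _ ≤ _ := by gcongr
          _ ≤ (M ^ p) ^ 2 / 2 * B := by
              rw [← Finset.mul_sum]
              exact mul_le_mul_of_nonneg_left (hBN N) (by positivity)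
          _ = _ := by ring
      have hG0 : 0 ≤ (ε x₁ + R N x₁) ^ (p + 1) / (p + 1) :=
        div_nonneg (Real.rpow_nonneg (hSnn x₁ le_rfl) _) (by linarith)
      have hG1 : (ε y + R N y) ^ (p + 1) / (p + 1) ≤ M ^ (p + 1) / (p + 1) :=
        div_le_div_of_nonneg_right (Real.rpow_le_rpow (hSnn y hy)
          ((hSle y hy).trans (h.upper y hy)) (by linarith)) (by linarith)
      have hRy : η N * R N y ≤ η N * M := by
        have h1 := hSle y hy
        have h2 := h.upper y hy
        have h3 := h.eps_nonneg y hy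
        exact mul_le_mul_of_nonneg_left (by linarith) (hη0 N)
      have hRx : 0 ≤ η N * R N x₁ := mul_nonneg (hη0 N) (h.sum_nonneg N le_rfl)
      have hεy : 0 ≤ M ^ p * ε y := mul_nonneg (by positivity) (h.eps_nonneg y hy)
      simp only [hF, hC₀]
      nlinarith
    · refine ContinuousOn.integrableOn_Icc ?_
      exact continuousOn_const.mul
        (((h.continuousOn_deriv n).mono fun x hx => hx.1).pow 2)
    · intro x hx
      have hx' := hx.1.le
      have t1 : a n * h' n x ^ 2 ≤ ∑ i ∈ Finset.range N, a i * h' i x ^ 2 :=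
        Finset.single_le_sum (f := fun i => a i * h' i x ^ 2)
          (fun i _ => mul_nonneg (h.a_pos i).le (sq_nonneg _)) (Finset.mem_range.2 hnN)
      have t2 : 0 ≤ φ x ^ p - (ε x + R N x) ^ p :=
        sub_nonneg.2 (Real.rpow_le_rpow (hSnn x hx') (hSle x hx') (by linarith))
      have t3 : φ x ^ p - (ε x + R N x) ^ p ≤ η N := by
        have s1 := abs_rpow_sub_rpow_le hp.le (M := M) ⟨(h.pos hx').le, h.upper x hx'⟩
          ⟨hSnn x hx', (hSle x hx').trans (h.upper x hx')⟩
        have s2 := h.sub_sum_le N hx'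
        rw [abs_of_nonneg (sub_nonneg.2 (hSle x hx'))] at s1
        refine (le_abs_self _).trans (s1.trans ?_)
        exact mul_le_mul_of_nonneg_left s2 (by positivity)
      have t4 : 0 ≤ ∑ i ∈ Finset.range N, a i * h' i x + D * B := by
        have s1 : -(D * ∑ i ∈ Finset.range N, a i / b i) ≤ ∑ i ∈ Finset.range N, a i * h' i x := by
          rw [Finset.mul_sum, ← Finset.sum_neg_distrib]
          refine Finset.sum_le_sum fun i _ => ?_
          have s2 := h.slack i x hx'
          have s3 := mul_le_mul_of_nonneg_left
            (show -(D / b i) ≤ h' i x by simp only [hh']; linarith) (h.a_pos i).le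
          calc -(D * (a i / b i)) = a i * -(D / b i) := by ring
            _ ≤ _ := s3
        have := mul_le_mul_of_nonneg_left (hBN N) h.D_nonneg
        linarith
      have t5 : 0 ≤ (η N - (φ x ^ p - (ε x + R N x) ^ p))
          * (∑ i ∈ Finset.range N, a i * h' i x + D * B) := mul_nonneg (by linarith) t4
      have t6 : 0 ≤ (φ x ^ p - (ε x + R N x) ^ p) * (D * B) :=
        mul_nonneg t2 (mul_nonneg h.D_nonneg hB0)
      have t7 : 0 ≤ β * ε x * (M ^ p - (ε x + R N x) ^ p) :=
        mul_nonneg (mul_nonneg h.rate_nonneg (h.eps_nonneg x hx')) (by linarith [hSM x hx'])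
      linarith
  have hlim : Tendsto (fun N => C₀ + η N * (M + D * B * (y - x₁))) atTop (nhds C₀) := by
    simpa using (hηlim.mul_const (M + D * B * (y - x₁))).const_add C₀
  have := ge_of_tendsto hlim ((eventually_gt_atTop n).mono hfin)
  rw [intervalIntegral.integral_const_mul] at this
  rw [le_div_iff₀ (h.a_pos n)]
  linarith

lemma tendsto_deriv (h : IsRelaxationSystem a b p β m M L D x₁ ε φ X) (n : ℕ) :
    Tendsto (fun x => φ x ^ p - b n * X n x) atTop (nhds 0) := by
  obtain ⟨C, hC⟩ := h.exists_integral_sq_le n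
  refine tendsto_zero_of_integral_sq_le (K := L + b n * M ^ p) (h.continuousOn_deriv n) ?_ hC
  intro x y hx hxy
  have h1 := h.lip x y hx hxy
  have h2 := (convex_Icc x y).norm_image_sub_le_of_norm_hasDerivWithin_le
    (f := X n) (C := M ^ p)
    (fun z hz => (h.hasDerivAt n z (hx.trans hz.1)).hasDerivWithinAt)
    (fun z hz => h.abs_deriv_le n (hx.trans hz.1)) (left_mem_Icc.2 hxy) (right_mem_Icc.2 hxy)
  rw [Real.norm_eq_abs, Real.norm_eq_abs, abs_of_nonneg (sub_nonneg.2 hxy)] at h2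
  have h3 := mul_le_mul_of_nonneg_left ((le_abs_self _).trans h2) (h.b_pos n).le
  linarith

/-- Convergence to the unique positive equilibrium. -/
theorem tendsto (h : IsRelaxationSystem a b p β m M L D x₁ ε φ X) {B : ℝ} (hB : 0 < B)
    (hBsum : HasSum (fun n => a n / b n) B) :
    Tendsto φ atTop (nhds ((1 / B) ^ (1 / (p - 1)))) := by
  have hp : 0 < p - 1 := by linarith [h.one_lt]
  have h1 : Tendsto (fun x => ∑' n, a n / b n * (φ x ^ p - b n * X n x)) atTop
      (nhds (∑' _ : ℕ, (0:ℝ))) := by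
    refine tendsto_tsum_of_dominated_convergence (h.summable.mul_right (M ^ p)) ?_ ?_
    · intro n
      simpa using (h.tendsto_deriv n).const_mul (a n / b n)
    · filter_upwards [eventually_ge_atTop x₁] with x hx n
      have hab := div_pos (h.a_pos n) (h.b_pos n)
      rw [norm_mul, Real.norm_of_nonneg hab.le, Real.norm_eq_abs]
      exact mul_le_mul_of_nonneg_left (h.abs_deriv_le n hx) hab.le
  rw [tsum_zero] at h1
  have h2 : Tendsto (fun x => B * φ x ^ p - φ x) atTop (nhds 0) := by
    have := h1.sub h.eps_tendsto
    rw [sub_zero] at this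
    refine this.congr' ?_
    filter_upwards [eventually_ge_atTop x₁] with x hx
    have hs := (hBsum.mul_right (φ x ^ p)).sub (h.hasSum x hx)
    have : ∀ n, a n / b n * (φ x ^ p - b n * X n x) = a n / b n * φ x ^ p - a n * X n x := by
      intro n
      have := (h.b_pos n).ne'
      field_simp
    rw [tsum_congr this, hs.tsum_eq]
    ring
  have h3 : Tendsto (fun x => B * φ x ^ (p - 1) - 1) atTop (nhds 0) := by
    refine squeeze_zero_norm' ?_ (by simpa using (h2.abs.div_const m))
    filter_upwards [eventually_ge_atTop x₁] with x hx
    have hφ := h.pos hx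
    have e : B * φ x ^ p - φ x = (B * φ x ^ (p - 1) - 1) * φ x := by
      have : φ x ^ p = φ x ^ (p - 1) * φ x := by
        conv_lhs => rw [show p = (p - 1) + 1 by ring, Real.rpow_add hφ, Real.rpow_one]
      rw [this]
      ring
    rw [e, abs_mul, abs_of_pos hφ, Real.norm_eq_abs, le_div_iff₀ h.m_pos]
    exact mul_le_mul_of_nonneg_left (h.lower x hx) (abs_nonneg _)
  have h4 : Tendsto (fun x => φ x ^ (p - 1)) atTop (nhds (1 / B)) := by
    have := (h3.add_const 1).div_const B
    simp only [sub_add_cancel, zero_add] at this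
    refine this.congr fun x => ?_
    field_simp
  have h5 := h4.rpow_const (p := 1 / (p - 1)) (Or.inl (by positivity))
  refine h5.congr' ?_
  filter_upwards [eventually_ge_atTop x₁] with x hx
  rw [← Real.rpow_mul (h.pos hx).le, mul_one_div_cancel hp.ne', Real.rpow_one]

end IsRelaxationSystem

lemma integral_abel_eq_rpow_mul {γ : ℝ} (hγ : 0 < γ) (w : ℝ → ℝ) {t : ℝ} (ht : 0 ≤ t) :
    ∫ s in (0:ℝ)..t, (t - s) ^ (γ - 1) * w s
      = t ^ γ * ∫ x in (0:ℝ)..1, (1 - x) ^ (γ - 1) * w (t * x) := by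
  rcases ht.eq_or_lt with rfl | ht
  · simp [Real.zero_rpow hγ.ne']
  have h1 := intervalIntegral.integral_comp_mul_left (a := 0) (b := 1)
    (fun s => (t - s) ^ (γ - 1) * w s) ht.ne'
  rw [mul_zero, mul_one, smul_eq_mul] at h1
  have h2 : ∫ x in (0:ℝ)..1, (t - t * x) ^ (γ - 1) * w (t * x)
      = t ^ (γ - 1) * ∫ x in (0:ℝ)..1, (1 - x) ^ (γ - 1) * w (t * x) := by
    rw [← intervalIntegral.integral_const_mul]
    refine intervalIntegral.integral_congr fun x hx => ?_
    rw [uIcc_of_le zero_le_one] at hx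
    rw [show t - t * x = t * (1 - x) by ring, Real.mul_rpow ht.le (by linarith [hx.2])]
    ring
  have h3 : t ^ γ = t * t ^ (γ - 1) := by
    conv_lhs => rw [show γ = 1 + (γ - 1) by ring, Real.rpow_add ht, Real.rpow_one]
  rw [h3, mul_assoc, ← h2, h1, mul_inv_cancel_left₀ ht.ne']

lemma continuous_rpow_mul_integral_abel {γ : ℝ} (hγ : 0 < γ) {w : ℝ → ℝ} (hw : Continuous w)
    {Q : ℝ} (hQ : ∀ s, |w s| ≤ Q) :
    Continuous fun t : ℝ => t ^ γ * ∫ x in (0:ℝ)..1, (1 - x) ^ (γ - 1) * w (t * x) := by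
  refine (Real.continuous_rpow_const hγ.le).mul ?_
  have hi := intervalIntegrable_abelKernel hγ 0 1 1
  refine intervalIntegral.continuous_of_dominated_interval
    (bound := fun x => (1 - x) ^ (γ - 1) * Q) ?_ ?_ (hi.mul_const Q) ?_
  · intro t
    refine AEStronglyMeasurable.mul ?_ (hw.comp (by fun_prop)).aestronglyMeasurable
    exact ((measurable_const.sub measurable_id).pow_const _).aestronglyMeasurable
  · intro t
    filter_upwards with x hx
    rw [uIoc_of_le zero_le_one] at hx
    have := Real.rpow_nonneg (show (0:ℝ) ≤ 1 - x by linarith [hx.2]) (γ - 1)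
    rw [norm_mul, Real.norm_of_nonneg this]
    exact mul_le_mul_of_nonneg_left (hQ _) this
  · filter_upwards with x _
    fun_prop

namespace IsVolterraSol

variable {γ k p u₀ T : ℝ} {u : ℝ → ℝ}

/-- The increasing, bounded solution extends continuously to the closed interval. -/
lemma exists_continuous_extension (h : IsVolterraSol γ k p u₀ T u) (hT : 0 < T) (hγ : 0 < γ)
    (hk : 0 < k) (hp : 0 ≤ p) {M : ℝ} (hM : ∀ t ∈ Ico 0 T, u t ≤ M) :
    ∃ U : ℝ → ℝ, Continuous U ∧ (∀ t ∈ Ico 0 T, U t = u t) ∧ (∀ t, T ≤ t → U t = U T) ∧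
      ∀ t, U t ∈ Icc u₀ M := by
  have hmono := h.monotoneOn hγ hk hp
  have hlim := (hmono.mono Ioo_subset_Ico_self).tendsto_nhdsWithin_Ioo_left
    (nonempty_Ioo.2 hT) ⟨M, by rintro _ ⟨t, ht, rfl⟩; exact hM t (Ioo_subset_Ico_self ht)⟩
  set l := sSup (u '' Ioo 0 T)
  have hcont : ContinuousOn (Function.update u T l) (Icc 0 T) := by
    have hdiff : Icc 0 T \ {T} = Ico 0 T := by
      ext x
      simp only [Set.mem_sdiff, mem_Icc, mem_Ico, mem_singleton_iff]
      grind
    rw [continuousOn_update_iff, hdiff]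
    exact ⟨h.cont, fun _ => hlim.mono_left (nhdsWithin_mono _ fun t ht => ht.2)⟩
  have hmem : ∀ s : ℝ, max 0 (min s T) ∈ Icc 0 T := fun s =>
    ⟨le_max_left _ _, max_le hT.le (min_le_right _ _)⟩
  have hU : Continuous fun s => Function.update u T l (max 0 (min s T)) :=
    hcont.comp_continuous (by fun_prop) hmem
  have hUu : ∀ t ∈ Ico 0 T, Function.update u T l (max 0 (min t T)) = u t := fun t ht => by
    rw [min_eq_left ht.2.le, max_eq_right ht.1, Function.update_of_ne ht.2.ne]
  have hl : l ∈ Icc u₀ M := by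
    have hev : ∀ᶠ t in nhdsWithin T (Iio T), t ∈ Ioo 0 T := Ioo_mem_nhdsLT hT
    exact ⟨ge_of_tendsto hlim (hev.mono fun t ht => h.initial_le hk.le (Ioo_subset_Ico_self ht)),
      le_of_tendsto hlim (hev.mono fun t ht => hM t (Ioo_subset_Ico_self ht))⟩
  refine ⟨_, hU, hUu, fun t ht => ?_, fun t => ?_⟩
  · simp only [min_eq_right ht, min_self]
  · by_cases ht : max 0 (min t T) = T
    · simp only [ht, Function.update_self]
      exact hl
    · simp only [Function.update_of_ne ht]
      have : max 0 (min t T) ∈ Ico 0 T := ⟨(hmem t).1, lt_of_le_of_ne (hmem t).2 ht⟩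
      exact ⟨h.initial_le hk.le this, hM _ this⟩

/-- A bounded solution can be continued. -/
theorem exists_extension (h : IsVolterraSol γ k p u₀ T u) (hT : 0 < T) (hγ : 0 < γ)
    (hk : 0 < k) (hp : 1 < p) (hu₀ : 0 < u₀) {M : ℝ} (hM : ∀ t ∈ Ico 0 T, u t ≤ M) :
    ∃ T', T < T' ∧ ∃ v, IsVolterraSol γ k p u₀ T' v ∧ ∀ t ∈ Ico 0 T, v t = u t := by
  obtain ⟨U, hUc, hUu, hUT, hUmem⟩ := h.exists_continuous_extension hT hγ hk (by linarith) hM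
  have hM0 : 0 < M := hu₀.trans_le ((hUmem 0).1.trans (hUmem 0).2)
  set M' := M + 1 with hM'
  have hM'0 : 0 < M' := by linarith
  set F : ℝ → ℝ := fun z => max 0 (min z M') ^ p with hF
  have hclamp : ∀ z, max 0 (min z M') ∈ Icc 0 M' := fun z =>
    ⟨le_max_left _ _, max_le hM'0.le (min_le_right _ _)⟩
  have hFc : Continuous F :=
    (by fun_prop : Continuous fun z : ℝ => max 0 (min z M')).rpow_const
      fun _ => Or.inr (by linarith)
  have hF0 : ∀ z, 0 ≤ F z := fun z => Real.rpow_nonneg (hclamp z).1 _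
  have hFb : ∀ z, |F z| ≤ M' ^ p := fun z => by
    rw [abs_of_nonneg (hF0 z)]
    exact Real.rpow_le_rpow (hclamp z).1 (hclamp z).2 (by linarith)
  have hFeq : ∀ z ∈ Icc 0 M', F z = z ^ p := fun z hz => by
    simp only [hF, min_eq_left hz.2, max_eq_right hz.1]
  set K := p * M' ^ (p - 1) with hK
  have hK0 : 0 < K := by positivity
  have hFlip : ∀ x y, |F x - F y| ≤ K * |x - y| := fun x y => by
    refine (abs_rpow_sub_rpow_le hp.le (hclamp x) (hclamp y)).trans ?_
    refine mul_le_mul_of_nonneg_left ?_ hK0.le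
    have h1 := abs_max_sub_max_le_max 0 (min x M') 0 (min y M')
    have h2 := abs_min_sub_min_le_max x M' y M'
    rw [sub_self, abs_zero, max_eq_right (abs_nonneg (min x M' - min y M'))] at h1
    rw [sub_self, abs_zero, max_eq_left (abs_nonneg (x - y))] at h2
    exact h1.trans h2
  -- the Volterra operator applied to the extended solution
  have hUeq : ∀ t ∈ Icc 0 T,
      u₀ + k * ∫ s in (0:ℝ)..t, (t - s) ^ (γ - 1) * F (U s) = U t := by
    have hJc : Continuous fun t : ℝ => u₀ + k * (t ^ γ *
        ∫ x in (0:ℝ)..1, (1 - x) ^ (γ - 1) * F (U (t * x))) :=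
      continuous_const.add (continuous_const.mul
        (continuous_rpow_mul_integral_abel hγ (hFc.comp hUc) fun s => hFb _))
    have hclosed := isClosed_eq hJc hUc
    have hsub : Ico 0 T ⊆ {t : ℝ | u₀ + k * (t ^ γ *
        ∫ x in (0:ℝ)..1, (1 - x) ^ (γ - 1) * F (U (t * x))) = U t} := by
      intro t ht
      rw [mem_ofPred_eq, ← integral_abel_eq_rpow_mul hγ (fun s => F (U s)) ht.1, hUu t ht,
        h.eq t ht]
      congr 2
      refine intervalIntegral.integral_congr fun s hs => ?_
      rw [uIcc_of_le ht.1] at hs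
      have hs' : s ∈ Ico 0 T := ⟨hs.1, hs.2.trans_lt ht.2⟩
      rw [hFeq _ ⟨hu₀.le.trans (hUmem s).1, by linarith [(hUmem s).2]⟩, hUu s hs']
    have := closure_minimal hsub hclosed
    rw [closure_Ico hT.ne] at this
    intro t ht
    rw [integral_abel_eq_rpow_mul hγ (fun s => F (U s)) ht.1]
    exact this ht
  obtain ⟨δ, hδ, hδK⟩ : ∃ δ : ℝ, 0 < δ ∧ k * (K * 2 * (δ ^ γ / γ)) = 1 / 2 := by
    refine ⟨(γ / (4 * k * K)) ^ (1 / γ), by positivity, ?_⟩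
    rw [← Real.rpow_mul (by positivity), one_div_mul_cancel hγ.ne', Real.rpow_one]
    field_simp
    norm_num
  set c : ℝ → ℝ := fun t => max 0 (min t (T + δ)) with hc
  have hcmem : ∀ t, c t ∈ Icc 0 (T + δ) := fun t =>
    ⟨le_max_left _ _, max_le (by linarith) (min_le_right _ _)⟩
  have hcc : Continuous c := by fun_prop
  set W : BoundedContinuousFunction ℝ ℝ → ℝ → ℝ := fun v s => U s + v s - v (min s T) with hW
  have hWc : ∀ v, Continuous (W v) := fun v => by
    have := v.continuous
    simp only [hW]
    fun_prop
  have hWle : ∀ v s, s ≤ T → W v s = U s := fun v s hs => by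
    simp only [hW, min_eq_left hs]
    ring
  have hex : ∀ v : BoundedContinuousFunction ℝ ℝ, ∃ g : BoundedContinuousFunction ℝ ℝ,
      ∀ t, g t = u₀ + k * ∫ s in (0:ℝ)..(c t), (c t - s) ^ (γ - 1) * F (W v s) := by
    intro v
    have hJc : Continuous fun t : ℝ => u₀ + k * (t ^ γ *
        ∫ x in (0:ℝ)..1, (1 - x) ^ (γ - 1) * F (W v (t * x))) :=
      continuous_const.add (continuous_const.mul
        (continuous_rpow_mul_integral_abel hγ (hFc.comp (hWc v)) fun s => hFb _))
    obtain ⟨C, hC⟩ := (isCompact_Icc (a := 0) (b := T + δ)).exists_bound_of_continuousOn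
      hJc.continuousOn
    refine ⟨BoundedContinuousFunction.ofNormedAddCommGroup _ (hJc.comp hcc) C
      fun t => hC _ (hcmem t), fun t => ?_⟩
    rw [integral_abel_eq_rpow_mul hγ (fun s => F (W v s)) (hcmem t).1]
    rfl
  choose Φ hΦ using hex
  have hInt : ∀ v a b t, a ≤ b →
      IntervalIntegrable (fun s => (t - s) ^ (γ - 1) * F (W v s)) volume a b :=
    fun v a b t hab => intervalIntegrable_abelKernel_mul hγ hab t
      (hFc.comp (hWc v)).continuousOn
  have hcontr : ContractingWith (1 / 2) Φ := by
    refine ⟨by norm_num, LipschitzWith.of_dist_le_mul fun v w => ?_⟩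
    rw [BoundedContinuousFunction.dist_le (by positivity)]
    intro t
    rw [hΦ, hΦ, Real.dist_eq, add_sub_add_left_eq_sub, ← mul_sub, abs_mul, abs_of_pos hk]
    have hsame : ∀ r b, 0 ≤ b → b ≤ T → ∫ s in (0:ℝ)..b, (r - s) ^ (γ - 1) * F (W v s)
        = ∫ s in (0:ℝ)..b, (r - s) ^ (γ - 1) * F (W w s) := by
      intro r b hb hbT
      refine intervalIntegral.integral_congr fun s hs => ?_
      rw [uIcc_of_le hb] at hs
      rw [hWle v s (hs.2.trans hbT), hWle w s (hs.2.trans hbT)]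
    rcases le_total (c t) T with hcT | hcT
    · rw [hsame _ _ (hcmem t).1 hcT, sub_self, abs_zero, mul_zero]
      positivity
    · rw [← intervalIntegral.integral_add_adjacent_intervals (hInt v 0 T (c t) hT.le)
          (hInt v T (c t) (c t) hcT),
        ← intervalIntegral.integral_add_adjacent_intervals (hInt w 0 T (c t) hT.le)
          (hInt w T (c t) (c t) hcT), hsame _ _ hT.le le_rfl, add_sub_add_left_eq_sub,
        ← intervalIntegral.integral_sub (hInt v T (c t) (c t) hcT) (hInt w T (c t) (c t) hcT)]
      have hbd := intervalIntegral.norm_integral_le_of_norm_le (μ := volume) hcT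
        (f := fun s => (c t - s) ^ (γ - 1) * F (W v s) - (c t - s) ^ (γ - 1) * F (W w s))
        (g := fun s => (c t - s) ^ (γ - 1) * (K * (2 * dist v w))) ?_
        ((intervalIntegrable_abelKernel hγ T (c t) (c t)).mul_const _)
      · rw [intervalIntegral.integral_mul_const, integral_abelKernel hγ, Real.norm_eq_abs] at hbd
        have hle : (c t - T) ^ γ ≤ δ ^ γ :=
          Real.rpow_le_rpow (by linarith) (by linarith [(hcmem t).2]) hγ.le
        calc k * _ ≤ k * ((c t - T) ^ γ / γ * (K * (2 * dist v w))) :=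
              mul_le_mul_of_nonneg_left hbd hk.le
          _ ≤ k * (δ ^ γ / γ * (K * (2 * dist v w))) := by gcongr
          _ = k * (K * 2 * (δ ^ γ / γ)) * dist v w := by ring
          _ = _ := by rw [hδK]; norm_num
      · filter_upwards with s hs
        have hnn := Real.rpow_nonneg (show 0 ≤ c t - s by linarith [hs.2]) (γ - 1)
        rw [← mul_sub, norm_mul, Real.norm_of_nonneg hnn]
        refine mul_le_mul_of_nonneg_left ((hFlip _ _).trans ?_) hnn
        refine mul_le_mul_of_nonneg_left ?_ hK0.le
        have h1 := v.dist_coe_le_dist (g := w) s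
        have h2 := v.dist_coe_le_dist (g := w) (min s T)
        rw [Real.dist_eq] at h1 h2
        calc |W v s - W w s| = |(v s - w s) - (v (min s T) - w (min s T))| := by
              simp only [hW]; congr 1; ring
          _ ≤ |v s - w s| + |v (min s T) - w (min s T)| := abs_sub _ _
          _ ≤ _ := by linarith
  set v := ContractingWith.fixedPoint Φ hcontr
  have hfix : Φ v = v := ContractingWith.fixedPoint_isFixedPt hcontr
  have hveq : ∀ t ∈ Icc 0 (T + δ),
      v t = u₀ + k * ∫ s in (0:ℝ)..t, (t - s) ^ (γ - 1) * F (W v s) := by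
    intro t ht
    have e := hΦ v t
    have hct : c t = t := by simp only [hc, min_eq_left ht.2, max_eq_right ht.1]
    rwa [hfix, hct] at e
  have hvU : ∀ t ∈ Icc 0 T, v t = U t := by
    intro t ht
    rw [hveq t ⟨ht.1, by linarith [ht.2]⟩, ← hUeq t ht]
    congr 2
    refine intervalIntegral.integral_congr fun s hs => ?_
    rw [uIcc_of_le ht.1] at hs
    rw [hWle v s (hs.2.trans ht.2)]
  have hWv : ∀ s, 0 ≤ s → W v s = v s := by
    intro s hs
    rcases le_total s T with hsT | hsT
    · rw [hWle v s hsT, hvU s ⟨hs, hsT⟩]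
    · simp only [hW, min_eq_right hsT]
      rw [hUT s hsT, hvU T ⟨hT.le, le_rfl⟩]
      ring
  have hvge : ∀ t ∈ Icc 0 (T + δ), u₀ ≤ v t := by
    intro t ht
    rw [hveq t ht]
    have := intervalIntegral.integral_nonneg (μ := volume) ht.1 fun s hs =>
      mul_nonneg (Real.rpow_nonneg (show 0 ≤ t - s by linarith [hs.2]) (γ - 1)) (hF0 (W v s))
    nlinarith
  obtain ⟨δ', hδ', hδ'v⟩ : ∃ δ' > 0, ∀ t, |t - T| < δ' → v t < M' := by
    have hvT : v T < M' := by
      rw [hvU T ⟨hT.le, le_rfl⟩]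
      linarith [(hUmem T).2]
    have := v.continuous.continuousAt.eventually (gt_mem_nhds hvT)
    obtain ⟨δ', hδ', hball⟩ := Metric.eventually_nhds_iff.1 this
    exact ⟨δ', hδ', fun t ht => hball (by rwa [Real.dist_eq])⟩
  have hvlt : ∀ t ∈ Ico 0 (T + min δ δ'), v t ≤ M' := by
    intro t ht
    rcases le_total t T with htT | htT
    · rw [hvU t ⟨ht.1, htT⟩]
      linarith [(hUmem t).2]
    · refine (hδ'v t ?_).le
      rw [abs_of_nonneg (by linarith)]
      linarith [ht.2, min_le_right δ δ']
  have hsubI : ∀ t ∈ Ico 0 (T + min δ δ'), t ∈ Icc 0 (T + δ) := fun t ht =>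
    ⟨ht.1, by linarith [ht.2, min_le_left δ δ']⟩
  refine ⟨T + min δ δ', by linarith [lt_min hδ hδ'], v, ⟨v.continuous.continuousOn,
    fun t ht => hu₀.trans_le (hvge t (hsubI t ht)), fun t ht => ?_⟩, fun t ht => ?_⟩
  · rw [hveq t (hsubI t ht)]
    congr 2
    refine intervalIntegral.integral_congr fun s hs => ?_
    rw [uIcc_of_le ht.1] at hs
    have hs' : s ∈ Ico 0 (T + min δ δ') := ⟨hs.1, hs.2.trans_lt ht.2⟩
    rw [hWv s hs.1, hFeq _ ⟨hu₀.le.trans (hvge s (hsubI s hs')), hvlt s hs'⟩]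
  · rw [hvU t ⟨ht.1, ht.2.le⟩, hUu t ht]

end IsVolterraSol

lemma integral_sub_rpow_le {T t c : ℝ} (ht : t ∈ Ico 0 T) (hc : 0 < c) :
    ∫ s in (0:ℝ)..t, (T - s) ^ (-1 - c) ≤ (T - t) ^ (-c) / c := by
  have hTt : 0 < T - t := by linarith [ht.2]
  have hT : 0 < T := by linarith [ht.1]
  rw [intervalIntegral.integral_comp_sub_left (fun x => x ^ (-1 - c)) T, sub_zero,
    integral_rpow (Or.inr ⟨by linarith, ?_⟩), show -1 - c + 1 = -c by ring, div_neg, ← neg_div,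
    neg_sub]
  · gcongr
    linarith [Real.rpow_nonneg hT.le (-c)]
  · rw [uIcc_of_le (by linarith [ht.1])]
    exact fun h => absurd h.1 (by linarith)

/-- The scaled weighted history integral of a solution. -/
noncomputable def historyMode (γ p β T : ℝ) (u : ℝ → ℝ) (n : ℕ) (t : ℝ) : ℝ :=
  (T - t) ^ (β + n) * ∫ s in (0:ℝ)..t, (T - s) ^ (γ - 1 - n) * u s ^ p

namespace IsVolterraSol

variable {γ k p u₀ T β : ℝ} {u : ℝ → ℝ}

lemma continuousOn_weight (h : IsVolterraSol γ k p u₀ T u) (e : ℝ) :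
    ContinuousOn (fun s => (T - s) ^ e * u s ^ p) (Ico 0 T) := by
  refine ContinuousOn.mul ?_ (h.cont.rpow_const fun s hs => Or.inl (h.pos s hs).ne')
  exact (by fun_prop : Continuous fun s : ℝ => T - s).continuousOn.rpow_const
    fun s hs => Or.inl (sub_pos.2 hs.2).ne'

lemma intervalIntegrable_weight (h : IsVolterraSol γ k p u₀ T u) (e : ℝ) {t : ℝ}
    (ht : t ∈ Ico 0 T) :
    IntervalIntegrable (fun s => (T - s) ^ e * u s ^ p) volume 0 t := by
  refine ContinuousOn.intervalIntegrable ?_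
  rw [uIcc_of_le ht.1]
  exact (h.continuousOn_weight e).mono (Icc_subset_Ico le_rfl ht.2)

lemma scaled_rpow (h : IsVolterraSol γ k p u₀ T u) {t : ℝ} (ht : t ∈ Ico 0 T) (q : ℝ) :
    ((T - t) ^ β * u t) ^ q = (T - t) ^ (q * β) * u t ^ q := by
  have hTt : 0 < T - t := by linarith [ht.2]
  rw [Real.mul_rpow (by positivity) (h.pos t ht).le, ← Real.rpow_mul hTt.le, mul_comm β]

lemma exists_scaled_le (h : IsVolterraSol γ k p u₀ T u) (hγ : γ ∈ Ioo (0:ℝ) 1) (hk : 0 < k)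
    (hp : 1 < p) (hu₀ : 0 < u₀) (hβ : (p - 1) * β = γ) :
    ∃ M : ℝ, 0 < M ∧ ∀ t ∈ Ico 0 T, (T - t) ^ β * u t ≤ M := by
  have hp1 : 0 < p - 1 := by linarith
  refine ⟨(2 ^ γ / ((p - 1) * k * 2 ^ (-p))) ^ (1 / (p - 1)), by positivity, fun t ht => ?_⟩
  have hTt : 0 < T - t := by linarith [ht.2]
  have hut := h.pos t ht
  have h1 := h.rpow_mul_le_one hγ hk hp hu₀ (t := t) (d := (T - t) / 2) ht.1 (by linarith)
    (by linarith)
  rw [← Real.rpow_le_rpow_iff (by positivity) (by positivity) hp1, ← Real.rpow_mul (by positivity),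
    one_div_mul_cancel hp1.ne', Real.rpow_one, h.scaled_rpow ht, hβ, le_div_iff₀ (by positivity)]
  rw [Real.div_rpow hTt.le (by norm_num)] at h1
  have h2 : (0:ℝ) < 2 ^ γ := by positivity
  calc _ = 2 ^ γ * (u t ^ (p - 1) * ((p - 1) * k * 2 ^ (-p) * ((T - t) ^ γ / 2 ^ γ))) := by
        field_simp
    _ ≤ 2 ^ γ * 1 := by gcongr
    _ = _ := mul_one _

lemma exists_le_scaled (h : IsVolterraSol γ k p u₀ T u) (hγ : γ ∈ Ioo (0:ℝ) 1) (hk : 0 < k)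
    (hp : 1 < p) (htop : Tendsto u (nhdsWithin T (Iio T)) atTop) (hβ : (p - 1) * β = γ) :
    ∃ m : ℝ, 0 < m ∧ ∀ t ∈ Ico 0 T, m ≤ (T - t) ^ β * u t := by
  have hp1 : 0 < p - 1 := by linarith
  have hγ0 := hγ.1
  refine ⟨(γ / (k * 2 ^ p)) ^ (1 / (p - 1)), by positivity, fun t ht => ?_⟩
  have hTt : 0 < T - t := by linarith [ht.2]
  have hut := h.pos t ht
  have h1 := h.one_le_rpow_mul hγ hk hp htop ht
  rw [← Real.rpow_le_rpow_iff (by positivity) (by positivity) hp1, ← Real.rpow_mul (by positivity),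
    one_div_mul_cancel hp1.ne', Real.rpow_one, h.scaled_rpow ht, hβ, div_le_iff₀ (by positivity)]
  calc γ = γ * 1 := (mul_one _).symm
    _ ≤ γ * (u t ^ (p - 1) * (k * 2 ^ p / γ * (T - t) ^ γ)) := by gcongr
    _ = _ := by field_simp

lemma hasDerivAt_historyMode (h : IsVolterraSol γ k p u₀ T u) (hβ : (p - 1) * β = γ) (n : ℕ)
    {t : ℝ} (ht : t ∈ Ioo 0 T) :
    HasDerivAt (historyMode γ p β T u n)
      ((((T - t) ^ β * u t) ^ p - (β + n) * historyMode γ p β T u n t) / (T - t)) t := by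
  have ht' := Ioo_subset_Ico_self ht
  have hTt : 0 < T - t := by linarith [ht.2]
  have hco := h.continuousOn_weight (γ - 1 - n)
  have hG := intervalIntegral.integral_hasDerivAt_right
    (h.intervalIntegrable_weight (γ - 1 - n) ht')
    ((hco.mono Ioo_subset_Ico_self).stronglyMeasurableAtFilter isOpen_Ioo t ht)
    ((hco.mono Ioo_subset_Ico_self).continuousAt (isOpen_Ioo.mem_nhds ht))
  have hR := ((hasDerivAt_id t).const_sub T).rpow_const (p := β + n) (Or.inl hTt.ne')
  refine (hR.mul hG).congr_deriv ?_
  rw [h.scaled_rpow ht', historyMode, eq_div_iff hTt.ne']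
  have e1 : (T - t) ^ (p * β) = (T - t) ^ (β + n) * (T - t) ^ (γ - 1 - n) * (T - t) := by
    rw [← Real.rpow_add hTt, ← Real.rpow_add_one hTt.ne']
    congr 1
    linarith
  have e2 : (T - t) ^ (β + n) = (T - t) ^ (β + n - 1) * (T - t) := by
    rw [← Real.rpow_add_one hTt.ne']
    congr 1
    ring
  simp only [id]
  rw [e1]
  linear_combination (β + n) * (∫ s in (0:ℝ)..t, (T - s) ^ (γ - 1 - n) * u s ^ p) * e2

lemma historyMode_nonneg (h : IsVolterraSol γ k p u₀ T u) (n : ℕ) {t : ℝ} (ht : t ∈ Ico 0 T) :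
    0 ≤ historyMode γ p β T u n t := by
  refine mul_nonneg (Real.rpow_nonneg (by linarith [ht.2]) _)
    (intervalIntegral.integral_nonneg ht.1 fun s hs => ?_)
  have hs' : s ∈ Ico 0 T := ⟨hs.1, hs.2.trans_lt ht.2⟩
  exact mul_nonneg (Real.rpow_nonneg (by linarith [hs'.2]) _)
    (Real.rpow_nonneg (h.pos s hs').le _)

lemma historyMode_le (h : IsVolterraSol γ k p u₀ T u) (n : ℕ) {t c C : ℝ} (hc : 0 < c)
    (hC : 0 ≤ C) (ht : t ∈ Ico 0 T)
    (hle : ∀ s ∈ Icc 0 t, (T - s) ^ (γ - 1 - n) * u s ^ p ≤ C * (T - s) ^ (-1 - c)) :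
    c * historyMode γ p β T u n t ≤ C * (T - t) ^ (β + n - c) := by
  have hTt : 0 < T - t := by linarith [ht.2]
  have hi : IntervalIntegrable (fun s => C * (T - s) ^ (-1 - c)) volume 0 t := by
    refine ContinuousOn.intervalIntegrable ?_
    rw [uIcc_of_le ht.1]
    refine ContinuousOn.mul continuousOn_const ?_
    exact (by fun_prop : Continuous fun s : ℝ => T - s).continuousOn.rpow_const
      fun s hs => Or.inl (by linarith [hs.2])
  have h1 := intervalIntegral.integral_mono_on ht.1 (h.intervalIntegrable_weight _ ht) hi hle
  rw [intervalIntegral.integral_const_mul] at h1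
  have h2 := h1.trans (mul_le_mul_of_nonneg_left (integral_sub_rpow_le ht hc) hC)
  calc c * historyMode γ p β T u n t
      ≤ c * ((T - t) ^ (β + n) * (C * ((T - t) ^ (-c) / c))) := by
        rw [historyMode]
        gcongr
    _ = C * (T - t) ^ (β + n - c) := by
        rw [sub_eq_add_neg (β + n), Real.rpow_add hTt (β + n)]
        generalize (T - t) ^ (β + n) = x
        generalize (T - t) ^ (-c) = y
        field_simp

lemma historyMode_le_of_scaled_le (h : IsVolterraSol γ k p u₀ T u) (hp : 1 < p)
    (hβ0 : 0 < β) (hβ : (p - 1) * β = γ) {M : ℝ} (hM0 : 0 < M)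
    (hM : ∀ t ∈ Ico 0 T, (T - t) ^ β * u t ≤ M) (n : ℕ) {t : ℝ} (ht : t ∈ Ico 0 T) :
    (β + n) * historyMode γ p β T u n t ≤ M ^ p := by
  have h1 := h.historyMode_le (β := β) n (c := β + n) (C := M ^ p) (by positivity) (by positivity)
    ht fun s hs => ?_
  · rwa [sub_self, Real.rpow_zero, mul_one] at h1
  · have hs' : s ∈ Ico 0 T := ⟨hs.1, hs.2.trans_lt ht.2⟩
    have hTs : 0 < T - s := by linarith [hs'.2]
    have hus := h.pos s hs'
    have h2 : ((T - s) ^ β * u s) ^ p ≤ M ^ p :=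
      Real.rpow_le_rpow (by positivity) (hM s hs') (by linarith)
    rw [h.scaled_rpow hs'] at h2
    calc (T - s) ^ (γ - 1 - n) * u s ^ p
        = (T - s) ^ (p * β) * u s ^ p * (T - s) ^ (-1 - (β + n)) := by
          rw [mul_right_comm, ← Real.rpow_add hTs]
          congr 2
          linarith
      _ ≤ _ := by gcongr

lemma historyMode_le_scaled (h : IsVolterraSol γ k p u₀ T u) (hγ : γ ∈ Ioo (0:ℝ) 1) (hk : 0 < k)
    (hp : 1 < p) (hβ : (p - 1) * β = γ) {n : ℕ} (hn : n ≠ 0) {t : ℝ} (ht : t ∈ Ico 0 T) :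
    (n - γ) * historyMode γ p β T u n t ≤ ((T - t) ^ β * u t) ^ p := by
  have hn1 : (1:ℝ) ≤ n := by exact_mod_cast Nat.one_le_iff_ne_zero.2 hn
  have hut := h.pos t ht
  have h1 := h.historyMode_le (β := β) n (c := n - γ) (C := u t ^ p) (by linarith [hγ.2])
    (by positivity) ht fun s hs => ?_
  · rwa [show β + n - (n - γ) = p * β by linarith, mul_comm (u t ^ p), ← h.scaled_rpow ht] at h1
  · have hs' : s ∈ Ico 0 T := ⟨hs.1, hs.2.trans_lt ht.2⟩
    have hTs : 0 < T - s := by linarith [hs'.2]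
    have hus := h.pos s hs'
    rw [mul_comm, show -1 - ((n:ℝ) - γ) = γ - 1 - n by ring]
    have := h.monotoneOn hγ.1 hk (by linarith) hs' ht hs.2
    gcongr

lemma historyMode_slack (h : IsVolterraSol γ k p u₀ T u) (hγ : γ ∈ Ioo (0:ℝ) 1) (hk : 0 < k)
    (hp : 1 < p) (hβ0 : 0 < β) (hβ : (p - 1) * β = γ) {M : ℝ} (hM0 : 0 < M)
    (hM : ∀ t ∈ Ico 0 T, (T - t) ^ β * u t ≤ M) (n : ℕ) {t : ℝ} (ht : t ∈ Ico 0 T) :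
    (β + n) * historyMode γ p β T u n t ≤ ((T - t) ^ β * u t) ^ p
      + (M ^ p * β + M ^ p * ((β + γ) * (β + 1) / (1 - γ))) / (β + n) := by
  have hγ0 := hγ.1
  have hγ1 : 0 < 1 - γ := by linarith [hγ.2]
  have hTt : 0 < T - t := by linarith [ht.2]
  have hut := h.pos t ht
  have hψ : 0 ≤ ((T - t) ^ β * u t) ^ p := by positivity
  rcases eq_or_ne n 0 with rfl | hn
  · have h1 := h.historyMode_le_of_scaled_le hp hβ0 hβ hM0 hM 0 ht
    have h2 : M ^ p ≤ (M ^ p * β + M ^ p * ((β + γ) * (β + 1) / (1 - γ))) / (β + (0:ℕ)) := by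
      rw [Nat.cast_zero, add_zero, le_div_iff₀ hβ0]
      have : 0 ≤ M ^ p * ((β + γ) * (β + 1) / (1 - γ)) := by positivity
      linarith
    exact h1.trans (h2.trans (le_add_of_nonneg_left hψ))
  · have hn1 : (1:ℝ) ≤ n := by exact_mod_cast Nat.one_le_iff_ne_zero.2 hn
    have hnγ : 0 < n - γ := by linarith
    have h1 := h.historyMode_le_scaled hγ hk hp hβ hn ht
    have h2 : ((T - t) ^ β * u t) ^ p ≤ M ^ p :=
      Real.rpow_le_rpow (by positivity) (hM t ht) (by linarith)
    have h3 : historyMode γ p β T u n t ≤ M ^ p * (((β + 1) / (1 - γ)) / (β + n)) := by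
      have : historyMode γ p β T u n t ≤ M ^ p / (n - γ) := by
        rw [le_div_iff₀ hnγ, mul_comm]
        exact h1.trans h2
      refine this.trans ?_
      rw [div_eq_mul_one_div]
      refine mul_le_mul_of_nonneg_left ?_ (by positivity)
      rw [div_div, div_le_div_iff₀ hnγ (by positivity)]
      nlinarith [mul_nonneg (add_pos hβ0 hγ0).le (sub_nonneg.2 hn1)]
    have h4 : 0 ≤ M ^ p * β / (β + n) := by positivity
    calc (β + n) * historyMode γ p β T u n t
        = (n - γ) * historyMode γ p β T u n t + (β + γ) * historyMode γ p β T u n t := by ring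
      _ ≤ ((T - t) ^ β * u t) ^ p
          + (β + γ) * (M ^ p * (((β + 1) / (1 - γ)) / (β + n))) := by gcongr
      _ ≤ ((T - t) ^ β * u t) ^ p
          + (β + γ) * (M ^ p * (((β + 1) / (1 - γ)) / (β + n))) + M ^ p * β / (β + n) := by linarith
      _ = _ := by ring

lemma hasSum_historyMode (h : IsVolterraSol γ k p u₀ T u) (hγ : γ ∈ Ioo (0:ℝ) 1)
    {t : ℝ} (ht : t ∈ Ico 0 T) :
    HasSum (fun n => k * kernelCoeff γ n * historyMode γ p β T u n t)
      ((T - t) ^ β * u t - u₀ * (T - t) ^ β) := by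
  have hTt : 0 < T - t := by linarith [ht.2]
  have hIoo : ∀ s ∈ Ioo 0 t, s ∈ Ico 0 T := fun s hs => ⟨hs.1.le, hs.2.trans ht.2⟩
  have h1 := hasSum_intervalIntegral_of_nonneg ht.1
    (F := fun n s => kernelCoeff γ n * (T - t) ^ n * ((T - s) ^ (γ - 1 - n) * u s ^ p))
    (f := fun s => (t - s) ^ (γ - 1) * u s ^ p) ?_ ?_
    (h.intervalIntegrable hγ.1 le_rfl ht.1 ht.2 t) ?_
  · have h2 := h1.mul_left ((T - t) ^ β * k)
    have e : (T - t) ^ β * u t - u₀ * (T - t) ^ β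
        = (T - t) ^ β * k * ∫ s in (0:ℝ)..t, (t - s) ^ (γ - 1) * u s ^ p := by
      rw [h.eq t ht]
      ring
    rw [e]
    refine h2.congr_fun fun n => ?_
    rw [intervalIntegral.integral_const_mul, historyMode, Real.rpow_add hTt, Real.rpow_natCast]
    ring
  · intro n
    refine AEStronglyMeasurable.const_mul ?_ _
    exact ((h.continuousOn_weight (γ - 1 - n)).mono hIoo).aestronglyMeasurable measurableSet_Ioo
  · intro n s hs
    have hTs : 0 < T - s := by linarith [(hIoo s hs).2]
    have := h.pos s (hIoo s hs)
    have := kernelCoeff_pos hγ.2 n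
    positivity
  · intro s hs
    have hTs : 0 < T - s := by linarith [(hIoo s hs).2]
    have hz : |(T - t) / (T - s)| < 1 := by
      rw [abs_of_pos (by positivity), div_lt_one hTs]
      linarith [hs.2]
    have h2 := (hasSum_kernelCoeff γ hz).mul_right ((T - s) ^ (γ - 1) * u s ^ p)
    have e : 1 - (T - t) / (T - s) = (t - s) / (T - s) := by
      field_simp
      ring
    have hne := (Real.rpow_pos_of_pos hTs (γ - 1)).ne'
    rw [e, Real.div_rpow (by linarith [hs.2]) hTs.le, ← mul_assoc, div_mul_cancel₀ _ hne] at h2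
    refine h2.congr_fun fun n => ?_
    rw [div_pow, Real.rpow_sub hTs, Real.rpow_natCast]
    ring

lemma scaled_rpow_sub_le (h : IsVolterraSol γ k p u₀ T u) (hγ : 0 < γ) (hk : 0 < k)
    (hp : 1 < p) (hβ0 : 0 < β) {M : ℝ}
    (hM : ∀ t ∈ Ico 0 T, (T - t) ^ β * u t ≤ M) {t r d : ℝ} (ht : t ∈ Ico 0 T)
    (htr : t ≤ r) (hd : 0 ≤ d) (hr : T - r = Real.exp (-d) * (T - t)) :
    ((T - t) ^ β * u t) ^ p - ((T - r) ^ β * u r) ^ p ≤ p * β * M ^ p * d := by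
  have hTt : 0 < T - t := by linarith [ht.2]
  have hr' : r ∈ Ico 0 T := by
    have : 0 < T - r := hr ▸ by positivity
    exact ⟨ht.1.trans htr, by linarith⟩
  have hut := h.pos t ht
  have hur := h.pos r hr'
  have hmono := h.monotoneOn hγ hk (by linarith) ht hr' htr
  have h1 : ((T - t) ^ β * u t) ^ p ≤ M ^ p :=
    Real.rpow_le_rpow (by positivity) (hM t ht) (by linarith)
  have h2 : Real.exp (-(p * β * d)) * ((T - t) ^ β * u t) ^ p ≤ ((T - r) ^ β * u r) ^ p := by
    rw [h.scaled_rpow ht, h.scaled_rpow hr', hr, Real.mul_rpow (Real.exp_pos _).le hTt.le,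
      ← Real.exp_mul, ← mul_assoc, show -d * (p * β) = -(p * β * d) by ring]
    gcongr
  have h3 := Real.add_one_le_exp (-(p * β * d))
  have h4 : 0 ≤ ((T - t) ^ β * u t) ^ p := by positivity
  have h5 : 0 ≤ p * β * d := by positivity
  nlinarith [mul_le_mul_of_nonneg_right h3 h4, mul_le_mul_of_nonneg_left h1 h5]

/-- The blow-up profile of a solution that tends to infinity. -/
theorem tendsto_scaled (h : IsVolterraSol γ k p u₀ T u) (hγ : γ ∈ Ioo (0:ℝ) 1) (hk : 0 < k)
    (hp : 1 < p) (hu₀ : 0 < u₀) (hT : 0 < T) (htop : Tendsto u (nhdsWithin T (Iio T)) atTop) :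
    Tendsto (fun t => (T - t) ^ (γ / (p - 1)) * u t) (nhdsWithin T (Iio T))
      (nhds ((1 / (k * ProbabilityTheory.beta (γ / (p - 1)) γ)) ^ (1 / (p - 1)))) := by
  have hp1 : 0 < p - 1 := by linarith
  set β := γ / (p - 1) with hβdef
  have hβ : (p - 1) * β = γ := mul_div_cancel₀ _ hp1.ne'
  have hβ0 : 0 < β := div_pos hγ.1 hp1
  obtain ⟨M, hM0, hM⟩ := h.exists_scaled_le hγ hk hp hu₀ hβ
  obtain ⟨m, hm0, hm⟩ := h.exists_le_scaled hγ hk hp htop hβ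
  set τ : ℝ → ℝ := fun x => T - Real.exp (-x) with hτ
  have hτx : ∀ x, T - τ x = Real.exp (-x) := fun x => sub_sub_cancel _ _
  have hτmem : ∀ x, -Real.log T + 1 ≤ x → τ x ∈ Ioo 0 T := fun x hx => by
    refine ⟨?_, ?_⟩
    · have : Real.exp (-x) < T := by
        rw [← Real.lt_log_iff_exp_lt hT]
        linarith
      exact sub_pos.2 this
    · exact sub_lt_self _ (Real.exp_pos _)
  have hτmem' : ∀ x, -Real.log T + 1 ≤ x → τ x ∈ Ico 0 T := fun x hx =>
    Ioo_subset_Ico_self (hτmem x hx)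
  have hτd : ∀ x, HasDerivAt τ (T - τ x) x := fun x => by
    rw [hτx]
    simpa using ((hasDerivAt_neg x).exp.const_sub T)
  have hsys : IsRelaxationSystem (fun n => k * kernelCoeff γ n) (fun n => β + n) p β m M
      (p * β * M ^ p) (M ^ p * β + M ^ p * ((β + γ) * (β + 1) / (1 - γ))) (-Real.log T + 1)
      (fun x => u₀ * (T - τ x) ^ β) (fun x => (T - τ x) ^ β * u (τ x))
      (fun n x => historyMode γ p β T u n (τ x)) := by
    have hγ0 := hγ.1
    have hγ1 : 0 < 1 - γ := by linarith [hγ.2]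
    constructor
    case one_lt => exact hp
    case rate_nonneg => exact hβ0.le
    case m_pos => exact hm0
    case D_nonneg => positivity
    case a_pos => exact fun n => mul_pos hk (kernelCoeff_pos hγ.2 n)
    case b_pos => intro n; positivity
    case summable =>
      simpa only [mul_div_assoc] using ((hasSum_kernelCoeff_div hγ hβ0).mul_left k).summable
    case cont =>
      simp only [hτx]
      refine ContinuousOn.mul ?_ ?_
      · exact ((by fun_prop : Continuous fun x : ℝ => Real.exp (-x)).rpow_const
          fun x => Or.inl (Real.exp_pos _).ne').continuousOn
      · exact h.cont.comp (by fun_prop) hτmem'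
    case lower => exact fun x hx => hm _ (hτmem' x hx)
    case upper => exact fun x hx => hM _ (hτmem' x hx)
    case hasDerivAt =>
      intro n x hx
      refine ((h.hasDerivAt_historyMode hβ n (hτmem x hx)).comp x (hτd x)).congr_deriv ?_
      exact div_mul_cancel₀ _ (sub_pos.2 (hτmem x hx).2).ne'
    case nonneg => exact fun n x hx => h.historyMode_nonneg n (hτmem' x hx)
    case bound => exact fun n x hx => h.historyMode_le_of_scaled_le hp hβ0 hβ hM0 hM n (hτmem' x hx)
    case slack => exact fun n x hx => h.historyMode_slack hγ hk hp hβ0 hβ hM0 hM n (hτmem' x hx)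
    case lip =>
      intro x y hx hxy
      refine h.scaled_rpow_sub_le hγ.1 hk hp hβ0 hM (hτmem' x hx) ?_ (sub_nonneg.2 hxy) ?_
      · exact sub_le_sub_left (Real.exp_le_exp.2 (neg_le_neg hxy)) T
      · rw [hτx, hτx, ← Real.exp_add]
        congr 1
        ring
    case eps_nonneg =>
      intro x _
      rw [hτx]
      positivity
    case eps_deriv =>
      intro x _
      simp only [hτx, ← Real.exp_mul]
      have := (((hasDerivAt_neg x).mul_const β).exp).const_mul u₀
      refine this.congr_deriv ?_
      ring
    case eps_tendsto =>
      simp only [hτx, ← Real.exp_mul]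
      have : Tendsto (fun x : ℝ => -x * β) atTop atBot :=
        tendsto_neg_atTop_atBot.atBot_mul_const hβ0
      simpa using (Real.tendsto_exp_atBot.comp this).const_mul u₀
    case hasSum => exact fun x hx => h.hasSum_historyMode hγ (hτmem' x hx)
  have hlim := hsys.tendsto (mul_pos hk (ProbabilityTheory.beta_pos hβ0 hγ.1))
    (by simpa only [mul_div_assoc] using (hasSum_kernelCoeff_div hγ hβ0).mul_left k)
  have hlog : Tendsto (fun t => -Real.log (T - t)) (nhdsWithin T (Iio T)) atTop := by
    refine tendsto_neg_atBot_atTop.comp (Real.tendsto_log_nhdsGT_zero.comp ?_)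
    refine tendsto_nhdsWithin_iff.2 ⟨?_, ?_⟩
    · have : Tendsto (fun t => T - t) (nhds T) (nhds (T - T)) :=
        (by fun_prop : Continuous fun t : ℝ => T - t).tendsto T
      rw [sub_self] at this
      exact this.mono_left nhdsWithin_le_nhds
    · filter_upwards [self_mem_nhdsWithin] with t ht using mem_Ioi.2 (sub_pos.2 (mem_Iio.1 ht))
  refine (hlim.comp hlog).congr' ?_
  filter_upwards [self_mem_nhdsWithin] with t ht
  have hTt : 0 < T - t := sub_pos.2 ht
  have : τ (-Real.log (T - t)) = t := by
    simp only [hτ, neg_neg, Real.exp_log hTt, sub_sub_cancel]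
  simp only [Function.comp_apply, this]

end IsVolterraSol

/-- For `A > 0`, `p > 1`, the maximal solution of `D_c^γ u = A u^p`
blows up in finite time `T_b < ∞` with
`u(t) ∼ [Γ(pγ/(p−1))/(A Γ(γ/(p−1)))]^{1/(p−1)} (T_b − t)^{−γ/(p−1)}` as `t → T_b⁻`. -/
theorem fractional_ode_blowup_asymptotics
    (γ A p u₀ : ℝ) (hγ : γ ∈ Set.Ioo (0:ℝ) 1) (hA : 0 < A) (hp : 1 < p) (hu₀ : 0 < u₀)
    (Tb : ℝ≥0∞) (hTb : 0 < Tb) (u : ℝ → ℝ)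
    (hu0 : u 0 = u₀)
    (hpos : ∀ t : ℝ, 0 ≤ t → ENNReal.ofReal t < Tb → 0 < u t)
    (hcont : ContinuousOn u {t : ℝ | 0 ≤ t ∧ ENNReal.ofReal t < Tb})
    (heq : ∀ t : ℝ, 0 ≤ t → ENNReal.ofReal t < Tb →
      u t = u₀ + (A / Real.Gamma γ) * ∫ s in (0:ℝ)..t, (t - s) ^ (γ - 1) * u s ^ p)
    (hmax : ¬ ∃ (T' : ℝ≥0∞) (v : ℝ → ℝ), Tb < T' ∧
      v 0 = u₀ ∧
      (∀ t : ℝ, 0 ≤ t → ENNReal.ofReal t < T' → 0 < v t) ∧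
      ContinuousOn v {t : ℝ | 0 ≤ t ∧ ENNReal.ofReal t < T'} ∧
      (∀ t : ℝ, 0 ≤ t → ENNReal.ofReal t < T' →
        v t = u₀ + (A / Real.Gamma γ) * ∫ s in (0:ℝ)..t, (t - s) ^ (γ - 1) * v s ^ p) ∧
      (∀ t : ℝ, 0 ≤ t → ENNReal.ofReal t < Tb → v t = u t)) :
    Tb ≠ ⊤ ∧
    Filter.Tendsto u (nhdsWithin Tb.toReal (Set.Iio Tb.toReal)) Filter.atTop ∧
    Filter.Tendsto (fun t => (Tb.toReal - t) ^ (γ / (p - 1)) * u t)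
      (nhdsWithin Tb.toReal (Set.Iio Tb.toReal))
      (nhds ((Real.Gamma (p * γ / (p - 1)) / (A * Real.Gamma (γ / (p - 1)))) ^ (1 / (p - 1)))) := by
  have hγ0 := hγ.1
  have hk : 0 < A / Real.Gamma γ := div_pos hA (Real.Gamma_pos_of_pos hγ0)
  have hp1 : 0 < p - 1 := by linarith
  have hsol : ∀ T : ℝ, (∀ t ∈ Ico 0 T, ENNReal.ofReal t < Tb) →
      IsVolterraSol γ (A / Real.Gamma γ) p u₀ T u := fun T hT =>
    ⟨hcont.mono fun t ht => ⟨ht.1, hT t ht⟩, fun t ht => hpos t ht.1 (hT t ht),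
      fun t ht => heq t ht.1 (hT t ht)⟩
  have hfin : Tb ≠ ⊤ := by
    rintro rfl
    set c := u 0 ^ (p - 1) * ((p - 1) * (A / Real.Gamma γ) * 2 ^ (-p)) with hc
    have hc0 : 0 < c := by
      rw [hc, hu0]
      positivity
    have h1 := (hsol ((2 / c) ^ (1 / γ) + 1) fun t _ => ENNReal.ofReal_lt_top).rpow_mul_le_one
      (t := 0) (d := (2 / c) ^ (1 / γ)) hγ hk hp hu₀ le_rfl (by positivity) (by linarith)
    rw [← mul_assoc, ← hc, ← Real.rpow_mul (by positivity), one_div_mul_cancel hγ0.ne',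
      Real.rpow_one, mul_div_cancel₀ _ hc0.ne'] at h1
    norm_num at h1
  have hT : 0 < Tb.toReal := ENNReal.toReal_pos hTb.ne' hfin
  have hlt : ∀ t : ℝ, ENNReal.ofReal t < Tb ↔ t < Tb.toReal := fun t =>
    ⟨fun ht => by
      by_contra hcon
      exact absurd (ENNReal.ofReal_le_ofReal (not_lt.1 hcon))
        (by rwa [ENNReal.ofReal_toReal hfin, not_le]),
    fun ht => by
      rw [← ENNReal.ofReal_toReal hfin]
      exact (ENNReal.ofReal_lt_ofReal_iff hT).2 ht⟩
  have h := hsol Tb.toReal fun t ht => (hlt t).2 ht.2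
  have hunb : ∀ M : ℝ, ∃ t ∈ Ico 0 Tb.toReal, M < u t := by
    by_contra! hcon
    obtain ⟨M, hM⟩ := hcon
    obtain ⟨T', hT', v, hv, hvu⟩ := h.exists_extension hT hγ0 hk hp hu₀ hM
    have hlt' : ∀ t : ℝ, ENNReal.ofReal t < ENNReal.ofReal T' → t < T' := fun t ht =>
      (ENNReal.ofReal_lt_ofReal_iff (hT.trans hT')).1 ht
    refine hmax ⟨ENNReal.ofReal T', v, ?_, ?_, fun t h0 ht => hv.pos t ⟨h0, hlt' t ht⟩,
      hv.cont.mono fun t ht => ⟨ht.1, hlt' t ht.2⟩, fun t h0 ht => hv.eq t ⟨h0, hlt' t ht⟩,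
      fun t h0 ht => hvu t ⟨h0, (hlt t).1 ht⟩⟩
    · rw [← ENNReal.ofReal_toReal hfin]
      exact (ENNReal.ofReal_lt_ofReal_iff (hT.trans hT')).2 hT'
    · rw [hvu 0 ⟨le_rfl, hT⟩, hu0]
  have htop : Tendsto u (nhdsWithin Tb.toReal (Iio Tb.toReal)) atTop := by
    refine tendsto_atTop.2 fun M => ?_
    obtain ⟨r, hr, hMr⟩ := hunb M
    filter_upwards [Ioo_mem_nhdsLT hr.2] with t ht
    exact hMr.le.trans (h.monotoneOn hγ0 hk (by linarith) hr ⟨hr.1.trans ht.1.le, ht.2⟩ ht.1.le)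
  refine ⟨hfin, htop, ?_⟩
  have hlim := h.tendsto_scaled hγ hk hp hu₀ hT htop
  have hB : 1 / (A / Real.Gamma γ * ProbabilityTheory.beta (γ / (p - 1)) γ)
      = Real.Gamma (p * γ / (p - 1)) / (A * Real.Gamma (γ / (p - 1))) := by
    have hβ0 : 0 < γ / (p - 1) := div_pos hγ0 hp1
    have e : p * γ / (p - 1) = γ / (p - 1) + γ := by
      field_simp
      ring
    have h1 := (Real.Gamma_pos_of_pos hγ0).ne'
    have h2 := (Real.Gamma_pos_of_pos hβ0).ne'
    have h3 := (Real.Gamma_pos_of_pos (add_pos hβ0 hγ0)).ne'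
    rw [e, ProbabilityTheory.beta]
    generalize Real.Gamma γ = x at *
    generalize Real.Gamma (γ / (p - 1)) = y at *
    generalize Real.Gamma (γ / (p - 1) + γ) = z at *
    field_simp
  rwa [hB] at hlim
end
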